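/- Let p be a prime and 𝔽_{p^4} the field with p^4 elements. A polynomial F ∈ 𝔽_{p^4}[x] with #V_F ≥ 3 is an MVSP if and only if there exist α, β, γ, δ ∈ 𝔽_{p^4} with α ≠ 0 and γ ≠ 0 such that G(x) = γ·F(αx + β) + δ is of one of the following types: (i) G = x^v, where v is a divisor of p^4 − 1 with v ≠ p^4 − 1; (ii) G = g^t, where t is a divisor of p − 1 with t ≠ p − 1 and g is a nonconstant polynomial of the form a·x^{p³+p²+p+1} + b·x^{p³+p²+p} + b^p·x^{p³+p²+1} + b^{p²}·x^{p³+p+1} + b^{p³}·x^{p²+p+1} + c·x^{p³+p²} + c^p·x^{p³+1} + c^{p²}·x^{p+1} + c^{p³}·x^{p²+p} + d·x^{p³+p} + d^p·x^{p²+1} + e·x^{p³} + e^p·x + e^{p²}·x^p + e^{p³}·x^{p²} + f, with a^p = a, f^p = f, d^{p²} = d, and b, c, e ∈ 𝔽_{p^4}; (iii) G = g^t, where t is a divisor of p² − 1 with t ≠ p² − 1 and g is a nonconstant polynomial of the form a·x^{p²+1} + b·x^{p²} + b^{p²}·x + c, with a^{p²} = a, c^{p²} = c, and b ∈ 𝔽_{p^4};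 (iv) G = (x^{p²} + (1 + (β₀^{p³} − β₀^{p²})^{p−1})·x^p − ((β₀^p − β₀)^{p−1})^{−1}·x)^v, where β₀ ∈ 𝔽_{p^4} satisfies β₀^p ≠ β₀ and v divides p − 1; (v) G = (x^p − x)^v, where v divides p − 1. -/

import Mathlib

open Polynomial

/-- The value set of a polynomial over a finite field. -/
def valueSet {F : Type*} [Field F] [Fintype F] [DecidableEq F] (f : F[X]) : Finset F :=
  Finset.image (fun a => f.eval a) Finset.univ

/-- A minimal value set polynomial (MVSP): a nonconstant polynomial whose value set has
the minimal possible size `⌊(q-1)/deg f⌋ + 1`. -/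
def IsMVSP {F : Type*} [Field F] [Fintype F] [DecidableEq F] (f : F[X]) : Prop :=
  0 < f.natDegree ∧ (valueSet f).card = (Fintype.card F - 1) / f.natDegree + 1

/-- `MVSPset S` is the set `𝒫(S, q)` of all MVSPs with value set `S`. -/
def MVSPset {F : Type*} [Field F] [Fintype F] [DecidableEq F] (S : Finset F) : Set F[X] :=
  {f | IsMVSP f ∧ valueSet f = S}

/-- `U` is a subspace over the subfield `{c : c ^ r = c}` (with `r = p ^ k`):
an additive subgroup closed under multiplication by elements of that subfield. -/
def IsSubspaceOver {F : Type*} [Field F] (r : ℕ) (U : Set F) : Prop :=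
  (0 : F) ∈ U ∧ (∀ x ∈ U, ∀ y ∈ U, x + y ∈ U) ∧ (∀ x ∈ U, -x ∈ U) ∧
    (∀ c : F, c ^ r = c → ∀ x ∈ U, c * x ∈ U)

/-- An `r`-linearized polynomial (with `r = q` or `r = p ^ k`): of the form `Σ aᵢ x ^ (r ^ i)`. -/
def IsLinearized {F : Type*} [Field F] (r : ℕ) (M : F[X]) : Prop :=
  ∃ (s : ℕ) (a : ℕ → F), M = ∑ i ∈ Finset.range (s + 1), C (a i) * X ^ r ^ i

section basics
set_option linter.unusedSectionVars false
variable {K : Type} [Field K] [Fintype K]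

theorem pth_root (p : ℕ) [hp : Fact p.Prime] [CharP K p] (f : K[X]) (h : derivative f = 0) :
    ∃ g : K[X], f = g ^ p := by
  have h1 := Polynomial.expand_contract p h hp.out.ne_zero
  refine ⟨(contract p f).map (frobeniusEquiv K p).symm, ?_⟩
  conv_lhs => rw [← h1, polynomial_expand_eq]

theorem deriv_pow_p (p : ℕ) [CharP K p] (f : K[X]) : derivative (f ^ p) = 0 := by
  simp [derivative_pow]

theorem frob_inj (p : ℕ) [hp : Fact p.Prime] [CharP K p] {f g : K[X]} (h : f ^ p = g ^ p) : f = g := 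
  frobenius_inj K[X] p h

theorem frob_neg (p : ℕ) [hp : Fact p.Prime] [CharP K p] {f g : K[X]} (h : f ^ p + g ^ p = 0) : f + g = 0 := by
  rw [← add_pow_char] at h
  exact pow_eq_zero_iff hp.out.ne_zero |>.1 h

theorem digits (F : K[X]) (hF : 0 < F.natDegree) (m : ℕ) : ∀ (c : ℕ → K[X]),
    (∀ j, j < m → (c j).natDegree < F.natDegree) →
    ∑ j ∈ Finset.range m, c j * F ^ j = 0 → ∀ j, j < m → c j = 0 := by
  induction m with
  | zero => intro c _ _ j hj; omega
  | succ m ih =>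
    intro c hc hs j hj
    rw [Finset.sum_range_succ'] at hs
    have hF0 : F ≠ 0 := by rintro rfl; simp at hF
    have e : ∑ k ∈ Finset.range m, c (k+1) * F ^ (k+1) = (∑ k ∈ Finset.range m, c (k+1) * F ^ k) * F := by
      rw [Finset.sum_mul]; refine Finset.sum_congr rfl fun k _ => by ring
    rw [e] at hs
    have hd : F ∣ c 0 := by
      refine ⟨-∑ k ∈ Finset.range m, c (k+1) * F ^ k, ?_⟩
      linear_combination hs
    have h0 : c 0 = 0 := eq_zero_of_dvd_of_natDegree_lt hd (hc 0 (by omega))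
    rw [h0] at hs
    simp only [zero_mul, add_zero, mul_eq_zero, hF0, or_false] at hs
    rcases j with _ | j
    · exact h0
    · exact ih (fun k => c (k+1)) (fun k hk => hc (k+1) (by omega)) hs j (by omega)

theorem dvd_deriv {f : K[X]} (h : f ∣ derivative f) : derivative f = 0 := by
  by_contra h0
  have := natDegree_le_of_dvd h h0
  rcases Nat.eq_zero_or_pos f.natDegree with h1 | h1
  · rw [eq_C_of_natDegree_eq_zero h1] at h0; simp at h0
  · have := natDegree_derivative_lt (p := f) (by omega)
    omega

theorem natDegree_deriv_le (f : K[X]) : (derivative f).natDegree ≤ f.natDegree - 1 :=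
  natDegree_derivative_le f

/-- L squarefree-ish: `L·M' = (a-1) L' M` gives `M = L^(a-1) N^p`. -/
theorem log_deriv (p : ℕ) [hp : Fact p.Prime] [CharP K p] (L M : K[X]) (hL : Squarefree L) (b : ℕ) (hb : b < p)
    (h : L * derivative M = C (b : K) * (derivative L * M)) : ∃ N : K[X], M = L ^ b * N ^ p := by
  have hL0 : L ≠ 0 := hL.ne_zero
  have h1 : derivative (L ^ (p - b) * M) = 0 := by
    rw [derivative_mul, derivative_pow]
    obtain ⟨k, hk⟩ : ∃ k, p - b = k + 1 := ⟨p - b - 1, by omega⟩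
    have hkk : ((k : K) + 1) = - (b : K) := by
      have : ((p : ℕ) : K) = ((b + (k + 1) : ℕ) : K) := by congr 1; omega
      rw [CharP.cast_eq_zero] at this
      push_cast at this
      linear_combination -this
    rw [hk]
    simp only [Nat.cast_add, Nat.cast_one, Nat.add_sub_cancel, hkk, pow_succ]
    simp only [map_neg]
    linear_combination L ^ k * h
  obtain ⟨G, hG⟩ := pth_root p _ h1
  have h2 : L ∣ G := by
    have : L ∣ G ^ p := by
      rw [← hG]; exact Dvd.dvd.mul_right (dvd_pow_self _ (by omega)) _
    exact (hL.dvd_pow_iff_dvd hp.out.ne_zero).1 this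
  obtain ⟨N, rfl⟩ := h2
  refine ⟨N, ?_⟩
  have h3 : L ^ (p - b) * M = L ^ (p - b) * (L ^ b * N ^ p) := by
    rw [hG, mul_pow, ← mul_assoc, ← pow_add]; congr 2; omega
  exact mul_left_cancel₀ (pow_ne_zero _ hL0) h3

end basics

section partA
set_option linter.unusedSectionVars false
variable {K : Type} [Field K] [Fintype K] [DecidableEq K]

/-- The reduced fibre polynomial. -/
noncomputable def Lf (F : K[X]) (g : K) : K[X] :=
  ∏ a ∈ Finset.univ.filter (fun a => F.eval a = g), (X - C a)

theorem Lf_monic (F : K[X]) (g : K) : (Lf F g).Monic := monic_prod_X_sub_C _ _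

theorem dvd_of_roots (S : Finset K) (E : K[X]) (h : ∀ a ∈ S, E.eval a = 0) :
    ∏ a ∈ S, (X - C a) ∣ E := by
  refine Finset.prod_dvd_of_coprime ?_ ?_
  · intro a _ b _ hab
    exact isCoprime_X_sub_C_of_isUnit_sub (sub_ne_zero.2 hab).isUnit
  · intro a ha
    exact dvd_iff_isRoot.2 (h a ha)

theorem Lf_dvd_of (F : K[X]) (g : K) (E : K[X]) (h : ∀ a, F.eval a = g → E.eval a = 0) :
    Lf F g ∣ E :=
  dvd_of_roots _ _ (fun a ha => h a (by simpa using ha))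

theorem Lf_dvd (F : K[X]) (g : K) : Lf F g ∣ F - C g :=
  Lf_dvd_of F g _ (fun a h => by simp [h])

theorem prod_univ : ∏ a : K, (X - C a) = X ^ Fintype.card K - (X : K[X]) := by
  have h := FiniteField.roots_X_pow_card_sub_X K
  have hd := FiniteField.X_pow_card_sub_X_natDegree_eq K (Fintype.one_lt_card (α := K))
  have hm : (X ^ Fintype.card K - (X : K[X])).Monic := by
    apply monic_X_pow_sub
    rw [degree_X]; exact_mod_cast Fintype.one_lt_card
  have := prod_multiset_X_sub_C_of_monic_of_roots_card_eq hm (by rw [h, hd]; rfl)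
  rw [h] at this
  exact this

theorem prod_Lf (F : K[X]) : ∏ g ∈ valueSet F, Lf F g = X ^ Fintype.card K - (X : K[X]) := by
  rw [← prod_univ]
  unfold Lf
  exact Finset.prod_fiberwise_of_maps_to (g := fun a => F.eval a)
    (fun a _ => Finset.mem_image_of_mem _ (Finset.mem_univ a)) _

theorem card_cast_zero : ((Fintype.card K : ℕ) : K) = 0 := by simp

theorem deriv_Q : derivative (X ^ Fintype.card K - (X : K[X])) = -1 := by
  simp [derivative_X_pow]

theorem Q_squarefree : Squarefree (X ^ Fintype.card K - (X : K[X])) := by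
  apply Separable.squarefree
  rw [separable_def, deriv_Q]
  exact ⟨0, -1, by ring⟩

theorem Lf_dvd_Q (F : K[X]) (g : K) : Lf F g ∣ X ^ Fintype.card K - (X : K[X]) :=
  Lf_dvd_of F g _ (fun a _ => by simp [FiniteField.pow_card])

theorem Lf_squarefree (F : K[X]) (g : K) : Squarefree (Lf F g) :=
  Q_squarefree.squarefree_of_dvd (Lf_dvd_Q F g)

theorem Lf_natDegree_pos (F : K[X]) (g : K) (hg : g ∈ valueSet F) : 0 < (Lf F g).natDegree := by
  unfold Lf
  rw [natDegree_prod_of_monic _ _ (fun a _ => monic_X_sub_C a)]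
  simp only [natDegree_X_sub_C, Finset.sum_const, smul_eq_mul, mul_one, Finset.card_pos]
  simp only [valueSet, Finset.mem_image, Finset.mem_univ, true_and] at hg
  obtain ⟨a, ha⟩ := hg
  exact ⟨a, by simp [ha]⟩

theorem sum_natDegree_Lf (F : K[X]) : ∑ g ∈ valueSet F, (Lf F g).natDegree = Fintype.card K := by
  rw [← natDegree_prod_of_monic _ _ (fun g _ => Lf_monic F g), prod_Lf]
  exact FiniteField.X_pow_card_sub_X_natDegree_eq K (Fintype.one_lt_card (α := K))

theorem F_sub_coprime (F : K[X]) {g g' : K} (h : g ≠ g') : IsCoprime (F - C g) (F - C g') := by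
  refine ⟨C (g' - g)⁻¹, - C (g' - g)⁻¹, ?_⟩
  have : (C (g' - g)⁻¹ : K[X]) * C (g' - g) = 1 := by
    rw [← C_mul, inv_mul_cancel₀ (sub_ne_zero.2 h.symm), C_1]
  rw [C_sub] at this
  linear_combination this

/-- cofactor -/
noncomputable def Mf (F : K[X]) (g : K) : K[X] := Classical.choose (Lf_dvd F g)

theorem LM (F : K[X]) (g : K) : F - C g = Lf F g * Mf F g := Classical.choose_spec (Lf_dvd F g)

/-- T polynomial without one value -/
noncomputable def cf (F : K[X]) (g : K) : K := ∏ g' ∈ (valueSet F).erase g, (g - g')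

theorem cf_ne (F : K[X]) (g : K) : cf F g ≠ 0 := by
  unfold cf
  rw [Finset.prod_ne_zero_iff]
  intro a ha
  exact sub_ne_zero.2 (Finset.ne_of_mem_erase ha).symm

theorem F_sub_natDegree (F : K[X]) (g : K) : (F - C g).natDegree = F.natDegree := natDegree_sub_C

theorem F_sub_ne (F : K[X]) (hn : 0 < F.natDegree) (g : K) : F - C g ≠ 0 := by
  intro h
  have := F_sub_natDegree F g
  rw [h] at this; simp at this; omega

theorem Mf_ne (F : K[X]) (hn : 0 < F.natDegree) (g : K) : Mf F g ≠ 0 := by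
  have := F_sub_ne F hn g
  rw [LM] at this
  exact right_ne_zero_of_mul this

theorem LM_deg (F : K[X]) (hn : 0 < F.natDegree) (g : K) :
    (Lf F g).natDegree + (Mf F g).natDegree = F.natDegree := by
  rw [← natDegree_mul (Lf_monic F g).ne_zero (Mf_ne F hn g), ← LM, F_sub_natDegree]

theorem key_identity (F : K[X]) (hn : 0 < F.natDegree)
    (h1 : ((valueSet F).card - 1) * F.natDegree ≤ Fintype.card K - 1)
    (g : K) (hg : g ∈ valueSet F) :
    C (cf F g) * derivative (Lf F g) = - ∏ g' ∈ (valueSet F).erase g, Mf F g' := by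
  rw [eq_neg_iff_add_eq_zero]
  have hq : 1 < Fintype.card K := Fintype.one_lt_card
  have hQ : Lf F g * ∏ g' ∈ (valueSet F).erase g, Lf F g' = X ^ Fintype.card K - (X : K[X]) := by
    rw [Finset.mul_prod_erase _ _ hg, prod_Lf]
  apply eq_zero_of_dvd_of_natDegree_lt (p := Lf F g)
  · apply Lf_dvd_of
    intro a ha
    have e1 : (∏ g' ∈ (valueSet F).erase g, (Lf F g').eval a) * (∏ g' ∈ (valueSet F).erase g, (Mf F g').eval a) = cf F g := by
      rw [← Finset.prod_mul_distrib]
      unfold cf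
      refine Finset.prod_congr rfl fun g' _ => ?_
      rw [← eval_mul, ← LM]; simp [ha]
    have hL : (Lf F g).eval a = 0 := by
      unfold Lf; rw [eval_prod]
      exact Finset.prod_eq_zero (i := a) (by simp [ha]) (by simp)
    have e2 := congrArg (fun f => (derivative f).eval a) hQ
    simp only [deriv_Q, derivative_mul, eval_add, eval_mul, hL, zero_mul, add_zero, eval_neg, eval_one, eval_prod] at e2
    simp only [eval_add, eval_mul, eval_C, eval_prod]
    rw [← e1]
    linear_combination (∏ g' ∈ (valueSet F).erase g, (Mf F g').eval a) * e2
  · have hd := Lf_natDegree_pos F g hg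
    have b1 : (C (cf F g) * derivative (Lf F g)).natDegree ≤ (Lf F g).natDegree - 1 :=
      (natDegree_C_mul_le _ _).trans (natDegree_derivative_le _)
    have b2 : (∏ g' ∈ (valueSet F).erase g, Mf F g').natDegree ≤ (Lf F g).natDegree - 1 := by
      rw [natDegree_prod _ _ (fun g' _ => Mf_ne F hn g')]
      have e1 : ∑ g' ∈ (valueSet F).erase g, (Lf F g').natDegree + ∑ g' ∈ (valueSet F).erase g, (Mf F g').natDegree = ((valueSet F).card - 1) * F.natDegree := by
        rw [← Finset.sum_add_distrib, Finset.sum_congr rfl (fun g' _ => LM_deg F hn g')]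
        rw [Finset.sum_const, Finset.card_erase_of_mem hg, smul_eq_mul]
      have e2 := sum_natDegree_Lf F
      rw [← Finset.add_sum_erase _ _ hg] at e2
      omega
    calc _ ≤ _ := natDegree_add_le _ _
      _ ≤ (Lf F g).natDegree - 1 := max_le b1 b2
      _ < _ := by omega

theorem Lf_coprime (F : K[X]) {g g' : K} (h : g ≠ g') : IsCoprime (Lf F g) (Lf F g') :=
  IsCoprime.of_isCoprime_of_dvd_right (IsCoprime.of_isCoprime_of_dvd_left (F_sub_coprime F h) (Lf_dvd F g)) (Lf_dvd F g')

theorem Mf_dvd (F : K[X]) (g : K) : Mf F g ∣ F - C g := ⟨Lf F g, by rw [LM F g, mul_comm]⟩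

theorem LfMf_coprime (F : K[X]) {g g' : K} (h : g ≠ g') : IsCoprime (Lf F g) (Mf F g') :=
  IsCoprime.of_isCoprime_of_dvd_right (IsCoprime.of_isCoprime_of_dvd_left (F_sub_coprime F h) (Lf_dvd F g)) (Mf_dvd F g')

theorem Mf_coprime (F : K[X]) {g g' : K} (h : g ≠ g') : IsCoprime (Mf F g) (Mf F g') :=
  IsCoprime.of_isCoprime_of_dvd_right (IsCoprime.of_isCoprime_of_dvd_left (F_sub_coprime F h) (Mf_dvd F g)) (Mf_dvd F g')

theorem d_sum2 (F : K[X]) (hn : 0 < F.natDegree)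
    (h1 : ((valueSet F).card - 1) * F.natDegree ≤ Fintype.card K - 1) {i j : K}
    (hi : i ∈ valueSet F) (hj : j ∈ valueSet F) (hij : i ≠ j) :
    F.natDegree + 1 ≤ (Lf F i).natDegree + (Lf F j).natDegree := by
  have hq : 1 < Fintype.card K := Fintype.one_lt_card
  have e2 := sum_natDegree_Lf F
  have hj' : j ∈ (valueSet F).erase i := Finset.mem_erase.2 ⟨hij.symm, hj⟩
  rw [← Finset.add_sum_erase _ _ hi, ← Finset.add_sum_erase _ _ hj'] at e2
  have b : ∑ x ∈ ((valueSet F).erase i).erase j, (Lf F x).natDegree ≤ ((valueSet F).card - 2) * F.natDegree := by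
    have := Finset.sum_le_card_nsmul (((valueSet F).erase i).erase j) (fun x => (Lf F x).natDegree) F.natDegree
      (fun x _ => by have := LM_deg F hn x; omega)
    rwa [Finset.card_erase_of_mem hj', Finset.card_erase_of_mem hi, smul_eq_mul] at this
  have hc : 2 ≤ (valueSet F).card := by
    have := Finset.card_pos.2 ⟨j, hj'⟩
    rw [Finset.card_erase_of_mem hi] at this; omega
  obtain ⟨m, hm⟩ : ∃ m, (valueSet F).card = m + 2 := ⟨_, (Nat.sub_add_cancel hc).symm⟩
  rw [hm] at b h1
  have : (m + 2 - 1) * F.natDegree = (m + 2 - 2) * F.natDegree + F.natDegree := by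
    simp only [Nat.add_sub_cancel]; rw [show m + 2 - 1 = m + 1 by omega]; ring
  omega

theorem d_sum3 (F : K[X]) (hn : 0 < F.natDegree)
    (h1 : ((valueSet F).card - 1) * F.natDegree ≤ Fintype.card K - 1) {i j k : K}
    (hi : i ∈ valueSet F) (hj : j ∈ valueSet F) (hk : k ∈ valueSet F) (hij : i ≠ j) (hik : i ≠ k) (hjk : j ≠ k) :
    2 * F.natDegree + 1 ≤ (Lf F i).natDegree + (Lf F j).natDegree + (Lf F k).natDegree := by
  have hq : 1 < Fintype.card K := Fintype.one_lt_card
  have e2 := sum_natDegree_Lf F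
  have hj' : j ∈ (valueSet F).erase i := Finset.mem_erase.2 ⟨hij.symm, hj⟩
  have hk' : k ∈ ((valueSet F).erase i).erase j := Finset.mem_erase.2 ⟨hjk.symm, Finset.mem_erase.2 ⟨hik.symm, hk⟩⟩
  rw [← Finset.add_sum_erase _ _ hi, ← Finset.add_sum_erase _ _ hj', ← Finset.add_sum_erase _ _ hk'] at e2
  have b : ∑ x ∈ (((valueSet F).erase i).erase j).erase k, (Lf F x).natDegree ≤ ((valueSet F).card - 3) * F.natDegree := by
    have := Finset.sum_le_card_nsmul ((((valueSet F).erase i).erase j).erase k) (fun x => (Lf F x).natDegree) F.natDegree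
      (fun x _ => by have := LM_deg F hn x; omega)
    rwa [Finset.card_erase_of_mem hk', Finset.card_erase_of_mem hj', Finset.card_erase_of_mem hi, smul_eq_mul] at this
  have hc : 3 ≤ (valueSet F).card := by
    have := Finset.card_pos.2 ⟨k, hk'⟩
    rw [Finset.card_erase_of_mem hj', Finset.card_erase_of_mem hi] at this; omega
  obtain ⟨m, hm⟩ : ∃ m, (valueSet F).card = m + 3 := ⟨_, (Nat.sub_add_cancel hc).symm⟩
  rw [hm] at b h1
  have : (m + 3 - 1) * F.natDegree = (m + 3 - 3) * F.natDegree + 2 * F.natDegree := by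
    simp only [Nat.add_sub_cancel]; rw [show m + 3 - 1 = m + 2 by omega]; ring
  omega

/-- H -/
noncomputable def Hf (F : K[X]) : K[X] := ∏ g ∈ valueSet F, Mf F g

theorem key2 (F : K[X]) (hn : 0 < F.natDegree)
    (h1 : ((valueSet F).card - 1) * F.natDegree ≤ Fintype.card K - 1)
    (g : K) (hg : g ∈ valueSet F) :
    C (cf F g) * (derivative (Lf F g) * Mf F g) = - Hf F := by
  unfold Hf
  rw [← mul_assoc, key_identity F hn h1 g hg, ← Finset.mul_prod_erase _ _ hg]; ring

theorem key3 (F : K[X]) (hn : 0 < F.natDegree)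
    (h1 : ((valueSet F).card - 1) * F.natDegree ≤ Fintype.card K - 1)
    (g : K) (hg : g ∈ valueSet F) :
    C (cf F g) * (Lf F g * derivative (Mf F g)) = Hf F + C (cf F g) * derivative F := by
  have h := key2 F hn h1 g hg
  have h2 := congrArg derivative (LM F g)
  simp only [derivative_sub, derivative_C, sub_zero, derivative_mul] at h2
  linear_combination -h - C (cf F g) * h2

theorem exists_M (F : K[X]) (hn : 0 < F.natDegree)
    (h1 : ((valueSet F).card - 1) * F.natDegree ≤ Fintype.card K - 1)
    (h3 : 3 ≤ (valueSet F).card) : ∃ g ∈ valueSet F, derivative (Mf F g) = 0 := by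
  obtain ⟨i, j, k, hi, hj, hk, hij, hik, hjk⟩ := Finset.two_lt_card_iff.1 h3
  have pair : ∀ {i j : K}, i ∈ valueSet F → j ∈ valueSet F → i ≠ j → cf F i = cf F j →
      derivative (Mf F i) = 0 := by
    intro i j hi hj hij hc
    have e1 := key3 F hn h1 i hi
    have e2 := key3 F hn h1 j hj
    rw [hc, ← e2] at e1
    have e3 := mul_left_cancel₀ (C_ne_zero.2 (cf_ne F j)) e1
    have : Lf F j ∣ Lf F i * derivative (Mf F i) := ⟨_, e3⟩
    have := (Lf_coprime F hij.symm).dvd_of_dvd_mul_left this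
    have d1 := d_sum2 F hn h1 hi hj hij
    have d2 := LM_deg F hn i
    have d3 := natDegree_derivative_le (Mf F i)
    have d4 := Lf_natDegree_pos F j hj
    exact eq_zero_of_dvd_of_natDegree_lt this (by omega)
  by_cases c1 : cf F i = cf F j
  · exact ⟨i, hi, pair hi hj hij c1⟩
  by_cases c2 : cf F i = cf F k
  · exact ⟨i, hi, pair hi hk hik c2⟩
  by_cases c3 : cf F j = cf F k
  · exact ⟨j, hj, pair hj hk hjk c3⟩
  refine ⟨i, hi, ?_⟩
  have ei := key3 F hn h1 i hi
  have ej := key3 F hn h1 j hj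
  have ek := key3 F hn h1 k hk
  have li := LM F i
  have lj := LM F j
  have lk := LM F k
  -- indices 0=i,1=j,2=k
  set Di := derivative (Mf F i)
  set Dj := derivative (Mf F j)
  set Dk := derivative (Mf F k)
  have R1 : C (j - k) * (Lf F i * Mf F i) + C (k - i) * (Lf F j * Mf F j) + C (i - j) * (Lf F k * Mf F k) = 0 := by
    rw [← li, ← lj, ← lk]; simp only [C_sub]; ring
  have R2 : C (cf F j - cf F k) * (C (cf F i) * (Lf F i * Di)) + C (cf F k - cf F i) * (C (cf F j) * (Lf F j * Dj)) + C (cf F i - cf F j) * (C (cf F k) * (Lf F k * Dk)) = 0 := by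
    rw [ei, ej, ek]; simp only [C_sub]; ring
  let Y : K[X] := C (j - k) * C (cf F i - cf F j) * C (cf F k) * (Mf F i * Dk) - C (cf F j - cf F k) * C (i - j) * C (cf F i) * (Di * Mf F k)
  have hY : Lf F j ∣ Lf F i * Y := by
    refine ⟨-(C (k - i) * C (cf F i - cf F j) * C (cf F k) * (Mf F j * Dk) - C (cf F k - cf F i) * C (i - j) * C (cf F j) * (Dj * Mf F k)), ?_⟩
    simp only [Y]
    linear_combination C (cf F i - cf F j) * C (cf F k) * Dk * R1 - C (i-j) * Mf F k * R2
  have hY2 := (Lf_coprime F hij.symm).dvd_of_dvd_mul_left hY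
  have d0 := d_sum3 F hn h1 hi hj hk hij hik hjk
  have di := LM_deg F hn i
  have dk := LM_deg F hn k
  have dj := Lf_natDegree_pos F j hj
  by_cases hDi : Di = 0
  · exact hDi
  exfalso
  have hMi : 0 < (Mf F i).natDegree := by
    by_contra h
    apply hDi
    exact derivative_of_natDegree_zero (by omega)
  have bY : Y.natDegree < (Lf F j).natDegree := by
    have b1 : (C (j - k) * C (cf F i - cf F j) * C (cf F k) * (Mf F i * Dk)).natDegree ≤ 2 * F.natDegree - (Lf F i).natDegree - (Lf F k).natDegree := by
      rw [← C_mul, ← C_mul]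
      refine (natDegree_C_mul_le _ _).trans (natDegree_mul_le.trans ?_)
      have := natDegree_derivative_le (Mf F k)
      simp only [Dk]; omega
    have b2 : (C (cf F j - cf F k) * C (i - j) * C (cf F i) * (Di * Mf F k)).natDegree ≤ 2 * F.natDegree - (Lf F i).natDegree - (Lf F k).natDegree := by
      rw [← C_mul, ← C_mul]
      refine (natDegree_C_mul_le _ _).trans (natDegree_mul_le.trans ?_)
      have := natDegree_derivative_le (Mf F i)
      simp only [Di]; omega
    have := natDegree_sub_le_of_le b1 b2
    simp only [max_self] at this
    have : Y.natDegree ≤ _ := this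
    omega
  have hY0 : Y = 0 := eq_zero_of_dvd_of_natDegree_lt hY2 bY
  have hdv : Mf F i ∣ Di * Mf F k := by
    have : C ((cf F j - cf F k) * (i - j) * (cf F i)) * (Di * Mf F k) = Mf F i * (C (j - k) * C (cf F i - cf F j) * C (cf F k) * Dk) := by
      simp only [Y] at hY0
      simp only [C_mul]
      linear_combination -hY0
    have hne : ((cf F j - cf F k) * (i - j) * (cf F i)) ≠ 0 :=
      mul_ne_zero (mul_ne_zero (sub_ne_zero.2 c3) (sub_ne_zero.2 hij)) (cf_ne F i)
    have h' : Mf F i ∣ C ((cf F j - cf F k) * (i - j) * (cf F i)) * (Di * Mf F k) := ⟨_, this⟩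
    rwa [IsUnit.dvd_mul_left] at h'
    exact isUnit_C.2 hne.isUnit
  have := (Mf_coprime F hik).dvd_of_dvd_mul_right hdv
  exact hDi (dvd_deriv this)

/-- Summary of part A. -/
theorem partA (F : K[X]) (hn : 0 < F.natDegree)
    (h1 : ((valueSet F).card - 1) * F.natDegree ≤ Fintype.card K - 1)
    (h3 : 3 ≤ (valueSet F).card) : ∃ c : K, c ≠ 0 ∧ derivative F ≠ 0 ∧ (∃ g ∈ valueSet F, cf F g = c) ∧
      (∀ g ∈ valueSet F, C (cf F g) * (Lf F g * derivative (Mf F g)) = C (cf F g - c) * derivative F) ∧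
      (∀ g ∈ valueSet F, C (cf F g) * (derivative (Lf F g) * Mf F g) = C c * derivative F) ∧
      (∏ g ∈ valueSet F, (F - C g) = - (C c * ((X ^ Fintype.card K - X) * derivative F))) ∧
      (∀ g ∈ valueSet F, Lf F g * ∏ g' ∈ (valueSet F).erase g, (F - C g') =
        - (C (cf F g) * ((X ^ Fintype.card K - X) * derivative (Lf F g)))) := by
  obtain ⟨g0, hg0, hM⟩ := exists_M F hn h1 h3
  have e0 := key3 F hn h1 g0 hg0
  rw [hM, mul_zero, mul_zero] at e0
  have hH : Hf F = - (C (cf F g0) * derivative F) := by linear_combination -e0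
  have hH0 : Hf F ≠ 0 := Finset.prod_ne_zero_iff.2 (fun g _ => Mf_ne F hn g)
  refine ⟨cf F g0, cf_ne F g0, ?_, ⟨g0, hg0, rfl⟩, ?_, ?_, ?_, ?_⟩
  · intro h; rw [h] at hH; simp at hH; exact hH0 hH
  · intro g hg
    rw [key3 F hn h1 g hg, hH]; simp only [C_sub]; ring
  · intro g hg
    rw [key2 F hn h1 g hg, hH]; ring
  · rw [Finset.prod_congr rfl (fun g _ => LM F g), Finset.prod_mul_distrib, prod_Lf]
    change _ * Hf F = _
    rw [hH]; ring
  · intro g hg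
    rw [Finset.prod_congr rfl (fun g _ => LM F g), Finset.prod_mul_distrib, ← mul_assoc, Finset.mul_prod_erase _ _ hg, prod_Lf]
    have := key_identity F hn h1 g hg
    linear_combination (X ^ Fintype.card K - X) * this

end partA

section good
set_option linter.unusedSectionVars false
variable {K : Type} [Field K] [Fintype K] [DecidableEq K]

/-- the (ii) shape -/
def Shape2 (p : ℕ) (g : K[X]) : Prop :=
  ∃ a b c d e f : K, a ^ p = a ∧ f ^ p = f ∧ d ^ p ^ 2 = d ∧
              g = C a * X ^ (p ^ 3 + p ^ 2 + p + 1) + C b * X ^ (p ^ 3 + p ^ 2 + p)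
                + C (b ^ p) * X ^ (p ^ 3 + p ^ 2 + 1) + C (b ^ p ^ 2) * X ^ (p ^ 3 + p + 1)
                + C (b ^ p ^ 3) * X ^ (p ^ 2 + p + 1) + C c * X ^ (p ^ 3 + p ^ 2)
                + C (c ^ p) * X ^ (p ^ 3 + 1) + C (c ^ p ^ 2) * X ^ (p + 1)
                + C (c ^ p ^ 3) * X ^ (p ^ 2 + p) + C d * X ^ (p ^ 3 + p)
                + C (d ^ p) * X ^ (p ^ 2 + 1) + C e * X ^ p ^ 3 + C (e ^ p) * X
                + C (e ^ p ^ 2) * X ^ p + C (e ^ p ^ 3) * X ^ p ^ 2 + C f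

def Typ1 (p : ℕ) (G : K[X]) : Prop := ∃ v : ℕ, v ∣ p ^ 4 - 1 ∧ v ≠ p ^ 4 - 1 ∧ G = X ^ v
def Typ2 (p : ℕ) (G : K[X]) : Prop :=
  ∃ (t : ℕ) (g : K[X]), t ∣ p - 1 ∧ t ≠ p - 1 ∧ 0 < g.natDegree ∧ Shape2 p g ∧ G = g ^ t
def Typ3 (p : ℕ) (G : K[X]) : Prop :=
  ∃ (t : ℕ) (g : K[X]), t ∣ p ^ 2 - 1 ∧ t ≠ p ^ 2 - 1 ∧ 0 < g.natDegree ∧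
            (∃ a b c : K, a ^ p ^ 2 = a ∧ c ^ p ^ 2 = c ∧
              g = C a * X ^ (p ^ 2 + 1) + C b * X ^ p ^ 2 + C (b ^ p ^ 2) * X + C c) ∧
            G = g ^ t
def Typ4 (p : ℕ) (G : K[X]) : Prop :=
  ∃ (β₀ : K) (v : ℕ), β₀ ^ p ≠ β₀ ∧ v ∣ p - 1 ∧
            G = (X ^ p ^ 2 + C (1 + (β₀ ^ p ^ 3 - β₀ ^ p ^ 2) ^ (p - 1)) * X ^ p
              - C (((β₀ ^ p - β₀) ^ (p - 1))⁻¹) * X) ^ v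
def Typ5 (p : ℕ) (G : K[X]) : Prop := ∃ v : ℕ, v ∣ p - 1 ∧ G = (X ^ p - X) ^ v

def Typ (p : ℕ) (G : K[X]) : Prop := Typ1 p G ∨ Typ2 p G ∨ Typ3 p G ∨ Typ4 p G ∨ Typ5 p G

def Good (p : ℕ) (P : K[X]) : Prop :=
  ∃ α β γ δ : K, α ≠ 0 ∧ γ ≠ 0 ∧
        ∃ G : K[X], G = C γ * P.comp (C α * X + C β) + C δ ∧ Typ p G

theorem Good.of_typ {p : ℕ} {G : K[X]} (h : Typ p G) : Good p G :=
  ⟨1, 0, 1, 0, one_ne_zero, one_ne_zero, G, by simp, h⟩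

theorem Good.of_affine {p : ℕ} {P : K[X]} (α β γ δ : K) (hα : α ≠ 0) (hγ : γ ≠ 0)
    (h : Good p (C γ * P.comp (C α * X + C β) + C δ)) : Good p P := by
  obtain ⟨a, b, c, d, ha, hc, G, hG, hT⟩ := h
  refine ⟨α * a, α * b + β, c * γ, c * δ + d, mul_ne_zero hα ha, mul_ne_zero hc hγ, G, ?_, hT⟩
  rw [hG]
  simp only [add_comp, mul_comp, C_comp, X_comp, comp_assoc, C_mul, C_add]
  rw [show C α * (C a * X + C b) + C β = (C α * C a * X + (C α * C b + C β) : K[X]) by ring]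
  ring

theorem Good.of_scale {p : ℕ} {P : K[X]} (γ δ : K) (hγ : γ ≠ 0)
    (h : Good p (C γ * P + C δ)) : Good p P :=
  Good.of_affine 1 0 γ δ one_ne_zero hγ (by simpa using h)

theorem Good.of_comp {p : ℕ} {P : K[X]} (α β : K) (hα : α ≠ 0)
    (h : Good p (P.comp (C α * X + C β))) : Good p P :=
  Good.of_affine α β 1 0 hα one_ne_zero (by simpa using h)

/-- if F = u * g ^ t with u nonzero, suffices Good (g^t) -/
theorem Good.of_const_mul {p : ℕ} {P : K[X]} (u : K) (hu : u ≠ 0) (h : Good p P) : Good p (C u * P) := by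
  refine Good.of_scale u⁻¹ 0 (inv_ne_zero hu) ?_
  rw [C_0, add_zero, ← mul_assoc, ← C_mul, inv_mul_cancel₀ hu, C_1, one_mul]
  exact h

theorem lemmaX {p : ℕ} (hcard : Fintype.card K = p ^ 4) (F S L : K[X]) (r : ℕ) (hr : 2 ≤ r)
    (hS : S.natDegree = r) (hS0 : S.eval 0 = 0) (hL : L.Monic) (hL1 : L.natDegree = 1)
    (hn : 0 < F.natDegree)
    (hE : L + L * S.comp F + (X ^ Fintype.card K - X) * derivative L = 0) : Good p F := by
  have hq : 1 < Fintype.card K := Fintype.one_lt_card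
  obtain ⟨b, rfl⟩ : ∃ b, L = X - C b := by
    refine ⟨-L.coeff 0, ?_⟩
    rw [hL.eq_X_add_C hL1]; simp
  apply Good.of_comp 1 b one_ne_zero
  set G := F.comp (C 1 * X + C b) with hG
  have hGd : G.natDegree = F.natDegree := by
    rw [hG, natDegree_comp]; simp
  have e := congrArg (fun f => f.comp (C 1 * X + C b)) hE
  simp only [add_comp, mul_comp, sub_comp, X_comp, C_comp, zero_comp, derivative_sub, derivative_X, derivative_C, sub_zero, one_comp, pow_comp, mul_one, comp_assoc, C_1, one_mul] at e
  rw [show F.comp (X + C b) = G by rw [hG]; simp] at e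
  have hqq : (X + C b : K[X]) ^ Fintype.card K = X ^ Fintype.card K + C b := by
    obtain ⟨p', hp', hc⟩ := CharP.exists K |>.imp fun p' h => (⟨h, trivial⟩ : _ ∧ True)
    have := hp'
    obtain ⟨n, hpr, hcd⟩ := FiniteField.card K p'
    have : Fact p'.Prime := ⟨hpr⟩
    rw [hcd, add_pow_char_pow, ← C_pow, ← hcd, FiniteField.pow_card]
  rw [hqq] at e
  have e2 : X * S.comp G = X * (- X ^ (Fintype.card K - 1)) := by
    rw [mul_neg, mul_pow_sub_one (by omega)]
    linear_combination e
  have e3 := mul_left_cancel₀ X_ne_zero e2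
  have hdv : G ∣ X ^ (Fintype.card K - 1) := by
    obtain ⟨S1, hS1⟩ : X ∣ S := by rw [X_dvd_iff, coeff_zero_eq_eval_zero, hS0]
    rw [hS1, mul_comp, X_comp] at e3
    exact ⟨-S1.comp G, by linear_combination e3⟩
  obtain ⟨i, hi, hass⟩ := (dvd_prime_pow prime_X _).1 hdv
  obtain ⟨u, hu⟩ := hass.symm
  obtain ⟨u0, hu0, hu1⟩ := isUnit_iff.1 u.isUnit
  have hiN : i = G.natDegree := by
    rw [← hu, ← hu1, mul_comm, natDegree_C_mul_X_pow _ _ hu0.ne_zero]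
  have hdeg : (S.comp G).natDegree = Fintype.card K - 1 := by
    rw [e3]; simp
  rw [natDegree_comp, hS] at hdeg
  rw [← hu, ← hu1, mul_comm]
  apply Good.of_const_mul _ hu0.ne_zero
  apply Good.of_typ
  left
  refine ⟨i, ⟨r, ?_⟩, ?_, rfl⟩
  · rw [← hcard, hiN, ← hdeg]; ring
  · rw [← hcard, hiN, ← hdeg]
    have : 0 < G.natDegree := by omega
    nlinarith

theorem coeff4 (P : ℕ) (hP : 4 ≤ P) (a b c d : K) :
    (C a * X ^ (P + 1) + C b * X ^ P + C c * X + C d : K[X]).coeff (P + 1) = a ∧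
    (C a * X ^ (P + 1) + C b * X ^ P + C c * X + C d : K[X]).coeff P = b ∧
    (C a * X ^ (P + 1) + C b * X ^ P + C c * X + C d : K[X]).coeff 1 = c ∧
    (C a * X ^ (P + 1) + C b * X ^ P + C c * X + C d : K[X]).coeff 0 = d := by
  simp only [coeff_add, coeff_C_mul, coeff_X_pow, coeff_X, coeff_C]
  refine ⟨?_, ?_, ?_, ?_⟩ <;> split_ifs <;> first | omega | contradiction | simp

theorem lemma3 {p : ℕ} [hp : Fact p.Prime] [CharP K p] (hcard : Fintype.card K = p ^ 4) (a b c e κ : K) (hκ : κ ≠ 0) (L : K[X]) (hL : L = C (a ^ p ^ 2) * X ^ (p ^ 2 + 1) + C (b ^ p ^ 2) * X ^ p ^ 2 + C (e ^ p ^ 2) * X + C (c ^ p ^ 2))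
    (hL2 : C a * X ^ (p ^ 2 + 1) + C e * X ^ p ^ 2 + C b * X + C c = C κ * L)
    (hd : 0 < L.natDegree) (t : ℕ) (ht : t ∣ p ^ 2 - 1) (ht2 : t ≠ p ^ 2 - 1) : Good p (L ^ t) := by
  have hp2 : 4 ≤ p ^ 2 := by nlinarith [hp.out.two_le]
  have co : ∀ k, (C a * X ^ (p ^ 2 + 1) + C e * X ^ p ^ 2 + C b * X + C c : K[X]).coeff k = (C κ * (C (a ^ p ^ 2) * X ^ (p ^ 2 + 1) + C (b ^ p ^ 2) * X ^ p ^ 2 + C (e ^ p ^ 2) * X + C (c ^ p ^ 2))).coeff k := by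
    intro k; rw [hL2, hL]
  have q4 : ∀ z : K, (z ^ p ^ 2) ^ p ^ 2 = z := by
    intro z; rw [← pow_mul, ← pow_add, ← hcard, FiniteField.pow_card]
  have h1 := co (p ^ 2 + 1)
  have h2 := co (p ^ 2)
  have h3 := co 1
  have h4 := co 0
  obtain ⟨l1, l2, l3, l4⟩ := coeff4 (p ^ 2) hp2 a e b c
  obtain ⟨m1, m2, m3, m4⟩ := coeff4 (p ^ 2) hp2 (a ^ p ^ 2) (b ^ p ^ 2) (e ^ p ^ 2) (c ^ p ^ 2)
  rw [coeff_C_mul, l1, m1] at h1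
  rw [coeff_C_mul, l2, m2] at h2
  rw [coeff_C_mul, l3, m3] at h3
  rw [coeff_C_mul, l4, m4] at h4
  -- δ with δ^(p^2) κ = δ
  obtain ⟨δ, hδ, hδκ⟩ : ∃ δ : K, δ ≠ 0 ∧ κ * δ ^ p ^ 2 = δ := by
    by_cases ha : a = 0
    · by_cases hc : c = 0
      · have hk : κ ^ (p ^ 2 + 1) = 1 := by
          have hb : b ≠ 0 := by
            rintro rfl
            have he : e = 0 := by rw [h2]; simp [hp.out.ne_zero]
            subst ha hc he
            rw [hL] at hd; simp [hp.out.ne_zero] at hd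
          have : b = κ ^ (p ^ 2 + 1) * b := by
            conv_lhs => rw [h3, h2, mul_pow, q4]
            ring
          have : (κ ^ (p ^ 2 + 1) - 1) * b = 0 := by linear_combination -this
          rcases mul_eq_zero.1 this with h | h
          · exact sub_eq_zero.1 h
          · exact absurd h hb
        obtain ⟨ζ, hζ⟩ := IsCyclic.exists_generator (α := Kˣ)
        obtain ⟨m, hm⟩ := (mem_powers_iff_mem_zpowers (x := ζ) (y := Units.mk0 κ hκ)).2 (hζ _)
        have hord : orderOf ζ = p ^ 4 - 1 := by
          rw [orderOf_eq_card_of_forall_mem_zpowers hζ, Nat.card_units, Nat.card_eq_fintype_card, hcard]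
        have hdv : p ^ 4 - 1 ∣ m * (p ^ 2 + 1) := by
          rw [← hord]
          apply orderOf_dvd_of_pow_eq_one
          rw [pow_mul]
          have : ζ ^ m = Units.mk0 κ hκ := hm
          rw [this]; ext; simpa using hk
        have hf : p ^ 4 - 1 = (p ^ 2 - 1) * (p ^ 2 + 1) := by
          obtain ⟨s, hs⟩ : ∃ s, p ^ 2 = s + 1 := ⟨p ^ 2 - 1, by omega⟩
          have : p ^ 4 = (s + 1) * (s + 1) := by rw [← hs]; ring
          rw [this, hs]
          have : (s + 1) * (s + 1) = s * (s + 1 + 1) + 1 := by ring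
          rw [this]; simp
        rw [hf] at hdv
        obtain ⟨l, hl⟩ := Nat.dvd_of_mul_dvd_mul_right (by omega) hdv
        refine ⟨((ζ ^ l)⁻¹ : Kˣ), Units.ne_zero _, ?_⟩
        have hu : Units.mk0 κ hκ * (ζ ^ l)⁻¹ ^ p ^ 2 = (ζ ^ l)⁻¹ := by
          have : ζ ^ m = Units.mk0 κ hκ := hm
          rw [← this, hl, mul_comm (p ^ 2 - 1) l, pow_mul]
          have hs : p ^ 2 = (p ^ 2 - 1) + 1 := by omega
          conv_lhs => rw [hs]
          simp only [Nat.add_sub_cancel, pow_succ _ (p ^ 2 - 1), inv_pow]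
          rw [← mul_assoc, mul_inv_cancel, one_mul]
        have := congrArg (fun u : Kˣ => (u : K)) hu
        simpa using this
      · exact ⟨c, hc, h4.symm⟩
    · exact ⟨a, ha, h1.symm⟩
  -- g = δ^{P}... 
  have hg : Good p ((C δ * L) ^ t) := by
    apply Good.of_typ
    right; right; left
    refine ⟨t, C δ * L, ht, ht2, by rwa [natDegree_C_mul hδ], ⟨δ * a ^ p ^ 2, δ * b ^ p ^ 2, δ * c ^ p ^ 2, ?_, ?_, ?_⟩, rfl⟩
    · rw [mul_pow, q4]
      apply mul_left_cancel₀ hκ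
      linear_combination a * hδκ + δ * h1
    · rw [mul_pow, q4]
      apply mul_left_cancel₀ hκ
      linear_combination c * hδκ + δ * h4
    · have : (δ * b ^ p ^ 2) ^ p ^ 2 = δ * e ^ p ^ 2 := by
        rw [mul_pow, q4]
        apply mul_left_cancel₀ hκ
        linear_combination b * hδκ + δ * h3
      rw [this, hL]; simp only [C_mul]; ring
  rw [mul_pow, ← C_pow] at hg
  have := Good.of_const_mul (δ ^ t)⁻¹ (inv_ne_zero (pow_ne_zero _ hδ)) hg
  rwa [← mul_assoc, ← C_mul, inv_mul_cancel₀ (pow_ne_zero _ hδ), C_1, one_mul] at this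

end good

section add
set_option linter.unusedSectionVars false
set_option linter.unusedSimpArgs false
variable {K : Type} [Field K] [Fintype K] [DecidableEq K]

theorem natDegree_C_mul_X_le (a : K) : (C a * X : K[X]).natDegree ≤ 1 := by
  have := natDegree_C_mul_X_pow_le a 1
  rwa [pow_one] at this

theorem zero_of_vanish (f : K[X]) (hd : f.natDegree < Fintype.card K) (h : ∀ x, f.eval x = 0) : f = 0 := by
  have h1 := dvd_of_roots Finset.univ f (fun a _ => h a)
  rw [prod_univ] at h1
  refine eq_zero_of_dvd_of_natDegree_lt h1 ?_
  rwa [FiniteField.X_pow_card_sub_X_natDegree_eq K (Fintype.one_lt_card (α := K))]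

theorem root_of_dvd_Q (D : K[X]) (hD : D ∣ X ^ Fintype.card K - X) (hd : 0 < D.natDegree) :
    ∃ s, D.eval s = 0 := by
  have hs : (X ^ Fintype.card K - X : K[X]).Splits := by
    rw [← prod_univ]
    exact Splits.prod (fun a _ => Splits.X_sub_C a)
  have h2 : D.Splits := hs.of_dvd (FiniteField.X_pow_card_sub_X_ne_zero K Fintype.one_lt_card) hD
  exact h2.exists_eval_eq_zero (by rw [degree_eq_natDegree (by rintro rfl; simp at hd)]; exact_mod_cast hd.ne')

theorem lemma5 {p : ℕ} [hp : Fact p.Prime] [CharP K p] (κ ω : K) (hκ : κ ≠ 0) (hω : ω ≠ 0) (L : K[X])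
    (hL : L = C κ * X ^ p + C ω * X) (hQ : L ∣ X ^ Fintype.card K - X) (a : ℕ) (ha : a ∣ p - 1) :
    Good p (L ^ a) := by
  have h2 := hp.out.two_le
  have hp1 : (X : K[X]) ^ p = X ^ (p - 1) * X := by rw [← pow_succ]; congr 1; omega
  obtain ⟨s, hs⟩ := root_of_dvd_Q (C κ * X ^ (p - 1) + C ω)
    (Dvd.dvd.trans ⟨X, by rw [hL, hp1]; ring⟩ hQ)
    (by rw [natDegree_add_C, natDegree_C_mul_X_pow _ _ hκ]; omega)
  simp at hs
  have hs0 : s ≠ 0 := by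
    rintro rfl
    rw [zero_pow (by omega)] at hs; simp at hs; exact hω hs
  apply Good.of_comp s 0 hs0
  have : (L ^ a).comp (C s * X + C 0) = C ((κ * s ^ p) ^ a) * (X ^ p - X) ^ a := by
    rw [C_pow, ← mul_pow, pow_comp]; congr 1
    rw [hL]; simp only [add_comp, mul_comp, C_comp, X_comp, pow_comp, C_0, add_zero, mul_pow, ← C_pow, C_mul]
    have : C ω * C s = - (C κ * C (s ^ p) : K[X]) := by
      rw [← C_mul, ← C_mul, ← C_neg]; congr 1
      have : s ^ p = s ^ (p - 1) * s := by rw [← pow_succ]; congr 1; omega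
      rw [this]; linear_combination s * hs
    linear_combination X * this
  rw [this]
  apply Good.of_const_mul _ (pow_ne_zero _ (mul_ne_zero hκ (pow_ne_zero _ hs0)))
  exact Good.of_typ (Or.inr (Or.inr (Or.inr (Or.inr ⟨a, ha, rfl⟩))))

theorem lemma4 {p : ℕ} [hp : Fact p.Prime] [CharP K p] (hcard : Fintype.card K = p ^ 4)
    (α κ ω : K) (hα : α ≠ 0) (L : K[X])
    (hL : L = C α * X ^ p ^ 2 + C κ * X ^ p + C ω * X) (hQ : L ∣ X ^ Fintype.card K - X) (a : ℕ) (ha : a ∣ p - 1) :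
    Good p (L ^ a) := by
  have h2 := hp.out.two_le
  have hpp : p < p ^ 2 := by nlinarith
  have hp3 : p ^ 2 < p ^ 3 := by nlinarith [pow_pos (by omega : 0 < p) 2]
  have hp4 : p ^ 3 < p ^ 4 := by nlinarith [pow_pos (by omega : 0 < p) 3]
  have ndeg : ∀ α' κ' ω' : K, α' ≠ 0 → (C α' * X ^ p ^ 2 + C κ' * X ^ p + C ω' * X : K[X]).natDegree = p ^ 2 := by
    intro α' κ' ω' h
    rw [add_assoc, natDegree_add_eq_left_of_natDegree_lt]
    · rw [natDegree_C_mul_X_pow _ _ h]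
    · rw [natDegree_C_mul_X_pow _ _ h]
      refine lt_of_le_of_lt (natDegree_add_le_of_le (natDegree_C_mul_X_pow_le _ _) (natDegree_C_mul_X_le _)) ?_
      rw [max_lt_iff]; omega
  obtain ⟨x0, hx0⟩ : ∃ x, L.eval x ≠ 0 := by
    by_contra! h
    have := zero_of_vanish L (by rw [hL, ndeg _ _ _ hα, hcard]; omega) h
    have h' := ndeg α κ ω hα
    rw [← hL, this] at h'; simp at h'; omega
  set s := L.eval x0
  have q4 : ∀ z : K, (z ^ p ^ 2) ^ p ^ 2 = z := by
    intro z; rw [← pow_mul, ← pow_add, ← hcard, FiniteField.pow_card]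
  -- scale
  set lam : K := (s / α) ^ p ^ 2 with hlam
  have hlam2 : lam ^ p ^ 2 = s / α := by rw [hlam, q4]
  have hlam0 : lam ≠ 0 := pow_ne_zero _ (div_ne_zero hx0 hα)
  obtain ⟨b, c, hg⟩ : ∃ b c : K, C s⁻¹ * L.comp (C lam * X + C 0) = X ^ p ^ 2 + C b * X ^ p + C c * X := by
    refine ⟨s⁻¹ * κ * lam ^ p, s⁻¹ * ω * lam, ?_⟩
    rw [hL]
    simp only [add_comp, mul_comp, C_comp, X_comp, pow_comp, C_0, add_zero, mul_pow, ← C_pow, C_mul, hlam2]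
    have : C s⁻¹ * C α * C (s / α) = (1 : K[X]) := by
      rw [← C_mul, ← C_mul, ← C_1]; congr 1; field_simp
    linear_combination X ^ p ^ 2 * this
  set g : K[X] := X ^ p ^ 2 + C b * X ^ p + C c * X with hgd
  have hgdeg : g.natDegree = p ^ 2 := by
    have := ndeg 1 b c one_ne_zero
    rwa [C_1, one_mul, ← hgd] at this
  suffices hgood : Good p (g ^ a) by
    refine Good.of_affine lam 0 (s⁻¹ ^ a) 0 hlam0 (pow_ne_zero _ (inv_ne_zero hx0)) ?_
    rw [pow_comp, C_pow, ← mul_pow, hg, C_0, add_zero]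
    exact hgood
  -- 1 in image
  have hone : g.eval (lam⁻¹ * x0) = 1 := by
    rw [← hg]; simp [eval_comp, hlam0]
    exact inv_mul_cancel₀ hx0
  -- beta
  obtain ⟨y, hy⟩ : ∃ y, (g.eval y) ^ p ≠ g.eval y := by
    by_contra! h
    have hz := zero_of_vanish (g ^ p - g) ?_ (fun x => by simp [h x])
    · have : (g ^ p).natDegree = g.natDegree := by rw [sub_eq_zero.1 hz]
      rw [natDegree_pow, hgdeg] at this
      nlinarith
    · refine lt_of_le_of_lt (natDegree_sub_le _ _) ?_
      rw [natDegree_pow, hgdeg, hcard, max_lt_iff]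
      constructor
      · calc p * p ^ 2 = p ^ 3 := by ring
          _ < _ := hp4
      · omega
  set β := g.eval y
  -- M∘g
  set m1 : K := -b ^ p ^ 2
  set m0 : K := - c ^ p ^ 2 - m1 * b ^ p
  have hgp : ∀ m, g ^ p ^ m = X ^ p ^ (m + 2) + C (b ^ p ^ m) * X ^ p ^ (m + 1) + C (c ^ p ^ m) * X ^ p ^ m := by
    intro m
    rw [hgd, add_pow_char_pow, add_pow_char_pow, mul_pow, mul_pow, ← C_pow, ← C_pow, ← pow_mul, ← pow_mul, ← pow_add, ← pow_succ', add_comm 2 m]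
  have e1 : g ^ p ^ 2 + C m1 * g ^ p + C m0 * g - (X ^ Fintype.card K - X) = C (m1 * c ^ p + m0 * b) * X ^ p + C (m0 * c + 1) * X := by
    have g1 := hgp 1
    simp only [pow_one] at g1
    rw [hgp 2, g1, hcard]
    simp only [m1, m0, hgd, C_add, C_mul, C_sub, C_neg, C_1]
    norm_num
    ring
  have hgQ : g ∣ X ^ Fintype.card K - X := by
    have hLg : L.comp (C lam * X + C 0) ∣ (X ^ Fintype.card K - X : K[X]).comp (C lam * X + C 0) := by
      obtain ⟨Z, hZ⟩ := hQ
      exact ⟨Z.comp (C lam * X + C 0), by rw [← mul_comp, ← hZ]⟩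
    have : (X ^ Fintype.card K - X : K[X]).comp (C lam * X + C 0) = C lam * (X ^ Fintype.card K - X) := by
      simp only [sub_comp, pow_comp, X_comp, C_0, add_zero, mul_pow, ← C_pow, FiniteField.pow_card]; ring
    rw [this] at hLg
    have h5 : L.comp (C lam * X + C 0) ∣ X ^ Fintype.card K - X :=
      ((isUnit_C.2 hlam0.isUnit).dvd_mul_left).1 hLg
    rw [← hg]
    exact ((isUnit_C.2 (inv_ne_zero hx0).isUnit).mul_left_dvd).2 h5
  have e2 : C (m1 * c ^ p + m0 * b) * X ^ p + C (m0 * c + 1) * X = (0 : K[X]) := by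
    apply eq_zero_of_dvd_of_natDegree_lt (p := g)
    · rw [← e1]
      refine dvd_sub (dvd_add (dvd_add (dvd_pow_self _ (by positivity)) (Dvd.dvd.mul_left (dvd_pow_self _ (by omega)) _)) (Dvd.intro_left _ rfl)) hgQ
    · rw [hgdeg]
      refine lt_of_le_of_lt (natDegree_add_le_of_le (natDegree_C_mul_X_pow_le _ _) (natDegree_C_mul_X_le _)) ?_
      rw [max_lt_iff]; omega
  have hc : m0 * c + 1 = 0 := by
    have := congrArg (fun f => f.coeff 1) e2
    simp only [coeff_add, coeff_C_mul, coeff_X_pow, coeff_X, coeff_zero] at this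
    rw [if_neg (by omega)] at this
    simpa using this
  have ev : ∀ x, (g.eval x) ^ p ^ 2 + m1 * (g.eval x) ^ p + m0 * (g.eval x) = 0 := by
    intro x
    have := congrArg (fun f => f.eval x) (e1.trans e2)
    simpa [FiniteField.pow_card] using this
  have ev1 := ev (lam⁻¹ * x0)
  rw [hone] at ev1; simp at ev1
  have ev2 : β ^ p ^ 2 + m1 * β ^ p + m0 * β = 0 := ev y
  have hb0 : β ^ p - β ≠ 0 := sub_ne_zero.2 hy
  have hu : m0 = (β ^ p - β) ^ (p - 1) := by
    apply mul_right_cancel₀ hb0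
    rw [← pow_succ, show p - 1 + 1 = p by omega, sub_pow_char, ← pow_mul, ← pow_two]
    linear_combination -ev2 + β ^ p * ev1
  have hbb : b = 1 + (β ^ p ^ 3 - β ^ p ^ 2) ^ (p - 1) := by
    have h7 : b ^ p ^ 2 = 1 + (β ^ p - β) ^ (p - 1) := by
      rw [← hu]; linear_combination -ev1
    rw [← q4 b, h7, add_pow_char_pow, one_pow, ← pow_mul, mul_comm (p - 1), pow_mul, sub_pow_char_pow, ← pow_mul]
    congr 3
    ring
  have hm0 : m0 ≠ 0 := by
    intro h; rw [h] at hc; simp at hc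
  have hcc : c = - ((β ^ p - β) ^ (p - 1))⁻¹ := by
    rw [← hu]; field_simp; linear_combination hc
  apply Good.of_typ
  right; right; right; left
  refine ⟨β, a, hy, ha, ?_⟩
  rw [← hbb, hgd]
  congr 1
  rw [hcc, C_neg]; ring

/-- combined additive lemma -/
theorem lemma45 {p : ℕ} [hp : Fact p.Prime] [CharP K p] (hcard : Fintype.card K = p ^ 4)
    (α κ ω β : K) (hκ : α = 0 → κ ≠ 0) (hω : ω ≠ 0) (L : K[X])
    (hL : L = C α * X ^ p ^ 2 + C κ * X ^ p + C ω * X + C β) (hQ : L ∣ X ^ Fintype.card K - X) (hd : 0 < L.natDegree) (a : ℕ) (ha : a ∣ p - 1) :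
    Good p (L ^ a) := by
  obtain ⟨s, hs⟩ := root_of_dvd_Q L hQ hd
  apply Good.of_comp 1 s one_ne_zero
  rw [pow_comp]
  have e : L.comp (C 1 * X + C s) = C α * X ^ p ^ 2 + C κ * X ^ p + C ω * X := by
    rw [hL] at hs ⊢
    simp at hs
    have h' := congrArg C hs
    simp only [C_add, C_mul, C_0, C_pow] at h'
    simp only [add_comp, mul_comp, C_comp, X_comp, pow_comp, C_1, one_mul, add_pow_char_pow, add_pow_char]
    linear_combination h'
  have hQ' : L.comp (C 1 * X + C s) ∣ X ^ Fintype.card K - X := by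
    have : (X ^ Fintype.card K - X : K[X]).comp (C 1 * X + C s) = X ^ Fintype.card K - X := by
      simp only [sub_comp, pow_comp, X_comp, C_1, one_mul]
      rw [hcard, add_pow_char_pow, ← C_pow, ← hcard, FiniteField.pow_card]; ring
    rw [← this]
    obtain ⟨Z, hZ⟩ := hQ
    exact ⟨Z.comp (C 1 * X + C s), by rw [← mul_comp, ← hZ]⟩
  by_cases hα : α = 0
  · exact lemma5 κ ω (hκ hα) hω _ (by rw [e, hα]; simp) hQ' a ha
  · exact lemma4 hcard α κ ω hα _ e hQ' a ha

end add

section caseE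
set_option linter.unusedSectionVars false
set_option linter.unusedSimpArgs false
variable {K : Type} [Field K] [Fintype K] [DecidableEq K]

theorem UWform (p : ℕ) [hp : Fact p.Prime] [CharP K p] (L : K[X]) (h : derivative (derivative L) = 0) :
    ∃ U W : K[X], L = U ^ p + X * W ^ p ∧ derivative L = W ^ p := by
  obtain ⟨W, hW⟩ := pth_root p _ h
  obtain ⟨U, hU⟩ := pth_root p (L - X * derivative L) (by simp [derivative_mul, h])
  exact ⟨U, W, by rw [← hU, ← hW]; ring, hW⟩

theorem degUW (P : ℕ) (L U W : K[X]) (h1 : L = U ^ P + X * W ^ P) (h2 : derivative L = W ^ P) :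
    P * U.natDegree ≤ L.natDegree ∧ P * W.natDegree ≤ L.natDegree - 1 := by
  have hw : P * W.natDegree ≤ L.natDegree - 1 := by
    rw [← natDegree_pow, ← h2]; exact natDegree_derivative_le _
  refine ⟨?_, hw⟩
  rw [← natDegree_pow, show U ^ P = L - X * derivative L by rw [h2]; conv_rhs => rw [h1]
                                                            ring]
  refine natDegree_sub_le_of_le le_rfl ?_ |>.trans (by simp : max L.natDegree L.natDegree ≤ _)
  rcases Nat.eq_zero_or_pos L.natDegree with h | h
  · rw [eq_C_of_natDegree_eq_zero h]; simp
  · refine natDegree_mul_le.trans ?_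
    have := natDegree_derivative_le L
    rw [natDegree_X]; omega

theorem coprimeUW (P : ℕ) (hP : 2 ≤ P) (L U W : K[X]) (h1 : L = U ^ P + X * W ^ P) (h2 : Squarefree L) : IsCoprime U W := by
  rw [← EuclideanDomain.gcd_isUnit_iff]
  apply h2
  rw [h1, ← pow_two]
  have a1 : EuclideanDomain.gcd U W ^ 2 ∣ U ^ P :=
    (pow_dvd_pow_of_dvd (EuclideanDomain.gcd_dvd_left U W) 2).trans (pow_dvd_pow _ hP)
  have a2 : EuclideanDomain.gcd U W ^ 2 ∣ W ^ P :=
    (pow_dvd_pow_of_dvd (EuclideanDomain.gcd_dvd_right U W) 2).trans (pow_dvd_pow _ hP)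
  exact dvd_add a1 (Dvd.dvd.mul_left a2 X)

theorem coprime_LW (p : ℕ) [hp : Fact p.Prime] (L W : K[X]) (h1 : L ∣ X ^ Fintype.card K - X)
    (h2 : derivative L = W ^ p) : IsCoprime L W := by
  have hs : (X ^ Fintype.card K - X : K[X]).Separable := by
    rw [separable_def, deriv_Q]; exact ⟨0, -1, by ring⟩
  have h3 := hs.of_dvd h1
  rw [separable_def, h2, IsCoprime.pow_right_iff hp.out.pos] at h3
  exact h3

theorem comp_digits (σ F : K[X]) (m : ℕ) (hm : σ.natDegree = m) :
    σ.comp F = ∑ j ∈ Finset.range (m + 1), C (σ.coeff j) * F ^ j := by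
  conv_lhs => rw [σ.as_sum_range_C_mul_X_pow, hm]
  rw [sum_comp]
  exact Finset.sum_congr rfl fun j _ => by simp

theorem comp_digits' (σ F : K[X]) (m : ℕ) (hm : σ.natDegree = m) :
    F * (derivative σ).comp F = ∑ j ∈ Finset.range (m + 1), C (σ.coeff j) * C (j : K) * F ^ j := by
  conv_lhs => rw [σ.as_sum_range_C_mul_X_pow, hm]
  rw [derivative_sum, sum_comp, Finset.mul_sum]
  refine Finset.sum_congr rfl fun j _ => ?_
  rcases j with _ | j
  · simp
  · simp [derivative_mul, derivative_X_pow]; ring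

theorem E_w {p : ℕ} [hp : Fact p.Prime] [CharP K p] (F L N U W σ : K[X]) (a h' r0' m k : ℕ)
    (hF : F = L ^ a * N ^ p) (ha : 1 ≤ a)
    (hL' : derivative L = W ^ p) (hm : σ.natDegree = m) (hk : k ≠ 0)
    (hE1 : U + X ^ p ^ k * W + L ^ (h' + 1) * N ^ (r0' + 1) * σ.comp F = 0) :
    U * derivative W - derivative U * W = L ^ h' * N ^ r0' *
      ∑ j ∈ Finset.range (m + 1), (C (σ.coeff j) * (C ((h' + 1 : ℕ) + (a : K) * (j : K)) * (W ^ (p + 1) * N)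
        + (L * (C ((r0' + 1 : ℕ) : K) * derivative N * W - derivative W * N)))) * F ^ j := by
  have hLF : L * derivative F = C (a : K) * (W ^ p * F) := by
    obtain ⟨b, rfl⟩ : ∃ b, a = b + 1 := ⟨a - 1, by omega⟩
    rw [hF, derivative_mul, deriv_pow_p p N, derivative_pow, hL']
    simp; ring
  have hd := congrArg derivative hE1
  have hXp : derivative (X ^ p ^ k : K[X]) = 0 := by
    rw [derivative_X_pow]; simp [hk]
  simp only [derivative_add, derivative_mul, hXp, derivative_pow, hL', derivative_comp, derivative_zero, zero_mul, zero_add, Nat.add_sub_cancel] at hd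
  have s1 : ∑ j ∈ Finset.range (m + 1), (C (σ.coeff j) * (C ((h' + 1 : ℕ) + (a : K) * (j : K)) * (W ^ (p + 1) * N)
        + (L * (C ((r0' + 1 : ℕ) : K) * derivative N * W - derivative W * N)))) * F ^ j
      = (C ((h' + 1 : ℕ) : K) * (W ^ (p + 1) * N) + (L * (C ((r0' + 1 : ℕ) : K) * derivative N * W - derivative W * N))) * σ.comp F
        + C (a : K) * (W ^ (p + 1) * N) * (F * (derivative σ).comp F) := by
    rw [comp_digits σ F m hm, comp_digits' σ F m hm, Finset.mul_sum, Finset.mul_sum, ← Finset.sum_add_distrib]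
    refine Finset.sum_congr rfl fun j _ => ?_
    simp only [C_add, C_mul]; ring
  rw [s1]
  linear_combination derivative W * hE1 - W * hd + L ^ h' * N ^ (r0' + 1) * W * (derivative σ).comp F * hLF

end caseE

section caseE2
set_option linter.unusedSectionVars false
set_option linter.unusedSimpArgs false
set_option linter.unusedVariables false
variable {K : Type} [Field K] [Fintype K] [DecidableEq K]

theorem Edeg (p a : ℕ) (hp : 2 ≤ p) (ha : 2 ≤ a) (L N W : K[X]) (s t u : K)
    (hd : 0 < L.natDegree) (hW : p * W.natDegree ≤ L.natDegree - 1) :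
    (C s * (C t * (W ^ (p + 1) * N) + (L * (C u * derivative N * W - derivative W * N)))).natDegree
      < a * L.natDegree + p * N.natDegree := by
  have hww : W.natDegree ≤ p * W.natDegree := Nat.le_mul_of_pos_left _ (by omega)
  have hnn : N.natDegree ≤ p * N.natDegree := Nat.le_mul_of_pos_left _ (by omega)
  have hdd : 2 * L.natDegree ≤ a * L.natDegree := Nat.mul_le_mul_right _ ha
  refine lt_of_le_of_lt (natDegree_C_mul_le _ _) ?_
  have b1 : (C t * (W ^ (p + 1) * N)).natDegree ≤ (p * W.natDegree + W.natDegree) + N.natDegree := by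
    refine (natDegree_C_mul_le _ _).trans (natDegree_mul_le.trans ?_)
    rw [natDegree_pow]; gcongr; apply le_of_eq; ring
  have b2 : (L * (C u * derivative N * W - derivative W * N)).natDegree ≤ L.natDegree + (N.natDegree + W.natDegree) := by
    refine natDegree_mul_le.trans ?_
    gcongr
    have c1 : (C u * derivative N * W).natDegree ≤ N.natDegree + W.natDegree := by
      refine natDegree_mul_le.trans ?_
      gcongr
      exact (natDegree_C_mul_le _ _).trans ((natDegree_derivative_le _).trans (by omega))
    have c2 : (derivative W * N).natDegree ≤ N.natDegree + W.natDegree := by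
      refine natDegree_mul_le.trans ?_
      have := natDegree_derivative_le W
      omega
    exact (natDegree_sub_le_of_le c1 c2).trans (by simp)
  refine lt_of_le_of_lt (natDegree_add_le_of_le b1 b2) ?_
  rw [max_lt_iff]
  constructor <;> omega

theorem F_deg {p : ℕ} (F L N : K[X]) (a : ℕ) (hF : F = L ^ a * N ^ p) (hL : L ≠ 0) (hN : N ≠ 0) :
    F.natDegree = a * L.natDegree + p * N.natDegree := by
  rw [hF, natDegree_mul (pow_ne_zero _ hL) (pow_ne_zero _ hN), natDegree_pow, natDegree_pow]

theorem cast_mod_solve (p : ℕ) [hp : Fact p.Prime] [CharP K p] (x y : ℕ) (hy : ((y : ℕ) : K) ≠ 0) :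
    ∃ b : ℕ, b < p ∧ p ∣ x + b * y := by
  have hc : ¬ p ∣ y := fun h => hy ((CharP.cast_eq_zero_iff K p y).2 h)
  have hy' : ((y : ℕ) : ZMod p) ≠ 0 := fun h => hc ((ZMod.natCast_eq_zero_iff y p).1 h)
  refine ⟨(-(x : ZMod p) / (y : ZMod p)).val, ZMod.val_lt _, ?_⟩
  rw [← ZMod.natCast_eq_zero_iff]
  push_cast
  rw [ZMod.natCast_val, ZMod.cast_id]
  field_simp
  ring

theorem E_w0 {p : ℕ} [hp : Fact p.Prime] [CharP K p] (hcard : Fintype.card K = p ^ 4)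
    (F L N U W σ S : K[X]) (a h' r0' m r : ℕ) (ha : 2 ≤ a)
    (hF : F = L ^ a * N ^ p) (hN : N ≠ 0) (hLm : L.Monic) (hLQ : L ∣ X ^ Fintype.card K - X)
    (hd : 0 < L.natDegree) (hUW : L = U ^ p + X * W ^ p)
    (hL' : derivative L = W ^ p) (hm : σ.natDegree = m) (hσ : σ ≠ 0)
    (hph : a * (r0' + 1) + 1 = p * (h' + 1)) (hr0 : r0' + 1 < p) (hrm : r = r0' + 1 + p * m) (hr : 2 ≤ r)
    (hw : U * derivative W - derivative U * W = 0)
    (hsum : ∑ j ∈ Finset.range (m + 1), (C (σ.coeff j) * (C ((h' + 1 : ℕ) + (a : K) * (j : K)) * (W ^ (p + 1) * N)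
        + (L * (C ((r0' + 1 : ℕ) : K) * derivative N * W - derivative W * N)))) * F ^ j = 0)
    (hS : S.natDegree = r) (hS0 : S.eval 0 = 0)
    (hE : L + L * S.comp F + (X ^ Fintype.card K - X) * derivative L = 0)
    (hn : r * F.natDegree ≤ p ^ 4 - 1) : Good p F := by
  have h2 := hp.out.two_le
  have hFd := F_deg F L N a hF hLm.ne_zero hN
  have had : 0 < a * L.natDegree := Nat.mul_pos (by omega) hd
  have hFpos : 0 < F.natDegree := by omega
  by_cases hd1 : L.natDegree = 1
  · exact lemmaX hcard F S L r hr hS hS0 hLm hd1 hFpos hE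
  have hsq : Squarefree L := Q_squarefree.squarefree_of_dvd hLQ
  obtain ⟨dU, dW⟩ := degUW p L U W hUW hL'
  have hcUW := coprimeUW p h2 L U W hUW hsq
  have hcLW := coprime_LW p L W hLQ hL'
  have hW0 : W ≠ 0 := by
    rintro rfl
    have := isUnit_iff_degree_eq_zero.1 (isCoprime_zero_right.1 hcLW)
    rw [degree_eq_natDegree hLm.ne_zero] at this
    norm_cast at this; omega
  have hWd : derivative W = 0 := by
    apply dvd_deriv
    apply hcUW.symm.dvd_of_dvd_mul_left
    exact ⟨derivative U, by linear_combination hw⟩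
  have hUd : derivative U = 0 := by
    rw [hWd, mul_zero, zero_sub, neg_eq_zero, mul_eq_zero] at hw
    exact hw.resolve_right hW0
  obtain ⟨U1, hU1⟩ := pth_root p U hUd
  obtain ⟨W1, hW1⟩ := pth_root p W hWd
  have hL2 : derivative L = W1 ^ p ^ 2 := by rw [hL', hW1, ← pow_mul, pow_two]
  have hUW2 : L = U1 ^ p ^ 2 + X * W1 ^ p ^ 2 := by
    conv_lhs => rw [hUW, hU1, hW1]
    rw [← pow_mul, ← pow_mul, pow_two]
  obtain ⟨dU1, dW1⟩ := degUW (p ^ 2) L U1 W1 hUW2 hL2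
  have hp2 : 4 ≤ p ^ 2 := by nlinarith
  have hdp : p ^ 2 ≤ L.natDegree := by
    by_contra hlt
    have u0 : U1.natDegree = 0 := by
      by_contra hne
      have : p ^ 2 * 1 ≤ p ^ 2 * U1.natDegree := Nat.mul_le_mul_left _ (by omega)
      omega
    have w0 : W1.natDegree = 0 := by
      by_contra hne
      have : p ^ 2 * 1 ≤ p ^ 2 * W1.natDegree := Nat.mul_le_mul_left _ (by omega)
      omega
    have : L.natDegree ≤ 1 := by
      rw [hUW2]
      refine (natDegree_add_le_of_le (m := 0) (n := 1) ?_ ?_).trans (by simp)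
      · rw [natDegree_pow, u0]; simp
      · refine natDegree_mul_le.trans ?_
        rw [natDegree_pow, w0]; simp
    omega
  -- top digit
  have htop := digits F hFpos (m + 1) _ (fun j _ => by
    rw [hFd]; exact Edeg p a h2 ha L N W _ _ _ hd dW) hsum m (by omega)
  have hlc : σ.coeff m ≠ 0 := by rw [← hm]; exact leadingCoeff_ne_zero.2 hσ
  rw [mul_eq_zero, hWd] at htop
  have htop := htop.resolve_left (C_ne_zero.2 hlc)
  have hr0ne : ((r0' + 1 : ℕ) : K) ≠ 0 := by
    intro h; have := Nat.le_of_dvd (by omega) ((CharP.cast_eq_zero_iff K p _).1 h); omega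
  obtain ⟨b, hb, hbd⟩ := cast_mod_solve (K := K) p (h' + 1 + a * m) (r0' + 1) hr0ne
  have hbK : ((h' + 1 : ℕ) + (a : K) * (m : K)) + (b : K) * ((r0' + 1 : ℕ) : K) = 0 := by
    have := (CharP.cast_eq_zero_iff K p _).2 hbd
    push_cast at this ⊢; linear_combination this
  have hlog : L * derivative N = C (b : K) * (derivative L * N) := by
    have e : (C ((r0' + 1 : ℕ) : K) * W) * (L * derivative N) = (C ((r0' + 1 : ℕ) : K) * W) * (C (b : K) * (derivative L * N)) := by
      rw [hL']
      have hbC := congrArg (C : K → K[X]) hbK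
      rw [C_add, C_mul, C_0] at hbC
      linear_combination htop - W ^ (p + 1) * N * hbC
    exact mul_left_cancel₀ (mul_ne_zero (C_ne_zero.2 hr0ne) hW0) e
  obtain ⟨N1, hN1⟩ := log_deriv p L N hsq b hb hlog
  have hN10 : N1 ≠ 0 := by rintro rfl; rw [zero_pow hp.out.ne_zero, mul_zero] at hN1; exact hN hN1
  have hF2 : F = L ^ (a + p * b) * N1 ^ p ^ 2 := by
    rw [hF, hN1, mul_pow, ← pow_mul, ← pow_mul, pow_add, pow_two, mul_comm b p]; ring
  have hFd2 := F_deg F L N1 (a + p * b) hF2 hLm.ne_zero hN10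
  set v := a + p * b with hv
  have hvdvd : p ^ 2 ∣ v * r + 1 := by
    obtain ⟨k, hk⟩ := hbd
    refine ⟨k + b * m, ?_⟩
    have : v * r + 1 = (a * (r0' + 1) + 1) + p * (a * m) + p * (b * (r0' + 1)) + p * p * (b * m) := by
      rw [hv, hrm]; ring
    rw [this, hph]
    calc p * (h' + 1) + p * (a * m) + p * (b * (r0' + 1)) + p * p * (b * m) = p * (h' + 1 + a * m + b * (r0' + 1)) + p * p * (b * m) := by ring
      _ = _ := by rw [hk]; ring
  have hp4 : p ^ 4 = p ^ 2 * p ^ 2 := by ring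
  have hvpos : 0 < v := by omega
  have hvr1 : v * r < p ^ 2 := by
    by_contra hge
    push Not at hge
    have : p ^ 2 * p ^ 2 ≤ (v * r) * L.natDegree := Nat.mul_le_mul hge hdp
    have h5 : r * F.natDegree = v * r * L.natDegree + r * (p ^ 2 * N1.natDegree) := by rw [hFd2]; ring
    have : 0 < p ^ 2 * p ^ 2 := by positivity
    omega
  have hvr : v * r = p ^ 2 - 1 := by
    have := Nat.le_of_dvd (by omega) hvdvd
    omega
  have h5 : r * F.natDegree = (p ^ 2 - 1) * L.natDegree + p ^ 2 * (r * N1.natDegree) := by rw [hFd2, ← hvr]; ring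
  have hN1d : N1.natDegree = 0 := by
    by_contra hne
    have c1 : (p ^ 2 - 1) * p ^ 2 ≤ (p ^ 2 - 1) * L.natDegree := Nat.mul_le_mul_left _ hdp
    have c2 : p ^ 2 * 1 ≤ p ^ 2 * (r * N1.natDegree) := Nat.mul_le_mul_left _ (Nat.mul_pos (by omega) (by omega))
    have c3 : (p ^ 2 - 1) * p ^ 2 + p ^ 2 = p ^ 2 * p ^ 2 := by
      rw [← Nat.succ_mul]; congr 1; omega
    have : 0 < p ^ 2 * p ^ 2 := by positivity
    omega
  have hdle : L.natDegree ≤ p ^ 2 + 1 := by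
    by_contra hgt
    have c1 : (p ^ 2 - 1) * (p ^ 2 + 2) ≤ (p ^ 2 - 1) * L.natDegree := Nat.mul_le_mul_left _ (by omega)
    have c3 : (p ^ 2 - 1) * (p ^ 2 + 2) = p ^ 2 * p ^ 2 + p ^ 2 - 2 := by
      obtain ⟨s, hs⟩ : ∃ s, p ^ 2 = s + 1 := ⟨p ^ 2 - 1, by omega⟩
      rw [hs]; simp only [Nat.add_sub_cancel]
      have : (s + 1) * (s + 1) + (s + 1) = s * (s + 1 + 2) + 2 := by ring
      omega
    omega
  have u1 : U1.natDegree ≤ 1 := by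
    by_contra hgt
    have : p ^ 2 * 2 ≤ p ^ 2 * U1.natDegree := Nat.mul_le_mul_left _ (by omega)
    omega
  have w1 : W1.natDegree ≤ 1 := by
    by_contra hgt
    have : p ^ 2 * 2 ≤ p ^ 2 * W1.natDegree := Nat.mul_le_mul_left _ (by omega)
    omega
  set Y := U1 + X ^ p ^ 2 * W1 with hY
  have hYP : Y ^ p ^ 2 = - (L * S.comp F) := by
    rw [hY, add_pow_char_pow, mul_pow, ← pow_mul, ← pow_add]
    rw [hL2, hcard] at hE
    norm_num
    linear_combination hE - hUW2
  have hLY : L ∣ Y := by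
    have : L ∣ Y ^ p ^ 2 := by rw [hYP]; exact (Dvd.intro _ rfl : L ∣ L * S.comp F).neg_right
    exact (hsq.dvd_pow_iff_dvd (by positivity)).1 this
  have hS00 : S ≠ 0 := by rintro rfl; simp at hS; omega
  have hScomp : S.comp F ≠ 0 := by
    intro h
    have := natDegree_comp (p := S) (q := F)
    rw [h, hS, natDegree_zero] at this
    have : 0 < r * F.natDegree := Nat.mul_pos (by omega) hFpos
    omega
  have hY0 : Y ≠ 0 := by
    intro h; rw [h, zero_pow (by positivity)] at hYP
    exact mul_ne_zero hLm.ne_zero hScomp (neg_eq_zero.1 hYP.symm)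
  have hYd : Y.natDegree ≤ L.natDegree := by
    have c1 : Y.natDegree ≤ max 1 (p ^ 2 + W1.natDegree) := by
      refine natDegree_add_le_of_le u1 ?_
      refine natDegree_mul_le.trans ?_
      simp
    rcases Nat.eq_zero_or_pos W1.natDegree with hz | hz
    · rw [hz] at c1; rw [max_eq_right (by omega)] at c1; omega
    · have : W1.natDegree = 1 := by omega
      rw [this] at c1 dW1; rw [max_eq_right (by omega)] at c1; omega
  obtain ⟨κ', hκ'⟩ := hLY
  have hκ0 : κ' ≠ 0 := by rintro rfl; rw [mul_zero] at hκ'; exact hY0 hκ'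
  have hκd : κ'.natDegree = 0 := by
    have := natDegree_mul hLm.ne_zero hκ0
    rw [← hκ'] at this; omega
  obtain ⟨κ, hκ⟩ := natDegree_eq_zero.1 hκd
  have hκn : κ ≠ 0 := by rintro rfl; rw [C_0] at hκ; exact hκ0 hκ.symm
  obtain ⟨n1, hn1⟩ := natDegree_eq_zero.1 hN1d
  have hn10 : n1 ≠ 0 := by rintro rfl; rw [C_0] at hn1; exact hN10 hn1.symm
  rw [hF2, ← hn1, ← C_pow, mul_comm]
  apply Good.of_const_mul _ (pow_ne_zero _ hn10)
  have eU := eq_X_add_C_of_natDegree_le_one u1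
  have eW := eq_X_add_C_of_natDegree_le_one w1
  refine lemma3 hcard (W1.coeff 1) (U1.coeff 1) (U1.coeff 0) (W1.coeff 0) κ hκn L ?_ ?_ hd v ⟨r, hvr.symm⟩ ?_
  · conv_lhs => rw [hUW2, eU, eW]
    rw [add_pow_char_pow, add_pow_char_pow, mul_pow, mul_pow]
    simp only [C_pow]; ring
  · rw [mul_comm (C κ) L, hκ, ← hκ', hY]
    conv_rhs => rw [eU, eW]
    ring
  · intro h
    rw [h] at hvr
    have : (p ^ 2 - 1) * 2 ≤ (p ^ 2 - 1) * r := Nat.mul_le_mul_left _ hr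
    omega

end caseE2

section caseE3
set_option linter.unusedSectionVars false
set_option linter.unusedSimpArgs false
set_option linter.unusedVariables false
variable {K : Type} [Field K] [Fintype K] [DecidableEq K]

theorem pow_natDegree_zero (p : ℕ) [hp : Fact p.Prime] [CharP K p] (f : K[X]) (h : derivative f = 0) (hd : f.natDegree < p) :
    f.natDegree = 0 := by
  obtain ⟨g, rfl⟩ := pth_root p f h
  rw [natDegree_pow] at hd ⊢
  by_contra hne
  have : g.natDegree ≠ 0 := by rintro h0; rw [h0] at hne; simp at hne
  have : p * 1 ≤ p * g.natDegree := Nat.mul_le_mul_left _ (by omega)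
  omega

theorem E_w1 {p : ℕ} [hp : Fact p.Prime] [CharP K p] (hcard : Fintype.card K = p ^ 4)
    (F L N U W σ : K[X]) (a r0' m r : ℕ) (ha : 2 ≤ a) (hap : a < p)
    (hF : F = L ^ a * N ^ p) (hN : N ≠ 0) (hLm : L.Monic) (hLQ : L ∣ X ^ Fintype.card K - X)
    (hd : 0 < L.natDegree) (hUW : L = U ^ p + X * W ^ p)
    (hL' : derivative L = W ^ p) (hm : σ.natDegree = m) (hσ : σ ≠ 0) (hm1 : 1 ≤ m)
    (hph : a * (r0' + 1) + 1 = p) (hrm : r = r0' + 1 + p * m)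
    (hE1 : U + X ^ p ^ 3 * W + L ^ (0 + 1) * N ^ (r0' + 1) * σ.comp F = 0)
    (hw : U * derivative W - derivative U * W ≠ 0)
    (hsum : U * derivative W - derivative U * W = N ^ r0' * ∑ j ∈ Finset.range (m + 1), (C (σ.coeff j) * (C ((0 + 1 : ℕ) + (a : K) * (j : K)) * (W ^ (p + 1) * N)
        + (L * (C ((r0' + 1 : ℕ) : K) * derivative N * W - derivative W * N)))) * F ^ j)
    (hn : r * F.natDegree ≤ p ^ 4 - 1) : Good p F := by
  have h2 := hp.out.two_le
  have hFd := F_deg F L N a hF hLm.ne_zero hN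
  have had : 2 * L.natDegree ≤ a * L.natDegree := Nat.mul_le_mul_right _ ha
  have hFpos : 0 < F.natDegree := by omega
  have hsq : Squarefree L := Q_squarefree.squarefree_of_dvd hLQ
  obtain ⟨dU, dW⟩ := degUW p L U W hUW hL'
  have hcUW := coprimeUW p h2 L U W hUW hsq
  have hcLW := coprime_LW p L W hLQ hL'
  have hW0 : W ≠ 0 := by rintro rfl; simp at hw
  have hUp : U.natDegree * 3 ≤ p * U.natDegree := by rw [mul_comm]; exact Nat.mul_le_mul_right _ (by omega)
  have hWp : W.natDegree * 3 ≤ p * W.natDegree := by rw [mul_comm]; exact Nat.mul_le_mul_right _ (by omega)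
  have hwd : (U * derivative W - derivative U * W).natDegree < L.natDegree := by
    have c1 : (U * derivative W).natDegree ≤ U.natDegree + W.natDegree := by
      refine natDegree_mul_le.trans ?_
      have := natDegree_derivative_le W
      omega
    have c2 : (derivative U * W).natDegree ≤ U.natDegree + W.natDegree := by
      refine natDegree_mul_le.trans ?_
      have := natDegree_derivative_le U
      omega
    have := natDegree_sub_le_of_le c1 c2
    rw [max_self] at this
    omega
  set c : ℕ → K[X] := fun j => (C (σ.coeff j) * (C ((0 + 1 : ℕ) + (a : K) * (j : K)) * (W ^ (p + 1) * N)
        + (L * (C ((r0' + 1 : ℕ) : K) * derivative N * W - derivative W * N)))) with hc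
  have hcd : ∀ j, (c j).natDegree < F.natDegree := fun j => by
    rw [hFd]; exact Edeg p a h2 ha L N W _ _ _ hd dW
  set Y := ∑ j ∈ Finset.range (m + 1), c j * F ^ j with hYdef
  have hsum' : U * derivative W - derivative U * W = N ^ r0' * Y := hsum
  have hYd : Y.natDegree < F.natDegree := by
    have hY0 : Y ≠ 0 := by rintro h; rw [h, mul_zero] at hsum'; exact hw hsum'
    have := natDegree_mul (pow_ne_zero r0' hN) hY0
    rw [← hsum'] at this
    omega
  have hdig := digits F hFpos (m + 1) (fun j => c j - if j = 0 then Y else 0) (fun j _ => by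
    split_ifs with h
    · exact lt_of_le_of_lt (natDegree_sub_le _ _) (max_lt (hcd j) hYd)
    · rw [sub_zero]; exact hcd j) (by
    simp only [sub_mul, Finset.sum_sub_distrib, ite_mul, zero_mul, Finset.sum_ite_eq', Finset.mem_range]
    simp [hYdef])
  have hcm : c m = 0 := by
    have := hdig m (by omega)
    simpa [show m ≠ 0 by omega] using this
  have hc0 : c 0 = Y := by
    have := hdig 0 (by omega)
    simpa [sub_eq_zero] using this
  have hlc : σ.coeff m ≠ 0 := by rw [← hm]; exact leadingCoeff_ne_zero.2 hσ
  have htop : C ((0 + 1 : ℕ) + (a : K) * (m : K)) * (W ^ (p + 1) * N)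
        + (L * (C ((r0' + 1 : ℕ) : K) * derivative N * W - derivative W * N)) = 0 := by
    simp only [hc, mul_eq_zero, C_eq_zero, hlc, false_or] at hcm
    exact hcm
  -- N, W coprime
  have hcNW : IsCoprime W N := by
    have h5 : IsCoprime W (L ^ (0 + 1) * N ^ (r0' + 1) * σ.comp F) := by
      have : L ^ (0 + 1) * N ^ (r0' + 1) * σ.comp F = -U + W * (-X ^ p ^ 3) := by linear_combination hE1
      rw [this]
      exact IsCoprime.add_mul_left_right hcUW.symm.neg_right _
    exact h5.of_isCoprime_of_dvd_right ⟨L ^ (0 + 1) * N ^ r0' * σ.comp F, by ring⟩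
  have hWd : derivative W = 0 := by
    apply dvd_deriv
    apply hcNW.dvd_of_dvd_mul_right
    apply hcLW.symm.dvd_of_dvd_mul_left
    exact ⟨C ((0 + 1 : ℕ) + (a : K) * (m : K)) * (W ^ p * N) + L * (C ((r0' + 1 : ℕ) : K) * derivative N), by linear_combination -htop⟩
  rw [hWd] at htop hsum' hw
  have hU' : derivative U = C ((a : K) * (m : K) * σ.coeff 0) * (W ^ p * N ^ (r0' + 1)) := by
    apply mul_right_cancel₀ hW0
    rw [← hc0] at hsum'
    simp only [hc, hWd] at hsum'
    simp only [C_mul, C_add, Nat.cast_zero, mul_zero, add_zero] at hsum' htop ⊢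
    linear_combination -hsum' - N ^ r0' * C (σ.coeff 0) * htop
  have hcst : (a : K) * (m : K) * σ.coeff 0 ≠ 0 := by
    intro h; rw [h, C_0, zero_mul] at hU'; rw [hU'] at hw; simp at hw
  have hU'deg : (derivative U).natDegree = p * W.natDegree + (r0' + 1) * N.natDegree := by
    rw [hU', natDegree_C_mul hcst, natDegree_mul (pow_ne_zero _ hW0) (pow_ne_zero _ hN), natDegree_pow, natDegree_pow]
  have hU'le := natDegree_derivative_le U
  have hNle : N.natDegree ≤ (r0' + 1) * N.natDegree := Nat.le_mul_of_pos_left _ (by omega)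
  have htop2 : C ((0 + 1 : ℕ) + (a : K) * (m : K)) * (W ^ p * N) + L * (C ((r0' + 1 : ℕ) : K) * derivative N) = 0 := by
    apply mul_right_cancel₀ hW0
    linear_combination htop
  have hr0ne : ((r0' + 1 : ℕ) : K) ≠ 0 := by
    intro h
    have := Nat.le_of_dvd (by omega) ((CharP.cast_eq_zero_iff K p _).1 h)
    nlinarith
  have hz : ((0 + 1 : ℕ) + (a : K) * (m : K)) = 0 := by
    by_contra hne
    have : L ∣ W ^ p * N := by
      have : L ∣ C ((0 + 1 : ℕ) + (a : K) * (m : K)) * (W ^ p * N) :=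
        ⟨-(C ((r0' + 1 : ℕ) : K) * derivative N), by linear_combination htop2⟩
      rwa [IsUnit.dvd_mul_left] at this
      exact isUnit_C.2 (Ne.isUnit hne)
    have := (hcLW.pow_right (n := p)).dvd_of_dvd_mul_left this
    have := natDegree_le_of_dvd this hN
    omega
  rw [hz, C_0, zero_mul, zero_add] at htop2
  have hN' : derivative N = 0 := by
    simp only [mul_eq_zero, hLm.ne_zero, C_eq_zero, hr0ne, false_or] at htop2
    exact htop2
  have hdiv : p ∣ a * m + 1 := by
    rw [← CharP.cast_eq_zero_iff K p]; push_cast at hz ⊢; linear_combination hz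
  have ham : p ≤ a * m + 1 := Nat.le_of_dvd (by omega) hdiv
  have hpp : p ^ 2 = p * p := by ring
  have har : p ^ 2 - 1 ≤ a * r := by
    have : a * r + 1 = p * (a * m + 1) := by
      rw [hrm]
      calc a * (r0' + 1 + p * m) + 1 = (a * (r0' + 1) + 1) + p * (a * m) := by ring
        _ = _ := by rw [hph]; ring
    have : p * p ≤ p * (a * m + 1) := Nat.mul_le_mul_left _ ham
    omega
  have hp2 : 9 ≤ p ^ 2 := by nlinarith
  have hp4 : p ^ 4 = p ^ 2 * p ^ 2 := by ring
  have hdle : L.natDegree ≤ p ^ 2 + 1 := by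
    by_contra hgt
    have c1 : (p ^ 2 - 1) * (p ^ 2 + 2) ≤ (a * r) * L.natDegree := Nat.mul_le_mul har (by omega)
    have c3 : (p ^ 2 - 1) * (p ^ 2 + 2) = p ^ 2 * p ^ 2 + p ^ 2 - 2 := by
      obtain ⟨s, hs⟩ : ∃ s, p ^ 2 = s + 1 := ⟨p ^ 2 - 1, by omega⟩
      rw [hs]; simp only [Nat.add_sub_cancel]
      have : (s + 1) * (s + 1) + (s + 1) = s * (s + 1 + 2) + 2 := by ring
      omega
    have h5 : r * F.natDegree = a * r * L.natDegree + r * (p * N.natDegree) := by rw [hFd]; ring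
    omega
  have hUd : U.natDegree ≤ p := by
    by_contra hgt
    have : p * (p + 1) ≤ p * U.natDegree := Nat.mul_le_mul_left _ (by omega)
    have : p * (p + 1) = p * p + p := by ring
    omega
  have hWc : W.natDegree = 0 := by
    apply pow_natDegree_zero p W hWd
    have : W.natDegree ≤ p * W.natDegree := Nat.le_mul_of_pos_left _ (by omega)
    omega
  have hNc : N.natDegree = 0 := by
    apply pow_natDegree_zero p N hN'
    omega
  obtain ⟨ω, hω⟩ := natDegree_eq_zero.1 hWc
  obtain ⟨ν, hν⟩ := natDegree_eq_zero.1 hNc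
  have hω0 : ω ≠ 0 := by rintro rfl; rw [C_0] at hω; exact hW0 hω.symm
  have hν0 : ν ≠ 0 := by rintro rfl; rw [C_0] at hν; exact hN hν.symm
  rw [← hω, ← hν, ← C_pow, ← C_pow, ← C_mul, ← C_mul] at hU'
  set u := (a : K) * (m : K) * σ.coeff 0 * (ω ^ p * ν ^ (r0' + 1))
  have hu0 : u ≠ 0 := mul_ne_zero hcst (mul_ne_zero (pow_ne_zero _ hω0) (pow_ne_zero _ hν0))
  obtain ⟨A, hA⟩ := pth_root p (U - C u * X) (by rw [derivative_sub, hU']; simp)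
  have hAd : A.natDegree ≤ 1 := by
    have c1 : (A ^ p).natDegree ≤ p := by
      rw [← hA]
      refine (natDegree_sub_le_of_le hUd (natDegree_C_mul_X_le u)).trans ?_
      exact max_le le_rfl (by omega)
    rw [natDegree_pow] at c1
    by_contra hgt
    have : p * 2 ≤ p * A.natDegree := Nat.mul_le_mul_left _ (by omega)
    omega
  have eA := eq_X_add_C_of_natDegree_le_one hAd
  have hUe : U = A ^ p + C u * X := by linear_combination hA
  rw [hF, ← hν, ← C_pow, mul_comm]
  apply Good.of_const_mul _ (pow_ne_zero _ hν0)
  refine lemma45 hcard ((A.coeff 1) ^ p ^ 2) (u ^ p) (ω ^ p) ((A.coeff 0) ^ p ^ 2) (fun _ => pow_ne_zero _ hu0) (pow_ne_zero _ hω0) L ?_ hLQ hd a ⟨r0' + 1, by omega⟩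
  conv_lhs => rw [hUW, hUe, ← hω, eA]
  rw [add_pow_char, ← pow_mul, ← pow_two, add_pow_char_pow, mul_pow, mul_pow]
  simp only [C_pow]; ring

/-- core of case E -/
theorem E_core {p : ℕ} [hp : Fact p.Prime] [CharP K p] (hcard : Fintype.card K = p ^ 4)
    (F L N S : K[X]) (a r : ℕ) (ha : 2 ≤ a) (hap : a < p) (hr : 2 ≤ r) (har : p ∣ a * r + 1)
    (hF : F = L ^ a * N ^ p) (hN : N ≠ 0) (hLm : L.Monic) (hLQ : L ∣ X ^ Fintype.card K - X)
    (hd : 0 < L.natDegree) (hL2 : derivative (derivative L) = 0)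
    (hS : S.natDegree = r) (hS' : X * derivative S = C (r : K) * S)
    (hE : L + L * S.comp F + (X ^ Fintype.card K - X) * derivative L = 0)
    (hn : r * F.natDegree ≤ p ^ 4 - 1) : Good p F ∨ (a * r = p - 1 ∧ ∃ s : K, S = C s * X ^ r) := by
  have h2 := hp.out.two_le
  have hS0 : S ≠ 0 := by rintro rfl; simp at hS; omega
  obtain ⟨U, W, hUW, hL'⟩ := UWform p L hL2
  set r0 := r % p with hr0
  have hrr : r = r0 + p * (r / p) := (Nat.mod_add_div r p).symm
  have hr0p : r0 < p := Nat.mod_lt _ (by omega)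
  have hr0K : (r : K) = (r0 : K) := by
    conv_lhs => rw [hrr]
    push_cast; simp
  obtain ⟨σ, hσ⟩ := log_deriv p X S prime_X.irreducible.squarefree r0 hr0p (by rw [hS', hr0K, derivative_X, one_mul])
  have hσ0 : σ ≠ 0 := by rintro rfl; rw [zero_pow (by omega), mul_zero] at hσ; exact hS0 hσ
  have hdeg : r = r0 + p * σ.natDegree := by
    conv_lhs => rw [← hS, hσ]
    rw [natDegree_mul (pow_ne_zero _ X_ne_zero) (pow_ne_zero _ hσ0), natDegree_pow, natDegree_pow, natDegree_X, mul_one]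
  have har0 : p ∣ a * r0 + 1 := by
    have : a * r + 1 = (a * r0 + 1) + p * (a * σ.natDegree) := by
      conv_lhs => rw [hdeg]
      ring
    rw [this] at har
    exact (Nat.dvd_add_left (Dvd.intro _ rfl)).1 har
  have hr0pos : r0 ≠ 0 := by
    intro h; rw [h, mul_zero, zero_add] at har0
    have := Nat.le_of_dvd (by omega) har0; omega
  obtain ⟨r0', hr0'⟩ : ∃ k, r0 = k + 1 := ⟨r0 - 1, by omega⟩
  obtain ⟨h, hh⟩ := har0
  obtain ⟨h', hh'⟩ : ∃ k, h = k + 1 := by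
    refine ⟨h - 1, ?_⟩
    have : h ≠ 0 := by rintro rfl; simp at hh
    omega
  rw [hr0'] at hσ hdeg hh hr0p
  rw [hh'] at hh
  have hS00 : S.eval 0 = 0 := by rw [hσ]; simp
  have hE1 : U + X ^ p ^ 3 * W + L ^ (h' + 1) * N ^ (r0' + 1) * σ.comp F = 0 := by
    have e : (U + X ^ p ^ 3 * W) ^ p + (L ^ (h' + 1) * N ^ (r0' + 1) * σ.comp F) ^ p = 0 := by
      rw [add_pow_char, mul_pow, mul_pow, mul_pow, ← pow_mul, ← pow_mul, ← pow_mul, ← pow_succ, mul_comm (h' + 1) p, ← hh]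
      have hSF : S.comp F = F ^ (r0' + 1) * (σ.comp F) ^ p := by
        rw [hσ, mul_comp, pow_comp, pow_comp, X_comp]
      have hFr : F ^ (r0' + 1) = L ^ (a * (r0' + 1)) * N ^ ((r0' + 1) * p) := by
        rw [hF, mul_pow, ← pow_mul, ← pow_mul, mul_comm p]
      rw [hSF, hFr, hL', hcard] at hE
      norm_num
      linear_combination hE - hUW
    exact frob_neg p e
  have hsum := E_w F L N U W σ a h' r0' σ.natDegree 3 hF (by omega) hL' rfl (by norm_num) hE1
  by_cases hw : U * derivative W - derivative U * W = 0
  · left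
    rw [hw] at hsum
    have hsum0 := (mul_eq_zero.1 hsum.symm).resolve_left (mul_ne_zero (pow_ne_zero _ hLm.ne_zero) (pow_ne_zero _ hN))
    exact E_w0 hcard F L N U W σ S a h' r0' σ.natDegree r ha hF hN hLm hLQ hd hUW hL' rfl hσ0 hh hr0p hdeg hr hw hsum0 hS hS00 hE hn
  · obtain ⟨dU, dW⟩ := degUW p L U W hUW hL'
    have hUp : U.natDegree * 3 ≤ p * U.natDegree := by rw [mul_comm]; exact Nat.mul_le_mul_right _ (by omega)
    have hWp : W.natDegree * 3 ≤ p * W.natDegree := by rw [mul_comm]; exact Nat.mul_le_mul_right _ (by omega)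
    have hh0 : h' = 0 := by
      by_contra hne
      apply hw
      refine eq_zero_of_dvd_of_natDegree_lt (p := L) ?_ ?_
      · rw [hsum, mul_assoc]
        exact Dvd.dvd.mul_right (dvd_pow_self _ hne) _
      · have c1 : (U * derivative W).natDegree ≤ U.natDegree + W.natDegree := by
          refine natDegree_mul_le.trans ?_
          have := natDegree_derivative_le W
          omega
        have c2 : (derivative U * W).natDegree ≤ U.natDegree + W.natDegree := by
          refine natDegree_mul_le.trans ?_
          have := natDegree_derivative_le U
          omega
        have := natDegree_sub_le_of_le c1 c2
        rw [max_self] at this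
        omega
    subst hh0
    by_cases hm : σ.natDegree = 0
    · right
      rw [hm] at hdeg
      simp only [mul_zero, add_zero, zero_add, mul_one] at hdeg hh
      refine ⟨by rw [hdeg]; omega, ?_⟩
      obtain ⟨s, hs⟩ := natDegree_eq_zero.1 hm
      exact ⟨s ^ p, by rw [hσ, ← hs, hdeg, C_pow]; ring⟩
    · left
      rw [pow_zero, one_mul] at hsum
      exact E_w1 hcard F L N U W σ a r0' σ.natDegree r ha hap hF hN hLm hLQ hd hUW hL' rfl hσ0 (by omega) (by omega) hdeg hE1 hw hsum hn

end caseE3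

section digit
set_option linter.unusedSectionVars false
set_option linter.unusedSimpArgs false
set_option linter.unusedVariables false
variable {K : Type} [Field K] [Fintype K] [DecidableEq K]

def rot (p k : ℕ) : ℕ := p * (k % p ^ 3) + k / p ^ 3

theorem rot_lt (p k : ℕ) (hp : 0 < p) (hk : k < p ^ 4) : rot p k < p ^ 4 := by
  have h1 : k % p ^ 3 < p ^ 3 := Nat.mod_lt _ (by positivity)
  have h2 : k / p ^ 3 < p := by rw [Nat.div_lt_iff_lt_mul (by positivity)]; rw [show p * p ^ 3 = p ^ 4 by ring]; exact hk
  unfold rot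
  calc _ < p * (k % p ^ 3) + p := by omega
    _ = p * (k % p ^ 3 + 1) := by ring
    _ ≤ p * p ^ 3 := by gcongr; exact h1
    _ = p ^ 4 := by ring

theorem rot_eq (p κ m : ℕ) (hp : 0 < p) (hm : m < p ^ 3) : rot p (κ * p ^ 3 + m) = p * m + κ := by
  unfold rot
  rw [Nat.add_comm (κ * p ^ 3) m, Nat.add_mul_mod_self_right, Nat.mod_eq_of_lt hm, Nat.add_mul_div_right _ _ (by positivity), Nat.div_eq_of_lt hm, zero_add]

theorem rot_inj (p k l : ℕ) (hp : 0 < p) (hk : k < p ^ 4) (hl : l < p ^ 4) (h : rot p k = rot p l) : k = l := by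
  have h2 : k / p ^ 3 < p := by rw [Nat.div_lt_iff_lt_mul (by positivity)]; rw [show p * p ^ 3 = p ^ 4 by ring]; exact hk
  have h3 : l / p ^ 3 < p := by rw [Nat.div_lt_iff_lt_mul (by positivity)]; rw [show p * p ^ 3 = p ^ 4 by ring]; exact hl
  unfold rot at h
  have e1 := congrArg (· % p) h
  have e2 := congrArg (· / p) h
  simp only [Nat.mul_add_mod, Nat.mod_eq_of_lt h2, Nat.mod_eq_of_lt h3] at e1
  simp only [Nat.mul_add_div hp, Nat.div_eq_of_lt h2, Nat.div_eq_of_lt h3, add_zero] at e2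
  rw [← Nat.div_add_mod k (p ^ 3), ← Nat.div_add_mod l (p ^ 3), e1, e2]

theorem pow_rot {p : ℕ} (hcard : Fintype.card K = p ^ 4) (k : ℕ) (x : K) : (x ^ k) ^ p = x ^ rot p k := by
  unfold rot
  conv_lhs => rw [← Nat.div_add_mod k (p ^ 3)]
  rw [← pow_mul, show (p ^ 3 * (k / p ^ 3) + k % p ^ 3) * p = p ^ 4 * (k / p ^ 3) + p * (k % p ^ 3) by ring, pow_add, pow_mul x (p ^ 4), ← hcard, FiniteField.pow_card, pow_add, mul_comm]

theorem coeff_rot {p : ℕ} [hp : Fact p.Prime] [CharP K p] (hcard : Fintype.card K = p ^ 4) (g : K[X])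
    (hd : g.natDegree < p ^ 4) (h : ∀ x, g.eval x ^ p = g.eval x) (k : ℕ) (hk : k < p ^ 4) :
    g.coeff (rot p k) = g.coeff k ^ p := by
  have hp0 : 0 < p := hp.out.pos
  set H : K[X] := ∑ k ∈ Finset.range (p ^ 4), C (g.coeff k ^ p) * X ^ rot p k with hH
  have hHd : H.natDegree < p ^ 4 := by
    refine lt_of_le_of_lt (natDegree_sum_le_of_forall_le (n := p ^ 4 - 1) _ _ (fun k hk => ?_)) (Nat.sub_lt (by positivity) one_pos)
    refine (natDegree_C_mul_X_pow_le _ _).trans ?_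
    have := rot_lt p k hp0 (Finset.mem_range.1 hk); omega
  have hHg : H - g = 0 := by
    apply zero_of_vanish
    · rw [hcard]; exact lt_of_le_of_lt (natDegree_sub_le _ _) (max_lt hHd hd)
    · intro x
      rw [eval_sub, ← h x, sub_eq_zero, hH, eval_finsetSum, eval_eq_sum_range' hd, sum_pow_char]
      refine Finset.sum_congr rfl (fun k _ => ?_)
      rw [mul_pow, pow_rot hcard]; simp
  have e : g.coeff (rot p k) = H.coeff (rot p k) := by rw [sub_eq_zero.1 hHg]
  rw [e, hH, finsetSum_coeff, Finset.sum_eq_single k]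
  · rw [coeff_C_mul, coeff_X_pow_self, mul_one]
  · intro b hb hbk
    rw [coeff_C_mul, coeff_X_pow, if_neg, mul_zero]
    intro e
    exact hbk (rot_inj p _ _ hp0 (Finset.mem_range.1 hb) hk e.symm)
  · intro hh; exact absurd (Finset.mem_range.2 hk) hh

theorem digit_lemma {p : ℕ} [hp : Fact p.Prime] [CharP K p] (hcard : Fintype.card K = p ^ 4) (g : K[X])
    (hd : g.natDegree ≤ p ^ 3 + p ^ 2 + p + 1) (h : ∀ x, g.eval x ^ p = g.eval x) : Shape2 p g := by
  have hp2 : 2 ≤ p := hp.out.two_le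
  have hD : p ^ 3 + p ^ 2 + p + 1 < p ^ 4 := by nlinarith [pow_pos (show 0 < p by omega) 2, pow_pos (show 0 < p by omega) 3]
  have hR := coeff_rot hcard g (by omega) h
  have rot' : ∀ a b c d : ℕ, a < p → b < p → c < p → d < p → g.coeff (b * p ^ 3 + c * p ^ 2 + d * p + a) = g.coeff (a * p ^ 3 + b * p ^ 2 + c * p + d) ^ p := by
    intro a b c d ha hb hc hd
    have : b * p ^ 2 + c * p + d < p ^ 3 := by
      have h1 : (b + 1) * p ^ 2 ≤ p * p ^ 2 := Nat.mul_le_mul_right _ hb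
      have h2 : (c + 1) * p ≤ p * p := Nat.mul_le_mul_right _ hc
      nlinarith
    have hlt : a * p ^ 3 + (b * p ^ 2 + c * p + d) < p ^ 4 := by
      have h1 : (a + 1) * p ^ 3 ≤ p * p ^ 3 := Nat.mul_le_mul_right _ ha
      nlinarith
    have e := hR _ hlt
    rw [rot_eq p a _ (by omega) this] at e
    rw [show a * p ^ 3 + b * p ^ 2 + c * p + d = a * p ^ 3 + (b * p ^ 2 + c * p + d) by ring, ← e]
    congr 1; ring
  have top : ∀ a b c d : ℕ, a < p → b < p → c < p → d < p → g.coeff (a * p ^ 3 + b * p ^ 2 + c * p + d) ≠ 0 → a < 2 := by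
    intro a b c d ha hb hc hd' h0
    have h1 := (le_natDegree_of_ne_zero h0).trans hd
    by_contra h2
    have h3 : 2 * p ^ 3 ≤ a * p ^ 3 := Nat.mul_le_mul_right _ (by omega)
    have h4 : p ^ 3 ≤ p ^ 2 + p + 1 := by omega
    have h5 : p * p ^ 2 = p ^ 3 := by ring
    have h6 : 2 * p ^ 2 ≤ p * p ^ 2 := Nat.mul_le_mul_right _ hp2
    have h7 : 2 * p ≤ p * p := Nat.mul_le_mul_right _ hp2
    have h8 : p ^ 2 = p * p := by ring
    omega
  have supp : ∀ k, g.coeff k ≠ 0 → ∃ a ∈ Finset.range 2, ∃ b ∈ Finset.range 2, ∃ c ∈ Finset.range 2, ∃ d ∈ Finset.range 2, k = a * p ^ 3 + b * p ^ 2 + c * p + d := by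
    intro k hk
    have hk4 : k < p ^ 4 := by have := (le_natDegree_of_ne_zero hk).trans hd; omega
    have hdig : k = (k / p / p / p) * p ^ 3 + (k / p / p % p) * p ^ 2 + (k / p % p) * p + k % p := by
      have e1 := Nat.div_add_mod k p
      have e2 := Nat.div_add_mod (k / p) p
      have e3 := Nat.div_add_mod (k / p / p) p
      conv_lhs => rw [← e1, ← e2, ← e3]
      ring
    have ha : k / p / p / p < p := by
      rw [Nat.div_div_eq_div_mul, Nat.div_div_eq_div_mul, Nat.div_lt_iff_lt_mul (by positivity)]
      convert hk4 using 1; ring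
    have hb : k / p / p % p < p := Nat.mod_lt _ (by omega)
    have hc : k / p % p < p := Nat.mod_lt _ (by omega)
    have hd1 : k % p < p := Nat.mod_lt _ (by omega)
    rw [hdig] at hk
    have k1 : g.coeff ((k / p / p % p) * p ^ 3 + (k / p % p) * p ^ 2 + (k % p) * p + k / p / p / p) ≠ 0 := by
      rw [rot' _ _ _ _ ha hb hc hd1]; exact pow_ne_zero _ hk
    have k2 : g.coeff ((k / p % p) * p ^ 3 + (k % p) * p ^ 2 + (k / p / p / p) * p + k / p / p % p) ≠ 0 := by
      rw [rot' _ _ _ _ hb hc hd1 ha]; exact pow_ne_zero _ k1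
    have k3 : g.coeff ((k % p) * p ^ 3 + (k / p / p / p) * p ^ 2 + (k / p / p % p) * p + k / p % p) ≠ 0 := by
      rw [rot' _ _ _ _ hc hd1 ha hb]; exact pow_ne_zero _ k2
    refine ⟨_, Finset.mem_range.2 (top _ _ _ _ ha hb hc hd1 hk), _, Finset.mem_range.2 (top _ _ _ _ hb hc hd1 ha k1), _, Finset.mem_range.2 (top _ _ _ _ hc hd1 ha hb k2), _, Finset.mem_range.2 (top _ _ _ _ hd1 ha hb hc k3), hdig⟩
  set S : Finset (ℕ × ℕ × ℕ × ℕ) := Finset.range 2 ×ˢ Finset.range 2 ×ˢ Finset.range 2 ×ˢ Finset.range 2 with hS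
  set φ : ℕ × ℕ × ℕ × ℕ → ℕ := fun t => t.1 * p ^ 3 + t.2.1 * p ^ 2 + t.2.2.1 * p + t.2.2.2 with hφ
  have hinj : ∀ s ∈ S, ∀ t ∈ S, φ s = φ t → s = t := by
    rintro ⟨a, b, c, d⟩ hs ⟨a', b', c', d'⟩ ht e
    simp only [hS, Finset.mem_product, Finset.mem_range] at hs ht
    simp only [hφ] at e
    obtain ⟨h1, h2, h3, h4⟩ := hs
    obtain ⟨h1', h2', h3', h4'⟩ := ht
    have h5 : p ^ 3 = p * p * p := by ring
    have h7 : 2 * (p * p) ≤ p * p * p := by rw [mul_assoc]; exact Nat.mul_le_mul_right _ hp2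
    have h8 : 2 * p ≤ p * p := Nat.mul_le_mul_right _ hp2
    have h9 : p ^ 2 = p * p := by ring
    interval_cases a <;> interval_cases b <;> interval_cases c <;> interval_cases d <;> interval_cases a' <;> interval_cases b' <;> interval_cases c' <;> interval_cases d' <;> first | rfl | (exfalso; simp only [zero_mul, one_mul] at e; omega)
  have hg : g = ∑ t ∈ S, C (g.coeff (φ t)) * X ^ φ t := by
    conv_lhs => rw [as_sum_support_C_mul_X_pow g]
    rw [← Finset.sum_image (f := fun k => C (g.coeff k) * X ^ k) (g := φ) hinj]
    apply Finset.sum_subset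
    · intro k hk
      obtain ⟨a, ha, b, hb, c, hc, d, hd, e⟩ := supp k (mem_support_iff.1 hk)
      rw [Finset.mem_image]
      exact ⟨(a, b, c, d), by simp only [hS, Finset.mem_product]; exact ⟨ha, hb, hc, hd⟩, e.symm⟩
    · intro k _ hk
      rw [notMem_support_iff.1 hk]; simp
  have z : 0 < p := by omega
  have o : 1 < p := by omega
  refine ⟨g.coeff (φ (1,1,1,1)), g.coeff (φ (1,1,1,0)), g.coeff (φ (1,1,0,0)), g.coeff (φ (1,0,1,0)), g.coeff (φ (1,0,0,0)), g.coeff (φ (0,0,0,0)), (rot' _ _ _ _ o o o o).symm, (rot' _ _ _ _ z z z z).symm, ?_, ?_⟩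
  · rw [pow_two, pow_mul]
    simp only [hφ]
    rw [← rot' _ _ _ _ o z o z, ← rot' _ _ _ _ z o z o]
  · conv_lhs => rw [hg]
    rw [hS]
    simp only [Finset.sum_product, Finset.sum_range_succ, Finset.sum_range_zero, zero_add]
    have p2 : ∀ x : K, x ^ p ^ 2 = (x ^ p) ^ p := fun x => by rw [pow_two, pow_mul]
    have p3 : ∀ x : K, x ^ p ^ 3 = ((x ^ p) ^ p) ^ p := fun x => by rw [← pow_mul, ← pow_mul]; congr 1; ring
    simp only [p2, p3, hφ]
    rw [← rot' _ _ _ _ o o o z, ← rot' _ _ _ _ o o z o, ← rot' _ _ _ _ o z o o]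
    rw [← rot' _ _ _ _ o o z z, ← rot' _ _ _ _ o z z o, ← rot' _ _ _ _ z z o o]
    rw [← rot' _ _ _ _ o z o z]
    rw [← rot' _ _ _ _ o z z z, ← rot' _ _ _ _ z z z o, ← rot' _ _ _ _ z z o z]
    simp only [zero_mul, one_mul, zero_add, add_zero, pow_zero, mul_one, pow_one]
    ring
end digit

section partC
set_option linter.unusedSectionVars false
set_option linter.unusedSimpArgs false
set_option linter.unusedVariables false
variable {K : Type} [Field K] [Fintype K] [DecidableEq K]

theorem good_pow {p : ℕ} [hp : Fact p.Prime] [CharP K p] (hcard : Fintype.card K = p ^ 4) (g : K[X]) (κ : K)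
    (h0 : 0 < g.natDegree)
    (hd : (p - 1) * g.natDegree ≤ p ^ 4 - 1) (h : ∀ x, g.eval x ^ p = κ * g.eval x) (t : ℕ) (ht : t ∣ p - 1)
    (ht2 : t ≠ p - 1) : Good p (g ^ t) := by
  have hp2 := hp.out.two_le
  have hq : 1 ≤ p ^ 4 := Nat.one_le_pow _ _ (by omega)
  have hd1 : g.natDegree < p ^ 4 := by
    have : 1 * g.natDegree ≤ (p - 1) * g.natDegree := Nat.mul_le_mul_right _ (by omega)
    omega
  obtain ⟨x0, hx0⟩ : ∃ x, g.eval x ≠ 0 := by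
    by_contra hh
    push Not at hh
    have := zero_of_vanish g (by rw [hcard]; exact hd1) hh
    rw [this] at h0; simp at h0
  set s := g.eval x0 with hs
  have hκ : κ = s ^ (p - 1) := by
    have e := h x0
    rw [← hs, ← Nat.sub_add_cancel (show 1 ≤ p by omega), pow_succ] at e
    exact (mul_right_cancel₀ hx0 e).symm
  have hsh : Shape2 p (C s⁻¹ * g) := by
    apply digit_lemma hcard
    · refine (natDegree_C_mul_le _ _).trans ?_
      obtain ⟨m, rfl⟩ : ∃ m, p = m + 2 := ⟨p - 2, by omega⟩
      have e : (m + 2) ^ 4 - 1 = (m + 2 - 1) * ((m + 2) ^ 3 + (m + 2) ^ 2 + (m + 2) + 1) := by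
        rw [show m + 2 - 1 = m + 1 by omega]
        apply Nat.sub_eq_of_eq_add; ring
      rw [e] at hd
      exact Nat.le_of_mul_le_mul_left hd (by omega)
    · intro x
      rw [eval_mul, eval_C, mul_pow, h x, hκ]
      have : s⁻¹ ^ p * s ^ (p - 1) = s⁻¹ := by
        obtain ⟨m, rfl⟩ : ∃ m, p = m + 2 := ⟨p - 2, by omega⟩
        rw [show m + 2 - 1 = m + 1 by omega]
        rw [inv_pow, pow_succ s (m + 1), mul_inv, mul_right_comm, inv_mul_cancel₀ (pow_ne_zero _ hx0), one_mul]
      rw [← mul_assoc, this]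
  have : g ^ t = C (s ^ t) * (C s⁻¹ * g) ^ t := by
    rw [mul_pow, ← C_pow, ← mul_assoc, ← C_mul, ← mul_pow, mul_inv_cancel₀ hx0, one_pow, C_1, one_mul]
  rw [this]
  apply Good.of_const_mul _ (pow_ne_zero _ hx0)
  apply Good.of_typ
  refine Or.inr (Or.inl ⟨t, _, ht, ht2, ?_, hsh, rfl⟩)
  rw [natDegree_C_mul (inv_ne_zero hx0)]; exact h0

theorem rot_pow (p c i : ℕ) (hp : 3 ≤ p) (hc : c ≤ 2) (hi : i < 3) : rot p (c * p ^ i) = c * p ^ (i + 1) := by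
  have h : c * p ^ i < p ^ 3 := by
    calc c * p ^ i ≤ 2 * p ^ 2 := by gcongr <;> omega
      _ < p * p ^ 2 := Nat.mul_lt_mul_of_pos_right (by omega) (by positivity)
      _ = p ^ 3 := by ring
  have := rot_eq p 0 (c * p ^ i) (by omega) h
  rw [zero_mul, zero_add, add_zero] at this
  rw [this]; ring

theorem hasse_rot {p : ℕ} [hp : Fact p.Prime] [CharP K p] (hcard : Fintype.card K = p ^ 4) (F : K[X])
    (hd : F.natDegree < p ^ 4) (h : ∀ x, F.eval x ^ p = F.eval x) (c i : ℕ) (hp : 3 ≤ p) (hc : c ≤ 2) (hi : i < 3) (x : K) :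
    (hasseDeriv (c * p ^ (i + 1)) F).eval x = (hasseDeriv (c * p ^ i) F).eval x ^ p := by
  rw [← taylor_coeff, ← taylor_coeff, ← rot_pow p c i hp hc hi]
  apply coeff_rot hcard
  · rw [natDegree_taylor]; exact hd
  · intro y; rw [taylor_eval]; exact h _
  · calc c * p ^ i ≤ 2 * p ^ 2 := by gcongr <;> omega
      _ < p ^ 2 * p ^ 2 := Nat.mul_lt_mul_of_pos_right (by nlinarith) (by positivity)
      _ = p ^ 4 := by ring

theorem J_all {p : ℕ} [hp : Fact p.Prime] [CharP K p] (hcard : Fintype.card K = p ^ 4) (F : K[X])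
    (hd : 2 * F.natDegree < p ^ 4) (h : ∀ x, F.eval x ^ p = F.eval x) (hp3 : 3 ≤ p) (a : ℕ)
    (h0 : C (a : K) * F * (2 * hasseDeriv (2 * p ^ 0) F) = C ((a : K) - 1) * (hasseDeriv (1 * p ^ 0) F) ^ 2) (i : ℕ) (hi : i < 4) :
    C (a : K) * F * (2 * hasseDeriv (2 * p ^ i) F) = C ((a : K) - 1) * (hasseDeriv (1 * p ^ i) F) ^ 2 := by
  induction i with
  | zero => exact h0
  | succ i ih =>
    have ih := ih (by omega)
    rw [← sub_eq_zero]
    have hh : ∀ k, (hasseDeriv k F).natDegree ≤ F.natDegree := fun k => (natDegree_hasseDeriv_le F k).trans (by omega)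
    apply zero_of_vanish
    · rw [hcard]
      refine lt_of_le_of_lt (natDegree_sub_le _ _) (max_lt ?_ ?_)
      · rw [show C (a : K) * F * (2 * hasseDeriv (2 * p ^ (i + 1)) F) = C ((a : K) * 2) * (F * hasseDeriv (2 * p ^ (i + 1)) F) by rw [C_mul]; simp only [C_ofNat]; ring]
        refine lt_of_le_of_lt ((natDegree_C_mul_le _ _).trans natDegree_mul_le) ?_
        have := hh (2 * p ^ (i + 1)); omega
      · refine lt_of_le_of_lt ((natDegree_C_mul_le _ _).trans natDegree_pow_le) ?_
        have := hh (1 * p ^ (i + 1)); omega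
    · intro x
      have e := congrArg (fun f => (f.eval x) ^ p) ih
      have hap : ((a : K) - 1) ^ p = a - 1 := by
        rw [sub_pow_char, one_pow, ← frobenius_def, map_natCast]
      have hap2 : (a : K) ^ p = a := by rw [← frobenius_def, map_natCast]
      have h2 : (2 : K) ^ p = 2 := by rw [← frobenius_def]; exact map_ofNat _ 2
      simp only [eval_mul, eval_C, eval_pow, eval_ofNat, mul_pow, h x, hap, hap2, h2] at e
      rw [pow_right_comm] at e
      simp only [eval_sub, eval_mul, eval_C, eval_pow, eval_ofNat]
      have d := hh
      rw [hasse_rot hcard F (by omega) h 2 i hp3 le_rfl (by omega), hasse_rot hcard F (by omega) h 1 i hp3 (by omega) (by omega), e, sub_self]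

/-- local analysis at a root -/
theorem digit_of_J {p : ℕ} [hp : Fact p.Prime] {E : Type*} [Field E] [CharP E p] (T : E[X]) (μ a i : ℕ)
    (hμ : T.coeff μ ≠ 0) (hlow : ∀ j < μ, T.coeff j = 0)
    (hJ : C (a : E) * T * (2 * hasseDeriv (2 * p ^ i) T) = C ((a : E) - 1) * (hasseDeriv (1 * p ^ i) T) ^ 2) :
    ((μ / p ^ i : ℕ) : E) = 0 ∨ ((μ / p ^ i : ℕ) : E) = a := by
  have key : ∀ k : ℕ, ∀ j, (X ^ k * hasseDeriv k T).coeff j = (j.choose k : E) * T.coeff j := by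
    intro k j
    rw [coeff_X_pow_mul']
    split_ifs with hk
    · rw [hasseDeriv_coeff, Nat.sub_add_cancel hk]
    · rw [Nat.choose_eq_zero_of_lt (by omega)]; simp
  have prod : ∀ f g : E[X], (∀ j < μ, f.coeff j = 0) → (∀ j < μ, g.coeff j = 0) → (f * g).coeff (μ + μ) = f.coeff μ * g.coeff μ := by
    intro f g hf hg
    rw [coeff_mul, Finset.sum_eq_single (μ, μ)]
    · rintro ⟨b, c⟩ hb hne
      rw [Finset.HasAntidiagonal.mem_antidiagonal] at hb
      simp only at hb
      rcases lt_trichotomy b μ with hlt | heq | hgt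
      · rw [hf _ hlt, zero_mul]
      · exact absurd (by ext <;> simp <;> omega) hne
      · rw [hg c (by omega), mul_zero]
    · intro hh; exact (hh (by simp)).elim
  have lc : ∀ (c i : ℕ), (((μ).choose (c * p ^ i) : ℕ) : E) = ((μ / p ^ i).choose c : ℕ) := by
    have lc : ∀ (c i M : ℕ), (((M).choose (c * p ^ i) : ℕ) : E) = ((M / p ^ i).choose c : ℕ) := by
      intro c i
      induction i with
      | zero => simp
      | succ i ih =>
        intro M
        have := Choose.choose_modEq_choose_mod_mul_choose_div_nat (n := M) (k := c * p ^ (i + 1)) (p := p)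
        have e := (CharP.natCast_eq_natCast E p).2 this
        rw [e, show c * p ^ (i + 1) = c * p ^ i * p by ring, Nat.mul_mod_left, Nat.mul_div_cancel _ hp.out.pos]
        rw [Nat.choose_zero_right, one_mul, ih, Nat.div_div_eq_div_mul, pow_succ']
    exact fun c i => lc c i μ
  have e : C (a : E) * (2 * (T * (X ^ (2 * p ^ i) * hasseDeriv (2 * p ^ i) T))) = C ((a : E) - 1) * ((X ^ (1 * p ^ i) * hasseDeriv (1 * p ^ i) T) * (X ^ (1 * p ^ i) * hasseDeriv (1 * p ^ i) T)) := by
    have : (X : E[X]) ^ (2 * p ^ i) = X ^ (1 * p ^ i) * X ^ (1 * p ^ i) := by rw [← pow_add]; congr 1; ring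
    rw [this]
    linear_combination X ^ (1 * p ^ i) * X ^ (1 * p ^ i) * hJ
  have e2 := congrArg (fun f => f.coeff (μ + μ)) e
  have h2 : (2 : E[X]) = C 2 := by simp only [C_ofNat]
  simp only [h2, coeff_C_mul] at e2
  rw [prod _ _ hlow (fun j hj => by rw [key, hlow j hj, mul_zero]), prod _ _ (fun j hj => by rw [key, hlow j hj, mul_zero]) (fun j hj => by rw [key, hlow j hj, mul_zero]), key, key, lc, lc, Nat.choose_one_right] at e2
  have hch : (2 : E) * ((μ / p ^ i).choose 2 : ℕ) = ((μ / p ^ i : ℕ) : E) * ((μ / p ^ i : ℕ) - 1) := by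
    generalize μ / p ^ i = M
    have h3 : 2 * M.choose 2 + M = M * M := by
      have := Nat.triangle_succ M
      rw [Nat.choose_two_right]
      have h4 : M * (M - 1) / 2 * 2 = M * (M - 1) := Nat.div_mul_cancel (by
        rcases Nat.even_or_odd M with h | h
        · exact Dvd.dvd.mul_right h.two_dvd _
        · obtain ⟨k, rfl⟩ := h; exact Dvd.dvd.mul_left ⟨k, by omega⟩ _)
      rcases M with _ | M
      · simp
      · simp only [Nat.add_sub_cancel] at h4 ⊢; nlinarith
    have := congrArg (Nat.cast (R := E)) h3
    push_cast at this
    linear_combination this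
  set m : E := ((μ / p ^ i : ℕ) : E) with hm
  have e3 : (T.coeff μ) ^ 2 * (m * (m - a)) = 0 := by
    linear_combination e2 - (a : E) * T.coeff μ ^ 2 * hch
  rcases mul_eq_zero.1 e3 with h | h
  · exact absurd h (pow_ne_zero _ hμ)
  · rcases mul_eq_zero.1 h with h | h
    · exact Or.inl h
    · exact Or.inr (sub_eq_zero.1 h)

theorem hasse_taylor {E : Type*} [Field E] (k : ℕ) (r : E) (f : E[X]) : hasseDeriv k (taylor r f) = taylor r (hasseDeriv k f) := by
  ext n
  rw [hasseDeriv_coeff, taylor_coeff, taylor_coeff, ← LinearMap.comp_apply, hasseDeriv_comp]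
  simp [Nat.choose_symm_add]

end partC

section partC2
set_option linter.unusedSectionVars false
set_option linter.unusedSimpArgs false
set_option linter.unusedVariables false
variable {K : Type} [Field K] [Fintype K] [DecidableEq K]

theorem hasse_map {E : Type*} [Field E] (ι : K →+* E) (k : ℕ) (f : K[X]) : (hasseDeriv k f).map ι = hasseDeriv k (f.map ι) := by
  ext n
  simp [hasseDeriv_coeff]

theorem mult_dvd {p : ℕ} [hp : Fact p.Prime] [CharP K p] (F : K[X]) (a : ℕ) (ha : a < p) (hF : F ≠ 0) (hd : F.natDegree < p ^ 4)
    (hJ : ∀ i < 4, C (a : K) * F * (2 * hasseDeriv (2 * p ^ i) F) = C ((a : K) - 1) * (hasseDeriv (1 * p ^ i) F) ^ 2)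
    (π : K[X]) (hπ : Irreducible π) (m : ℕ) (H : K[X]) (hFH : F = π ^ m * H) (hH : ¬ π ∣ H) : a ∣ m := by
  have hmd : m < p ^ 4 := by
    have hH0 : H ≠ 0 := by rintro rfl; exact hH (dvd_zero _)
    have := natDegree_mul (pow_ne_zero m hπ.ne_zero) hH0
    rw [← hFH, natDegree_pow] at this
    have h2 : m * 1 ≤ m * π.natDegree := Nat.mul_le_mul_left _ hπ.natDegree_pos
    omega
  have : Fact (Irreducible π) := ⟨hπ⟩
  set ι := algebraMap K (AdjoinRoot π) with hι
  have : CharP (AdjoinRoot π) p := charP_of_injective_algebraMap ι.injective p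
  set β := AdjoinRoot.root π with hβ
  have ev : ∀ f : K[X], (f.map ι).eval β = AdjoinRoot.mk π f := by
    intro f; rw [eval_map, hι, AdjoinRoot.algebraMap_eq, ← AdjoinRoot.aeval_eq]; rfl
  set P1 := taylor β (π.map ι) with hP1
  have c0 : P1.coeff 0 = 0 := by
    rw [hP1, taylor_coeff_zero, ev, AdjoinRoot.mk_self]
  have c1 : P1.coeff 1 ≠ 0 := by
    rw [hP1, taylor_coeff_one, derivative_map, ev]
    intro h0
    have hs : π.Separable := PerfectField.separable_of_irreducible hπ
    exact hπ.not_isUnit (hs.isUnit_of_dvd' dvd_rfl (AdjoinRoot.mk_eq_zero.1 h0))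
  have hP : P1 = X * P1.divX := by
    have := divX_mul_X_add P1
    rw [c0, C_0, add_zero] at this; rw [mul_comm]; exact this.symm
  set T := taylor β (F.map ι) with hT
  have hTX : T = X ^ m * (P1.divX ^ m * taylor β (H.map ι)) := by
    rw [hT, hFH, Polynomial.map_mul, Polynomial.map_pow, taylor_mul, taylor_pow, ← hP1, ← mul_assoc, ← mul_pow, ← hP]
  have hR0 : (P1.divX ^ m * taylor β (H.map ι)).coeff 0 ≠ 0 := by
    rw [coeff_zero_eq_eval_zero, eval_mul, eval_pow, ← coeff_zero_eq_eval_zero, ← coeff_zero_eq_eval_zero, coeff_divX, taylor_coeff_zero, ev]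
    refine mul_ne_zero (pow_ne_zero _ c1) ?_
    intro h; exact hH (AdjoinRoot.mk_eq_zero.1 h)
  have hdig : ∀ i < 4, m / p ^ i % p = 0 ∨ m / p ^ i % p = a := by
    intro i hi
    have := digit_of_J (p := p) T m a i (by rw [hTX, coeff_X_pow_mul', if_pos le_rfl, Nat.sub_self]; exact hR0)
      (fun j hj => by rw [hTX, coeff_X_pow_mul', if_neg (by omega)]) (by
      have e := congrArg (fun f => taylor β (f.map ι)) (hJ i hi)
      simp only [Polynomial.map_mul, Polynomial.map_pow, taylor_mul, taylor_pow, map_C, taylor_C, Polynomial.map_ofNat, hasse_map] at e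
      rw [hT, hasse_taylor, hasse_taylor]
      have t2 : taylor β (2 : (AdjoinRoot π)[X]) = 2 := by
        rw [show (2 : (AdjoinRoot π)[X]) = C 2 by simp only [C_ofNat], taylor_C]
      simpa [t2] using e)
    rcases this with h | h
    · left
      exact Nat.mod_eq_zero_of_dvd ((CharP.cast_eq_zero_iff _ p _).1 h)
    · right
      have := (CharP.natCast_eq_natCast (AdjoinRoot π) p).1 h
      rwa [Nat.ModEq, Nat.mod_eq_of_lt ha] at this
  have h0 := hdig 0 (by omega)
  have h1 := hdig 1 (by omega)
  have h2 := hdig 2 (by omega)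
  have h3 := hdig 3 (by omega)
  have hlt : m / p ^ 3 < p := by
    rw [Nat.div_lt_iff_lt_mul (pow_pos hp.out.pos _), ← pow_succ']; exact hmd
  rw [Nat.mod_eq_of_lt hlt] at h3
  have dv : ∀ x, x = 0 ∨ x = a → a ∣ x := by rintro x (rfl | rfl); exacts [dvd_zero _, dvd_rfl]
  have e : m = m / p ^ 0 % p + p * (m / p ^ 1 % p + p * (m / p ^ 2 % p + p * (m / p ^ 3))) := by
    rw [show p ^ 3 = p ^ 2 * p by ring, ← Nat.div_div_eq_div_mul, Nat.mod_add_div, show p ^ 2 = p ^ 1 * p by ring, ← Nat.div_div_eq_div_mul, Nat.mod_add_div, pow_one, pow_zero, Nat.div_one, Nat.mod_add_div]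
  rw [e]
  exact dvd_add (dv _ h0) (Dvd.dvd.mul_left (dvd_add (dv _ h1) (Dvd.dvd.mul_left (dvd_add (dv _ h2) (Dvd.dvd.mul_left (dv _ h3) _)) _)) _)

theorem pow_of_mult (a : ℕ) : ∀ (n : ℕ) (F : K[X]), F ≠ 0 → F.natDegree ≤ n → 
    (∀ π : K[X], Irreducible π → ∀ m H, F = π ^ m * H → ¬ π ∣ H → a ∣ m) → ∃ (c : K) (g : K[X]), F = C c * g ^ a := by
  intro n
  induction n with
  | zero =>
    intro F _ hd _
    refine ⟨F.coeff 0, 1, ?_⟩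
    rw [one_pow, mul_one]; exact eq_C_of_natDegree_le_zero hd
  | succ n ih =>
    intro F hF hd h
    by_cases h0 : F.natDegree = 0
    · refine ⟨F.coeff 0, 1, ?_⟩
      rw [one_pow, mul_one]; exact eq_C_of_natDegree_eq_zero h0
    obtain ⟨π, hπ, hdvd⟩ := exists_irreducible_of_natDegree_ne_zero h0
    obtain ⟨m, H, hH, hFH⟩ := WfDvdMonoid.max_power_factor hF hπ
    have hH0 : H ≠ 0 := by rintro rfl; exact hH (dvd_zero _)
    have hm : m ≠ 0 := by rintro rfl; rw [pow_zero, one_mul] at hFH; rw [hFH] at hdvd; exact hH hdvd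
    obtain ⟨k, rfl⟩ := h π hπ m H hFH hH
    have hdeg := natDegree_mul (pow_ne_zero (a * k) hπ.ne_zero) hH0
    rw [← hFH, natDegree_pow] at hdeg
    have : 1 ≤ a * k * π.natDegree := Nat.mul_pos (Nat.pos_of_ne_zero hm) hπ.natDegree_pos
    obtain ⟨c, g, hg⟩ := ih H hH0 (by omega) (by
      intro ϖ hϖ m' H' e nd
      by_cases has : Associated π ϖ
      · have : m' = 0 := by
          by_contra hne
          exact hH (has.dvd.trans (e ▸ (dvd_pow_self ϖ hne).mul_right _))
        rw [this]; exact dvd_zero _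
      · refine h ϖ hϖ m' (π ^ (a * k) * H') (by rw [hFH, e]; ring) ?_
        intro hd
        rcases hϖ.prime.dvd_or_dvd hd with h1 | h1
        · exact has ((hϖ.associated_of_dvd hπ (hϖ.prime.dvd_of_dvd_pow h1)).symm)
        · exact nd h1)
    refine ⟨c, π ^ k * g, ?_⟩
    rw [hFH, hg, mul_pow, ← pow_mul, mul_comm k a]; ring
theorem hasseDeriv_C_mul' (k : ℕ) (c : K) (f : K[X]) : hasseDeriv k (C c * f) = C c * hasseDeriv k f := by
  rw [← smul_eq_C_mul, ← smul_eq_C_mul, map_smul]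

theorem partC {p : ℕ} [hp : Fact p.Prime] [CharP K p] (hcard : Fintype.card K = p ^ 4) (F L N S : K[X]) (a r : ℕ)
    (ha : 2 ≤ a) (hr : 2 ≤ r) (har : a * r = p - 1) (hF : F = L ^ a * N ^ p) (hN : N ≠ 0) (hL : L.Monic) (hd : 0 < L.natDegree)
    (hL2 : derivative (derivative L) = 0) (s : K) (hS : S = C s * X ^ r)
    (hE : L + L * S.comp F + (X ^ Fintype.card K - X) * derivative L = 0)
    (hLx : ∀ x, L.eval x = 0 → F.eval x = 0)
    (hrn : r * F.natDegree ≤ p ^ 4 - 1) : Good p F := by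
  have hp2 := hp.out.two_le
  have hq : 1 ≤ p ^ 4 := Nat.one_le_pow _ _ (by omega)
  have hapos : 2 * 2 ≤ a * r := Nat.mul_le_mul ha hr
  have halt : a < p := by
    have : a * 1 ≤ a * r := Nat.mul_le_mul_left _ (by omega)
    omega
  have hF0 : F ≠ 0 := by rw [hF]; exact mul_ne_zero (pow_ne_zero _ hL.ne_zero) (pow_ne_zero _ hN)
  have hFd : F.natDegree = a * L.natDegree + p * N.natDegree := by
    rw [hF, natDegree_mul (pow_ne_zero _ hL.ne_zero) (pow_ne_zero _ hN), natDegree_pow, natDegree_pow]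
  have hFpos : 0 < F.natDegree := by
    have := Nat.mul_pos (show 0 < a by omega) hd; omega
  have h2n : 2 * F.natDegree < p ^ 4 := by
    have := Nat.mul_le_mul_right F.natDegree hr; omega
  have hval : ∀ x, F.eval x ≠ 0 → s * F.eval x ^ r = -1 := by
    intro x hx
    have hLne : L.eval x ≠ 0 := fun h => hx (hLx x h)
    have e := congrArg (eval x) hE
    rw [hS] at e
    simp only [eval_add, eval_mul, eval_sub, eval_pow, eval_X, eval_comp, eval_C, FiniteField.pow_card, sub_self, zero_mul, add_zero, eval_zero] at e
    have : L.eval x * (1 + s * F.eval x ^ r) = 0 := by linear_combination e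
    rcases mul_eq_zero.1 this with h | h
    · exact absurd h hLne
    · linear_combination h
  obtain ⟨x0, hx0⟩ : ∃ x, F.eval x ≠ 0 := by
    by_contra hh
    push Not at hh
    exact hF0 (zero_of_vanish F (by rw [hcard]; omega) hh)
  have hs : s ≠ 0 := by
    rintro rfl
    have := hval x0 hx0
    simp at this
  set u := F.eval x0 with hu
  have hr1 : ∀ x, F.eval x ≠ 0 → F.eval x ^ r = u ^ r := fun x hx =>
    mul_left_cancel₀ hs ((hval x hx).trans (hval x0 hx0).symm)
  have hpar : p = r * a + 1 := by rw [mul_comm]; omega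
  have hfp : ∀ x, (C u⁻¹ * F).eval x ^ p = (C u⁻¹ * F).eval x := by
    intro x
    by_cases hx : F.eval x = 0
    · rw [eval_mul, hx, mul_zero, zero_pow (by omega)]
    · rw [hpar, pow_succ, pow_mul, eval_mul, eval_C, mul_pow, hr1 x hx, ← mul_pow, inv_mul_cancel₀ hx0, one_pow, one_pow, one_mul]
  have hd0 : (C u⁻¹ * F).natDegree = F.natDegree := natDegree_C_mul (inv_ne_zero hx0)
  have J0 : C (a : K) * F * (2 * hasseDeriv (2 * p ^ 0) F) = C ((a : K) - 1) * (hasseDeriv (1 * p ^ 0) F) ^ 2 := by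
    have h2 : 2 * hasseDeriv 2 F = derivative (derivative F) := by
      have := congrArg (fun φ => φ F) (factorial_smul_hasseDeriv (R := K) 2)
      simpa [two_smul, two_mul] using this
    rw [pow_zero, mul_one, mul_one, h2, hasseDeriv_one']
    obtain ⟨b, rfl⟩ : ∃ b, a = b + 2 := ⟨a - 2, by omega⟩
    have f1 : derivative F = C ((b : K) + 2) * (L ^ (b + 1) * derivative L * N ^ p) := by
      rw [hF, derivative_mul, deriv_pow_p p, mul_zero, add_zero, derivative_pow, Nat.add_sub_assoc (by omega)]
      simp only [Nat.cast_add, Nat.cast_ofNat, C_add, show 2 - 1 = 1 from rfl]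
      ring
    have f2 : derivative (derivative F) = C ((b : K) + 2) * (C ((b : K) + 1) * (L ^ b * derivative L ^ 2 * N ^ p)) := by
      rw [f1, derivative_C_mul, derivative_mul, deriv_pow_p p, mul_zero, add_zero, derivative_mul, hL2, mul_zero, add_zero, derivative_pow, Nat.add_sub_cancel]
      simp only [Nat.cast_add, Nat.cast_one, C_add]
      ring
    rw [f2, f1, hF]
    simp only [Nat.cast_add, Nat.cast_ofNat, C_add, C_sub, C_1, C_ofNat]
    ring
  have hJ := J_all hcard (C u⁻¹ * F) (by rw [hd0]; exact h2n) hfp (by omega) a (by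
    simp only [hasseDeriv_C_mul']
    linear_combination C u⁻¹ ^ 2 * J0)
  obtain ⟨c, g, hg⟩ := pow_of_mult a _ (C u⁻¹ * F) (mul_ne_zero (C_ne_zero.2 (inv_ne_zero hx0)) hF0) le_rfl
    (mult_dvd _ a halt (mul_ne_zero (C_ne_zero.2 (inv_ne_zero hx0)) hF0) (by rw [hd0]; omega) hJ)
  have hc : c ≠ 0 := by
    rintro rfl
    rw [C_0, zero_mul, mul_eq_zero, C_eq_zero] at hg
    rcases hg with h | h
    · exact inv_ne_zero hx0 h
    · exact hF0 h
  have hFg : F = C (u * c) * g ^ a := by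
    rw [C_mul, mul_assoc, ← hg, ← mul_assoc, ← C_mul, mul_inv_cancel₀ hx0, C_1, one_mul]
  have hgd : F.natDegree = a * g.natDegree := by
    rw [hFg, natDegree_C_mul (mul_ne_zero hx0 hc), natDegree_pow]
  rw [hFg]
  apply Good.of_const_mul _ (mul_ne_zero hx0 hc)
  apply good_pow hcard g ((c ^ r)⁻¹)
  · rcases Nat.eq_zero_or_pos g.natDegree with h | h
    · rw [hgd, h] at hFpos; simp at hFpos
    · exact h
  · rw [← har]; calc a * r * g.natDegree = r * (a * g.natDegree) := by ring
      _ ≤ _ := by rw [← hgd]; exact hrn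
  · intro x
    by_cases hx : g.eval x = 0
    · rw [hx, mul_zero, zero_pow (by omega)]
    · have e : F.eval x = u * c * g.eval x ^ a := by rw [hFg]; simp
      have hne : F.eval x ≠ 0 := by rw [e]; exact mul_ne_zero (mul_ne_zero hx0 hc) (pow_ne_zero _ hx)
      have e2 := hr1 x hne
      rw [e, mul_pow, mul_pow, mul_assoc] at e2
      have e3 : c ^ r * (g.eval x ^ a) ^ r = 1 := by
        apply mul_left_cancel₀ (pow_ne_zero r hx0); rw [e2, mul_one]
      rw [← pow_mul, har] at e3
      rw [← Nat.sub_add_cancel (show 1 ≤ p by omega), pow_succ]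
      congr 1
      exact eq_inv_of_mul_eq_one_right e3
  · exact ⟨r, har.symm⟩
  · intro hh
    have : a * 2 ≤ a * r := Nat.mul_le_mul_left _ hr
    omega
end partC2

section caseEw
set_option linter.unusedSectionVars false
set_option linter.unusedSimpArgs false
set_option linter.unusedVariables false
variable {K : Type} [Field K] [Fintype K] [DecidableEq K]

noncomputable def Tp (s : Finset K) : K[X] := ∏ g ∈ s, (X - C g)

theorem Tp_monic (s : Finset K) : (Tp s).Monic := monic_prod_X_sub_C _ _
theorem Tp_deg (s : Finset K) : (Tp s).natDegree = s.card := by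
  unfold Tp
  rw [natDegree_prod_of_monic _ _ (fun a _ => monic_X_sub_C a)]
  simp
theorem Tp_erase (s : Finset K) (g : K) (hg : g ∈ s) : Tp s = (X - C g) * Tp (s.erase g) :=
  (Finset.mul_prod_erase s (fun g => (X - C g : K[X])) hg).symm
theorem Tp_eval (s : Finset K) (g : K) : (Tp s).eval g = ∏ h ∈ s, (g - h) := by
  unfold Tp; rw [eval_prod]; simp
theorem Tp_deriv (s : Finset K) (g : K) (hg : g ∈ s) : (derivative (Tp s)).eval g = ∏ h ∈ s.erase g, (g - h) := by
  rw [Tp_erase s g hg, derivative_mul]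
  simp [Tp_eval]
theorem Tp_comp (s : Finset K) (F : K[X]) : (Tp s).comp F = ∏ g ∈ s, (F - C g) := by
  unfold Tp; rw [prod_comp]; simp

theorem caseE {p : ℕ} [hp : Fact p.Prime] [CharP K p] (hcard : Fintype.card K = p ^ 4) (F : K[X]) (hn : 0 < F.natDegree)
    (h1 : ((valueSet F).card - 1) * F.natDegree ≤ Fintype.card K - 1)
    (h3 : 3 ≤ (valueSet F).card) (c : K) (hc : c ≠ 0) (hF' : derivative F ≠ 0)
    (hA : ∀ g ∈ valueSet F, C (cf F g) * (Lf F g * derivative (Mf F g)) = C (cf F g - c) * derivative F)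
    (hB : ∀ g ∈ valueSet F, C (cf F g) * (derivative (Lf F g) * Mf F g) = C c * derivative F)
    (hD : ∀ g ∈ valueSet F, Lf F g * ∏ g' ∈ (valueSet F).erase g, (F - C g') =
        - (C (cf F g) * ((X ^ Fintype.card K - X) * derivative (Lf F g))))
    (γ : K) (hγ : γ ∈ valueSet F) (hγc : cf F γ ≠ c) : Good p F := by
  have huniq : ∀ g ∈ (valueSet F).erase γ, cf F g = c := by
    intro g hg
    by_contra hne
    have hgγ := Finset.ne_of_mem_erase hg
    have hgV := Finset.mem_of_mem_erase hg
    have dv : ∀ g ∈ valueSet F, cf F g ≠ c → Lf F g ∣ derivative F := by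
      intro g hg hne
      have h0 : cf F g - c ≠ 0 := sub_ne_zero.2 hne
      refine (IsUnit.dvd_mul_left (isUnit_C.2 h0.isUnit)).1 ?_
      rw [← hA g hg]
      exact ⟨C (cf F g) * derivative (Mf F g), by ring⟩
    have hdv := (Lf_coprime F hgγ).mul_dvd (dv g hgV hne) (dv γ hγ hγc)
    have := natDegree_le_of_dvd hdv hF'
    rw [natDegree_mul (Lf_monic _ _).ne_zero (Lf_monic _ _).ne_zero] at this
    have h2 := d_sum2 F hn h1 hgV hγ hgγ
    have h4 := natDegree_derivative_le F
    omega
  set r := (valueSet F).card - 1 with hr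
  have hr2 : 2 ≤ r := by omega
  set V := valueSet F with hV
  set L := Lf F γ with hL
  set M := Mf F γ with hM
  set c0 := cf F γ with hc0
  have hc00 : c0 ≠ 0 := cf_ne F γ
  set T0 := Tp (V.erase γ) with hT0
  have hT0d : T0.natDegree = r := by rw [hT0, Tp_deg, Finset.card_erase_of_mem hγ]
  have hT0c : T0.eval γ = c0 := by rw [hT0, Tp_eval, hc0, cf]
  have hTV : Tp V = (X - C γ) * T0 := Tp_erase V γ hγ
  have hder : derivative (Tp V) - C c = C ((r : K) + 1) * T0 := by
    have hdv : T0 ∣ derivative (Tp V) - C c := by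
      rw [hT0, Tp]
      apply dvd_of_roots
      intro g hg
      rw [eval_sub, eval_C, Tp_deriv V g (Finset.mem_of_mem_erase hg), sub_eq_zero]
      exact huniq g hg
    rw [← sub_eq_zero]
    refine eq_zero_of_dvd_of_degree_lt (dvd_sub hdv (Dvd.intro_left _ rfl)) ?_
    rw [degree_eq_natDegree (Tp_monic _).ne_zero, hT0d, degree_lt_iff_coeff_zero]
    intro m hm
    have hVd : (Tp V).natDegree = r + 1 := by rw [Tp_deg]; omega
    rcases Nat.eq_or_lt_of_le hm with rfl | hm
    · have c1 : (Tp V).coeff (r + 1) = 1 := by rw [← hVd]; exact Tp_monic V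
      have c2 : T0.coeff r = 1 := by rw [← hT0d]; exact Tp_monic _
      rw [coeff_sub, coeff_sub, coeff_derivative, coeff_C_mul, c1, c2, coeff_C, if_neg (by omega)]
      ring
    · rw [coeff_sub, coeff_sub, coeff_derivative, coeff_C_mul, coeff_eq_zero_of_natDegree_lt (by omega : (Tp V).natDegree < m + 1), coeff_eq_zero_of_natDegree_lt (by omega : T0.natDegree < m), coeff_C, if_neg (by omega)]
      ring
  have hder2 : (X - C γ) * derivative T0 = C (r : K) * T0 + C c := by
    rw [hTV, derivative_mul] at hder
    simp only [derivative_sub, derivative_X, derivative_C, sub_zero, one_mul, C_add, C_1] at hder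
    linear_combination hder
  have hcr : c = - (r * c0) := by
    have := congrArg (eval γ) hder2
    simp [hT0c] at this
    linear_combination -this
  have hr0 : (r : K) ≠ 0 := by rintro h; rw [h] at hcr; simp at hcr; exact hc hcr
  have hr1 : (1 : K) + r ≠ 0 := by
    intro h; apply hγc; rw [hcr]; linear_combination c0 * h
  obtain ⟨a, hap, hadv⟩ := cast_mod_solve (K := K) p 1 r hr0
  have har : (a : K) * r = -1 := by
    have := (CharP.cast_eq_zero_iff K p _).2 hadv
    push_cast at this; linear_combination this
  have ha2 : 2 ≤ a := by
    rcases a with _ | _ | a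
    · simp at har
    · exfalso; apply hr1; push_cast at har; linear_combination har
    · omega
  set F' := derivative F with hF'd
  have e1 : L * derivative M = C ((1 : K) + r) * F' := by
    have := hA γ hγ
    apply mul_left_cancel₀ (C_ne_zero.2 hc00)
    rw [this, hcr]; simp only [C_add, C_sub, C_neg, C_mul, C_1]; ring
  have e2 : derivative L * M = C (- (r : K)) * F' := by
    have := hB γ hγ
    apply mul_left_cancel₀ (C_ne_zero.2 hc00)
    rw [this, hcr]; simp only [C_neg, C_mul]; ring
  obtain ⟨b, rfl⟩ : ∃ b, a = b + 1 := ⟨a - 1, by omega⟩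
  have hbr : C (b : K) * C (r : K) = - C (1 + r : K) := by
    rw [← C_mul, ← C_neg]; congr 1; push_cast at har; linear_combination har
  have e3 : L * derivative M = C (b : K) * (derivative L * M) := by
    rw [e1, e2]; simp only [C_neg]; linear_combination F' * hbr
  obtain ⟨N, hN⟩ := log_deriv p L M (Lf_squarefree F γ) b (by omega) e3
  set G := F - C γ with hG
  have hLM : G = L * M := LM F γ
  have hGN : G = L ^ (b + 1) * N ^ p := by rw [hLM, hN]; ring
  have hN0 : N ≠ 0 := by
    rintro rfl; rw [zero_pow hp.out.ne_zero, mul_zero] at hN; exact Mf_ne F hn γ hN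
  set S : K[X] := C c0⁻¹ * T0.comp (X + C γ) - 1 with hS
  have hinv : (C c0 : K[X]) * C c0⁻¹ = 1 := by rw [← C_mul, mul_inv_cancel₀ hc00, C_1]
  have hSd : S.natDegree = r := by
    rw [hS, show (1 : K[X]) = C 1 from rfl, natDegree_sub_C, natDegree_C_mul (inv_ne_zero hc00), natDegree_comp, natDegree_X_add_C, hT0d, mul_one]
  have hS' : X * derivative S = C (r : K) * S := by
    have := congrArg (fun f => f.comp (X + C γ)) hder2
    simp only [mul_comp, sub_comp, X_comp, C_comp, add_comp, add_sub_cancel_right] at this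
    rw [hS, derivative_sub, derivative_C_mul, derivative_comp]
    simp only [derivative_one, derivative_add, derivative_X, derivative_C, add_zero, sub_zero, one_mul, mul_one]
    have hcC : (C c : K[X]) = - (C (r : K) * C c0) := by rw [hcr]; simp
    rw [hcC] at this
    linear_combination C c0⁻¹ * this - C (r : K) * hinv
  have hScomp : S.comp G = C c0⁻¹ * ∏ g' ∈ V.erase γ, (F - C g') - 1 := by
    rw [hS, sub_comp, mul_comp, C_comp, comp_assoc, one_comp, ← Tp_comp]
    simp [hG, hT0]
  have hE : L + L * S.comp G + (X ^ Fintype.card K - X) * derivative L = 0 := by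
    rw [hScomp]
    have := hD γ hγ
    linear_combination C c0⁻¹ * this + (-(X ^ Fintype.card K - X) * derivative L) * hinv
  have hGd : G.natDegree = F.natDegree := F_sub_natDegree F γ
  have hQ0 : (X ^ Fintype.card K - X : K[X]) ≠ 0 := Q_squarefree.ne_zero
  have hQ' : derivative (X ^ Fintype.card K - X : K[X]) = -1 := deriv_Q
  have hL2 : derivative (derivative L) = 0 := by
    have d := congrArg derivative hE
    simp only [derivative_add, derivative_mul (f := L), derivative_mul (f := X ^ Fintype.card K - X), derivative_comp, hQ', derivative_zero] at d
    have g1 : L * derivative G = C ((b : K) + 1) * (derivative L * G) := by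
      rw [hLM, derivative_mul]; simp only [C_add, C_1]
      linear_combination L * e3
    have g2 : G * (derivative S).comp G = C (r : K) * S.comp G := by
      have := congrArg (fun f => f.comp G) hS'
      simpa only [mul_comp, X_comp, C_comp] using this
    have harC : C ((b : K) + 1) * C (r : K) = -1 := by
      rw [← C_mul]; push_cast at har; rw [har]; simp
    have : (X ^ Fintype.card K - X) * derivative (derivative L) = 0 := by
      linear_combination d - (derivative S).comp G * g1 - C ((b : K) + 1) * derivative L * g2 - derivative L * S.comp G * harC
    exact (mul_eq_zero.1 this).resolve_left hQ0
  have hadv' : p ∣ (b + 1) * r + 1 := by rwa [add_comm]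
  have hrn : r * G.natDegree ≤ p ^ 4 - 1 := by rw [hGd, ← hcard]; exact h1
  apply Good.of_scale 1 (-γ) one_ne_zero
  rw [C_1, one_mul, C_neg, ← sub_eq_add_neg, ← hG]
  rcases E_core hcard G L N S (b + 1) r ha2 hap hr2 hadv' hGN hN0 (Lf_monic F γ) (Lf_dvd_Q F γ) (Lf_natDegree_pos F γ hγ) hL2 hSd hS' hE hrn with h | ⟨h, s, hs⟩
  · exact h
  · refine partC hcard G L N S (b + 1) r ha2 hr2 h hGN hN0 (Lf_monic F γ) (Lf_natDegree_pos F γ hγ) hL2 s hs hE ?_ hrn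
    intro x hx
    rw [hGN, eval_mul, eval_pow, hx, zero_pow (by omega), zero_mul]

end caseEw

section caseN1
set_option linter.unusedSectionVars false
set_option linter.unusedSimpArgs false
set_option linter.unusedVariables false
variable {K : Type} [Field K] [Fintype K] [DecidableEq K]

theorem comp_digits_lt (σ F : K[X]) (m : ℕ) (hm : σ.natDegree < m) :
    σ.comp F = ∑ j ∈ Finset.range m, C (σ.coeff j) * F ^ j := by
  rw [comp, eval₂_eq_sum_range' _ hm]

theorem mkS (F : K[X]) (c : K) (hc : c ≠ 0) (γ : K) (hγ : γ ∈ valueSet F) (hcf : cf F γ = c)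
    (hD : Lf F γ * ∏ g' ∈ (valueSet F).erase γ, (F - C g') =
        - (C (cf F γ) * ((X ^ Fintype.card K - X) * derivative (Lf F γ)))) :
    ∃ S : K[X], S.natDegree = (valueSet F).card - 1 ∧ S.eval 0 = 0 ∧
      Lf F γ + Lf F γ * S.comp (F - C γ) + (X ^ Fintype.card K - X) * derivative (Lf F γ) = 0 := by
  have hinv : (C c : K[X]) * C c⁻¹ = 1 := by rw [← C_mul, mul_inv_cancel₀ hc, C_1]
  refine ⟨C c⁻¹ * (Tp ((valueSet F).erase γ)).comp (X + C γ) - 1, ?_, ?_, ?_⟩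
  · rw [show (1 : K[X]) = C 1 from rfl, natDegree_sub_C, natDegree_C_mul (inv_ne_zero hc), natDegree_comp, natDegree_X_add_C, Tp_deg, mul_one, Finset.card_erase_of_mem hγ]
  · simp only [eval_sub, eval_mul, eval_C, eval_comp, eval_add, eval_X, zero_add, eval_one, Tp_eval]
    rw [← cf, hcf, inv_mul_cancel₀ hc, sub_self]
  · rw [sub_comp, mul_comp, C_comp, comp_assoc, one_comp]
    rw [show (X + C γ : K[X]).comp (F - C γ) = F by simp, Tp_comp]
    rw [hcf] at hD
    linear_combination C c⁻¹ * hD + (-(X ^ Fintype.card K - X) * derivative (Lf F γ)) * hinv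

/-- first step: `B^(p+1) = κ (F - γ)` -/
theorem N1_div {p : ℕ} [hp : Fact p.Prime] [CharP K p] (F A B ζ : K[X]) (hn : 0 < F.natDegree)
    (dA : p * A.natDegree ≤ F.natDegree) (dB : p * B.natDegree ≤ F.natDegree - 1)
    (hw : A * derivative B - derivative A * B = (derivative ζ).comp F * B ^ (p + 1) - ζ.comp F * derivative B)
    (hρ : 2 ≤ ζ.natDegree) (hB' : derivative B ≠ 0) :
    ∃ (κ : K[X]) (γ : K), derivative B = C (ζ.natDegree : K) * κ ∧ B ^ (p + 1) = κ * (F - C γ) ∧ (ζ.natDegree : K) ≠ 0 ∧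
      A * derivative B - derivative A * B = - C (ζ.eval γ) * derivative B := by
  have h2 := hp.out.two_le
  set ρ := ζ.natDegree with hρd
  have hF0 : F ≠ 0 := by rintro rfl; simp at hn
  have hA2 : 2 * A.natDegree ≤ p * A.natDegree := Nat.mul_le_mul_right _ h2
  have hB2 : 2 * B.natDegree ≤ p * B.natDegree := Nat.mul_le_mul_right _ h2
  have dB1 := natDegree_derivative_le B
  have dA1 := natDegree_derivative_le A
  have hBpos : 0 < B.natDegree := by
    rcases Nat.eq_zero_or_pos B.natDegree with h | h
    · rw [eq_C_of_natDegree_eq_zero h] at hB'; simp at hB'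
    · exact h
  set w := A * derivative B - derivative A * B with hwd
  have dw : w.natDegree < F.natDegree := by
    refine lt_of_le_of_lt (natDegree_sub_le _ _) (max_lt ?_ ?_)
    · exact lt_of_le_of_lt natDegree_mul_le (by omega)
    · exact lt_of_le_of_lt natDegree_mul_le (by omega)
  obtain ⟨κ, τ, hdm, dτ⟩ : ∃ κ τ : K[X], B ^ (p + 1) = F * κ + τ ∧ τ.natDegree < F.natDegree :=
    ⟨_, _, (EuclideanDomain.div_add_mod _ _).symm, natDegree_mod_lt _ (by omega)⟩
  have dκ : κ.natDegree < F.natDegree := by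
    by_cases h0 : κ = 0
    · rw [h0]; simpa using hn
    have h3 : (F * κ).natDegree = F.natDegree + κ.natDegree := natDegree_mul hF0 h0
    have h4 : (F * κ).natDegree ≤ max (B ^ (p + 1)).natDegree τ.natDegree := by
      rw [show F * κ = B ^ (p + 1) - τ by rw [hdm]; ring]; exact natDegree_sub_le _ _
    rw [natDegree_pow, add_mul, one_mul] at h4
    rcases le_max_iff.1 h4 with h4 | h4 <;> omega
  set d : ℕ → K[X] := fun j => C (ζ.coeff j) * (C (j : K) * κ - derivative B) + C (ζ.coeff (j + 1) * (j + 1)) * τ - (if j = 0 then w else 0) with hdd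
  have hdeg : ∀ j, (d j).natDegree < F.natDegree := by
    intro j
    refine lt_of_le_of_lt (natDegree_sub_le _ _) (max_lt ?_ ?_)
    · refine lt_of_le_of_lt (natDegree_add_le _ _) (max_lt ?_ ?_)
      · refine lt_of_le_of_lt (natDegree_C_mul_le _ _) (lt_of_le_of_lt (natDegree_sub_le _ _) (max_lt ?_ (by omega)))
        exact lt_of_le_of_lt (natDegree_C_mul_le _ _) dκ
      · exact lt_of_le_of_lt (natDegree_C_mul_le _ _) dτ
    · split_ifs
      · exact dw
      · simpa using hn
  have hsum : ∑ j ∈ Finset.range (ρ + 1), d j * F ^ j = 0 := by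
    have s1 := comp_digits ζ F ρ rfl
    have s2 := comp_digits' ζ F ρ rfl
    have s3 := comp_digits_lt (derivative ζ) F (ρ + 1) (by have := natDegree_derivative_le ζ; omega)
    have e : F * (derivative ζ).comp F * κ + (derivative ζ).comp F * τ - ζ.comp F * derivative B - w = 0 := by
      rw [hw, hdm]; ring
    rw [s2, s1, s3] at e
    rw [← e]
    simp only [hdd, sub_mul, add_mul, Finset.sum_sub_distrib, Finset.sum_add_distrib, ite_mul, zero_mul, Finset.sum_ite_eq', Finset.mem_range, Finset.sum_mul, mul_sub, coeff_derivative]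
    rw [if_pos (by omega), pow_zero, mul_one, ← sub_eq_zero]
    have r1 : ∀ j, C (ζ.coeff j) * C (j : K) * F ^ j * κ = C (ζ.coeff j) * (C (j : K) * κ) * F ^ j := fun j => by ring
    have r2 : ∀ j, C (ζ.coeff (j + 1) * ((j : K) + 1)) * F ^ j * τ = C (ζ.coeff (j + 1) * ((j : K) + 1)) * τ * F ^ j := fun j => by ring
    have r3 : ∀ j, C (ζ.coeff j) * F ^ j * derivative B = C (ζ.coeff j) * derivative B * F ^ j := fun j => by ring
    simp only [r1, r2, r3]
    ring
  have hdig := digits F hn (ρ + 1) d (fun j _ => hdeg j) hsum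
  have hlc : ζ.coeff ρ ≠ 0 := by
    rw [hρd]; apply leadingCoeff_ne_zero.2; rintro rfl; simp [hρd] at hρ
  have t1 := hdig ρ (by omega)
  simp only [hdd] at t1
  rw [coeff_eq_zero_of_natDegree_lt (show ζ.natDegree < ρ + 1 by omega), if_neg (by omega), zero_mul, C_0, zero_mul, add_zero, sub_zero, mul_eq_zero] at t1
  have t1 := sub_eq_zero.1 (t1.resolve_left (C_ne_zero.2 hlc))
  have hρ0 : (ρ : K) ≠ 0 := by
    intro h; rw [h, C_0, zero_mul] at t1; exact hB' t1.symm
  obtain ⟨σ, hσ⟩ : ∃ σ, ρ = σ + 1 := ⟨ρ - 1, by omega⟩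
  have t2 := hdig σ (by omega)
  simp only [hdd] at t2
  rw [if_neg (by omega), sub_zero, ← t1, ← hσ] at t2
  have hcast : (ρ : K) = σ + 1 := by rw [hσ]; push_cast; ring
  set γ : K := - (ζ.coeff σ / (ρ * ζ.coeff ρ)) with hγ
  have hτ : τ = - C γ * κ := by
    have hu : ζ.coeff ρ * (σ + 1) ≠ 0 := by rw [← hcast]; exact mul_ne_zero hlc hρ0
    apply mul_left_cancel₀ (C_ne_zero.2 hu)
    have hg : C (ζ.coeff ρ * ((σ : K) + 1)) * C γ = - C (ζ.coeff σ) := by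
      rw [← C_mul, ← C_neg, hγ, ← hcast]; congr 1; field_simp
    have hc1 : (C (ρ : K) : K[X]) = C (σ : K) + 1 := by rw [hcast]; simp
    rw [hc1] at t2
    linear_combination t2 + κ * hg
  have hBk : B ^ (p + 1) = κ * (F - C γ) := by rw [hdm, hτ]; ring
  refine ⟨κ, γ, t1.symm, hBk, hρ0, ?_⟩
  set Ξ : K[X] := (X - C γ) * derivative ζ - C (ρ : K) * ζ with hΞ
  have hw2 : w = κ * Ξ.comp F := by
    rw [hw, hBk, ← t1, hΞ]
    simp only [sub_comp, mul_comp, X_comp, C_comp]; ring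
  have hκ0 : κ ≠ 0 := by rintro rfl; rw [mul_zero] at t1; exact hB' t1.symm
  have hΞ0 : Ξ.natDegree = 0 := by
    by_contra hne
    have hc0 : Ξ.comp F ≠ 0 := by
      intro h
      have := congrArg natDegree h
      rw [natDegree_comp, natDegree_zero] at this
      rcases Nat.mul_eq_zero.1 this with h | h <;> omega
    have := natDegree_mul hκ0 hc0
    rw [← hw2, natDegree_comp] at this
    have h5 : 1 * F.natDegree ≤ Ξ.natDegree * F.natDegree := Nat.mul_le_mul_right _ (by omega)
    omega
  have hΞC : Ξ = C (- (ρ * ζ.eval γ)) := by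
    have h6 := eq_C_of_natDegree_eq_zero hΞ0
    have h7 := congrArg (eval γ) h6
    rw [eval_C] at h7
    rw [h6, ← h7, hΞ]; simp
  rw [hw2, hΞC, C_comp, ← t1]
  simp only [C_neg, C_mul]; ring

end caseN1

section caseN2
set_option linter.unusedSectionVars false
set_option linter.unusedSimpArgs false
set_option linter.unusedVariables false
variable {K : Type} [Field K] [Fintype K] [DecidableEq K]

theorem UW_big {p : ℕ} [hp : Fact p.Prime] [CharP K p] (L U W : K[X]) (hLQ : L ∣ X ^ Fintype.card K - X) (hL0 : L ≠ 0)
    (hd : 0 < L.natDegree) (hd1 : L.natDegree ≠ 1)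
    (hUW : L = U ^ p + X * W ^ p) (hL' : derivative L = W ^ p)
    (hw : U * derivative W - derivative U * W = 0) :
    p ^ 2 ≤ L.natDegree ∧ derivative W = 0 ∧ W ≠ 0 := by
  have h2 := hp.out.two_le
  have hsq : Squarefree L := Q_squarefree.squarefree_of_dvd hLQ
  have hcUW := coprimeUW p h2 L U W hUW hsq
  have hcLW := coprime_LW p L W hLQ hL'
  have hW0 : W ≠ 0 := by
    rintro rfl
    have := isUnit_iff_degree_eq_zero.1 (isCoprime_zero_right.1 hcLW)
    rw [degree_eq_natDegree hL0] at this
    norm_cast at this; omega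
  have hWd : derivative W = 0 := by
    apply dvd_deriv
    apply hcUW.symm.dvd_of_dvd_mul_left
    exact ⟨derivative U, by linear_combination hw⟩
  have hUd : derivative U = 0 := by
    rw [hWd, mul_zero, zero_sub, neg_eq_zero, mul_eq_zero] at hw
    exact hw.resolve_right hW0
  obtain ⟨U1, hU1⟩ := pth_root p U hUd
  obtain ⟨W1, hW1⟩ := pth_root p W hWd
  have hL2 : derivative L = W1 ^ p ^ 2 := by rw [hL', hW1, ← pow_mul, pow_two]
  have hUW2 : L = U1 ^ p ^ 2 + X * W1 ^ p ^ 2 := by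
    conv_lhs => rw [hUW, hU1, hW1]
    rw [← pow_mul, ← pow_mul, pow_two]
  obtain ⟨dU1, dW1⟩ := degUW (p ^ 2) L U1 W1 hUW2 hL2
  refine ⟨?_, hWd, hW0⟩
  by_contra hlt
  have u0 : U1.natDegree = 0 := by
    by_contra hne
    have : p ^ 2 * 1 ≤ p ^ 2 * U1.natDegree := Nat.mul_le_mul_left _ (by omega)
    omega
  have w0 : W1.natDegree = 0 := by
    by_contra hne
    have : p ^ 2 * 1 ≤ p ^ 2 * W1.natDegree := Nat.mul_le_mul_left _ (by omega)
    omega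
  have : L.natDegree ≤ 1 := by
    rw [hUW2]
    refine (natDegree_add_le_of_le (m := 0) (n := 1) ?_ ?_).trans (by simp)
    · rw [natDegree_pow, u0]; simp
    · refine natDegree_mul_le.trans ?_
      rw [natDegree_pow, w0]; simp
  omega

theorem caseN_B {p : ℕ} [hp : Fact p.Prime] [CharP K p] (hcard : Fintype.card K = p ^ 4) (F : K[X]) (hn : 0 < F.natDegree)
    (h1 : ((valueSet F).card - 1) * F.natDegree ≤ Fintype.card K - 1)
    (h3 : 3 ≤ (valueSet F).card) (c : K) (hc : c ≠ 0)
    (hA : ∀ g ∈ valueSet F, C (cf F g) * (Lf F g * derivative (Mf F g)) = C (cf F g - c) * derivative F)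
    (hB : ∀ g ∈ valueSet F, C (cf F g) * (derivative (Lf F g) * Mf F g) = C c * derivative F)
    (hD : ∀ g ∈ valueSet F, Lf F g * ∏ g' ∈ (valueSet F).erase g, (F - C g') =
        - (C (cf F g) * ((X ^ Fintype.card K - X) * derivative (Lf F g))))
    (hall : ∀ g ∈ valueSet F, cf F g = c)
    (hTF : (Tp (valueSet F)).comp F = - (C c * ((X ^ Fintype.card K - X) * derivative F)))
    (A B ζ : K[X]) (hAB : F = A ^ p + X * B ^ p) (hF' : derivative F = B ^ p)
    (hζ : Tp (valueSet F) = C c * (X + ζ ^ p)) (hR : (valueSet F).card = p * ζ.natDegree)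
    (hw : A * derivative B - derivative A * B = (derivative ζ).comp F * B ^ (p + 1) - ζ.comp F * derivative B)
    (hρ : 2 ≤ ζ.natDegree) (hB' : derivative B ≠ 0) : Good p F := by
  have h2 := hp.out.two_le
  have hp0 := hp.out.ne_zero
  obtain ⟨dA, dB⟩ := degUW p F A B hAB hF'
  obtain ⟨κ, γ, hκ1, hκ2, hρ0, hww⟩ := N1_div F A B ζ hn dA dB hw hρ hB'
  have hB0 : B ≠ 0 := by rintro rfl; simp at hB'
  have hγ : γ ∈ valueSet F := by
    by_contra hγ
    have hev : (Tp (valueSet F)).eval γ ≠ 0 := by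
      rw [Tp_eval, Finset.prod_ne_zero_iff]
      intro h hh h0; rw [sub_eq_zero] at h0; exact hγ (h0 ▸ hh)
    obtain ⟨q, hq⟩ := X_sub_C_dvd_sub_C_eval (p := Tp (valueSet F)) (a := γ)
    have hq2 := congrArg (fun f => f.comp F) hq
    simp only [sub_comp, mul_comp, X_comp, C_comp] at hq2
    have hcop : IsCoprime (F - C γ) ((Tp (valueSet F)).comp F) := by
      refine ⟨- C ((Tp (valueSet F)).eval γ)⁻¹ * q.comp F, C ((Tp (valueSet F)).eval γ)⁻¹, ?_⟩
      have hi : C ((Tp (valueSet F)).eval γ)⁻¹ * C ((Tp (valueSet F)).eval γ) = 1 := by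
        rw [← C_mul, inv_mul_cancel₀ hev, C_1]
      linear_combination C ((Tp (valueSet F)).eval γ)⁻¹ * hq2 + hi
    have hBd : B ∣ (Tp (valueSet F)).comp F := by
      rw [hTF, hF']
      exact (dvd_neg.2 (((dvd_pow_self B hp0).mul_left _).mul_left _))
    have hcB : IsCoprime (F - C γ) (B ^ (p + 1)) := (hcop.of_isCoprime_of_dvd_right hBd).pow_right
    have hu : IsUnit (F - C γ) := hcB.isUnit_of_dvd' dvd_rfl (by rw [hκ2]; exact dvd_mul_left _ _)
    have := natDegree_eq_zero_of_isUnit hu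
    rw [F_sub_natDegree] at this; omega
  have hγe : γ + (ζ.eval γ) ^ p = 0 := by
    have := congrArg (eval γ) hζ
    rw [Tp_eval, Finset.prod_eq_zero hγ (sub_self γ)] at this
    simp [hc] at this; exact this
  set At := A + C (ζ.eval γ) with hAt
  set L := Lf F γ with hL
  set M := Mf F γ with hM
  have hLM : F - C γ = L * M := LM F γ
  have hG : F - C γ = At ^ p + X * B ^ p := by
    rw [hAt, add_pow_char, ← C_pow]
    have : (C (ζ.eval γ ^ p) : K[X]) = - C γ := by rw [← C_neg]; congr 1; linear_combination hγe
    linear_combination hAB - this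
  have hAtw : At * derivative B - derivative At * B = 0 := by
    rw [hAt]; simp only [derivative_add, derivative_C, add_zero]
    linear_combination hww
  have hcf := hall γ hγ
  have hLm : L.Monic := Lf_monic F γ
  have hM0 : M ≠ 0 := Mf_ne F hn γ
  have hM' : derivative M = 0 := by
    have := hA γ hγ
    rw [hcf, sub_self, C_0, zero_mul, mul_eq_zero, mul_eq_zero] at this
    rcases this with h | h | h
    · exact absurd h (C_ne_zero.2 hc)
    · exact absurd h hLm.ne_zero
    · exact h
  obtain ⟨N, hN⟩ := pth_root p M hM'
  have hN0 : N ≠ 0 := by rintro rfl; rw [zero_pow hp0] at hN; exact hM0 hN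
  have hLB : derivative L * N ^ p = B ^ p := by
    have := hB γ hγ
    rw [hcf, ← hL, ← hM, hN, hF'] at this
    exact mul_left_cancel₀ (C_ne_zero.2 hc) this
  obtain ⟨W, hW⟩ : N ∣ B := by
    rw [← UniqueFactorizationMonoid.pow_dvd_pow_iff_dvd hp0, ← hLB]; exact dvd_mul_left _ _
  have hL' : derivative L = W ^ p := by
    apply mul_right_cancel₀ (pow_ne_zero p hN0)
    rw [hLB, hW]; ring
  obtain ⟨U, hU⟩ : N ∣ At := by
    rw [← UniqueFactorizationMonoid.pow_dvd_pow_iff_dvd hp0]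
    refine ⟨L - X * W ^ p, ?_⟩
    rw [hLM, hN, hW] at hG
    linear_combination - hG
  have hUW : L = U ^ p + X * W ^ p := by
    apply mul_right_cancel₀ (pow_ne_zero p hN0)
    rw [hLM, hN, hW, hU] at hG
    linear_combination hG
  have hwUW : U * derivative W - derivative U * W = 0 := by
    rw [hU, hW] at hAtw
    simp only [derivative_mul] at hAtw
    have : N ^ 2 * (U * derivative W - derivative U * W) = 0 := by linear_combination hAtw
    exact (mul_eq_zero.1 this).resolve_left (pow_ne_zero 2 hN0)
  have hLQ : L ∣ X ^ Fintype.card K - X := Lf_dvd_Q F γ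
  have hd : 0 < L.natDegree := Lf_natDegree_pos F γ hγ
  by_cases hd1 : L.natDegree = 1
  · obtain ⟨S, hS1, hS2, hS3⟩ := mkS F c hc γ hγ hcf (hD γ hγ)
    have := lemmaX hcard (F - C γ) S L _ (by omega) hS1 hS2 hLm hd1 (by rw [F_sub_natDegree]; exact hn) hS3
    apply Good.of_scale 1 (-γ) one_ne_zero
    simpa [sub_eq_add_neg] using this
  exfalso
  obtain ⟨hbig, hWd, hW0⟩ := UW_big L U W hLQ hLm.ne_zero hd hd1 hUW hL' hwUW
  have key : C (ζ.natDegree : K) * N * W ^ p = derivative N * L := by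
    have e : C (ζ.natDegree : K) * B ^ (p + 1) = derivative B * (L * M) := by
      rw [hκ2, hκ1, hLM]; ring
    rw [hW, hN, derivative_mul, hWd] at e
    apply mul_left_cancel₀ (mul_ne_zero (pow_ne_zero p hN0) hW0)
    linear_combination e
  have hLN : L ∣ N := by
    have hc2 : IsCoprime L (W ^ p) := (coprime_LW p L W hLQ hL').pow_right
    have : L ∣ C (ζ.natDegree : K) * N := hc2.dvd_of_dvd_mul_right (by rw [key]; exact dvd_mul_left _ _)
    exact (IsUnit.dvd_mul_left (isUnit_C.2 hρ0.isUnit)).1 this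
  have hdN := natDegree_le_of_dvd hLN hN0
  have hdeg : F.natDegree = L.natDegree + p * N.natDegree := by
    rw [← LM_deg F hn γ, ← hL, ← hM, hN, natDegree_pow]
  have hq : p * p ≤ p ^ 4 := by
    calc p * p = p ^ 2 := by ring
      _ ≤ p ^ 4 := Nat.pow_le_pow_right (by omega) (by norm_num)
  have hr : 2 * p - 1 ≤ (valueSet F).card - 1 := by
    rw [hR]
    have : p * 2 ≤ p * ζ.natDegree := Nat.mul_le_mul_left _ hρ
    omega
  have hF2 : p ^ 2 + p * p ^ 2 ≤ F.natDegree := by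
    rw [hdeg]; exact add_le_add hbig (Nat.mul_le_mul_left _ (hbig.trans hdN))
  have := (Nat.mul_le_mul hr hF2).trans h1
  rw [hcard] at this
  obtain ⟨m, rfl⟩ : ∃ m, p = m + 2 := ⟨p - 2, by omega⟩
  have e1 : 2 * (m + 2) - 1 = 2 * m + 3 := by omega
  rw [e1] at this
  have : (2 * m + 3) * ((m + 2) ^ 2 + (m + 2) * (m + 2) ^ 2) ≤ (m + 2) ^ 4 := this.trans (Nat.sub_le _ _)
  nlinarith [sq_nonneg (m + 2), pow_pos (show 0 < m + 2 by omega) 3]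

end caseN2

section caseN3
set_option linter.unusedSectionVars false
set_option linter.unusedSimpArgs false
set_option linter.unusedVariables false
variable {K : Type} [Field K] [Fintype K] [DecidableEq K]

theorem lin_form (f : K[X]) (h : f.natDegree ≤ 1) : f = C (f.coeff 1) * X + C (f.coeff 0) :=
  eq_X_add_C_of_natDegree_le_one h

theorem F0_mem (F : K[X]) : F.eval 0 ∈ valueSet F :=
  Finset.mem_image_of_mem _ (Finset.mem_univ _)

theorem caseN_const {p : ℕ} [hp : Fact p.Prime] [CharP K p] (hcard : Fintype.card K = p ^ 4) (F : K[X]) (hn : 0 < F.natDegree)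
    (A B : K[X]) (b0 k : K) (hB : B = C b0) (hb0 : b0 ≠ 0) (hAB : F = A ^ p + X * B ^ p)
    (hk : derivative A = C k) (hdA : A.natDegree ≤ p) (γ : K) (hγ : F - C γ ∣ X ^ Fintype.card K - X) : Good p F := by
  have h2 := hp.out.two_le
  have hp0 := hp.out.ne_zero
  obtain ⟨A1, hA1⟩ := pth_root p (A - C k * X) (by simp [hk])
  have d1 : A1.natDegree ≤ 1 := by
    have : (A - C k * X).natDegree ≤ p := (natDegree_sub_le _ _).trans (max_le hdA ((natDegree_C_mul_X_le _).trans (by omega)))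
    rw [hA1, natDegree_pow] at this
    by_contra hne
    have h3 : p * 2 ≤ p * A1.natDegree := Nat.mul_le_mul_left _ (by omega)
    omega
  have hA1l := lin_form A1 d1
  set α := A1.coeff 1
  set α0 := A1.coeff 0
  have hA : A = C (α ^ p) * X ^ p + C k * X + C (α0 ^ p) := by
    have : A = C k * X + A1 ^ p := by rw [← hA1]; ring
    rw [this, hA1l, add_pow_char, mul_pow]; simp only [C_pow]; ring
  have hF : F = C (α ^ p ^ 2) * X ^ p ^ 2 + C (k ^ p) * X ^ p + C (b0 ^ p) * X + C (α0 ^ p ^ 2) := by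
    rw [hAB, hA, hB, add_pow_char, add_pow_char, mul_pow, mul_pow]
    simp only [C_pow, ← pow_mul, ← pow_two]; ring
  have hFG : F - C γ = C (α ^ p ^ 2) * X ^ p ^ 2 + C (k ^ p) * X ^ p + C (b0 ^ p) * X + C (α0 ^ p ^ 2 - γ) := by
    rw [hF, C_sub]; ring
  by_cases hc : α = 0 ∧ k = 0
  · have hb : b0 ^ p ≠ 0 := pow_ne_zero _ hb0
    apply Good.of_scale (b0 ^ p)⁻¹ (-((b0 ^ p)⁻¹ * α0 ^ p ^ 2)) (inv_ne_zero hb)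
    apply Good.of_typ
    left
    refine ⟨1, one_dvd _, ?_, ?_⟩
    · have : 2 ^ 4 ≤ p ^ 4 := Nat.pow_le_pow_left h2 4
      omega
    · rw [hF, hc.1, hc.2, zero_pow hp0, zero_pow (pow_ne_zero 2 hp0)]
      simp only [C_0, zero_mul, zero_add, pow_one, mul_add, C_neg, C_mul, ← mul_assoc]
      rw [← C_mul, inv_mul_cancel₀ hb, C_1]; ring
  · have := lemma45 hcard _ _ _ _ (fun h => by
      have hα : α = 0 := eq_zero_of_pow_eq_zero h
      exact pow_ne_zero p (fun hk => hc ⟨hα, hk⟩)) (pow_ne_zero p hb0) (F - C γ) hFG hγ (by rw [F_sub_natDegree]; exact hn) 1 (one_dvd _)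
    apply Good.of_scale 1 (-γ) one_ne_zero
    simpa [sub_eq_add_neg] using this

theorem caseN_p2 {p : ℕ} [hp : Fact p.Prime] [CharP K p] (hcard : Fintype.card K = p ^ 4) (F : K[X]) (hn : 0 < F.natDegree)
    (A1 B1 ξ : K[X]) (hA1 : A1.natDegree ≤ 1) (hB1 : B1.natDegree ≤ 1) (hξ : ξ.natDegree = 1)
    (hF : F = A1 ^ p ^ 2 + X * B1 ^ p ^ 2) (hs : A1 + ξ.comp F + X ^ p ^ 2 * B1 = 0) (γ : K)
    (hγ : γ + (ξ.eval γ) ^ p ^ 2 = 0) : Good p F := by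
  have h2 := hp.out.two_le
  have hA := lin_form A1 hA1
  have hB := lin_form B1 hB1
  have hx := lin_form ξ (by omega)
  have hx1 : ξ.coeff 1 ≠ 0 := by
    rw [← hξ]; apply leadingCoeff_ne_zero.2; rintro rfl; simp at hξ
  set a1 := A1.coeff 1
  set a0 := A1.coeff 0
  set b1 := B1.coeff 1
  set b0 := B1.coeff 0
  set x1 := ξ.coeff 1
  set x0 := ξ.coeff 0
  have hev : ξ.eval γ = x1 * γ + x0 := by rw [hx]; simp
  rw [hev] at hγ
  have hFe : F = C (b1 ^ p ^ 2) * X ^ (p ^ 2 + 1) + C (a1 ^ p ^ 2) * X ^ p ^ 2 + C (b0 ^ p ^ 2) * X + C (a0 ^ p ^ 2) := by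
    rw [hF, hA, hB, add_pow_char_pow, add_pow_char_pow, mul_pow, mul_pow]
    simp only [C_pow]; ring
  have hg : (C ((x1 * γ + x0) ^ p ^ 2) : K[X]) = - C γ := by
    rw [← C_neg]; congr 1; linear_combination hγ
  rw [hx] at hs
  simp only [add_comp, mul_comp, X_comp, C_comp] at hs
  have hp4 : 4 ≤ p ^ 2 := by nlinarith
  have := lemma3 hcard b1 a1 (a0 + (x1 * γ + x0)) b0 (-x1) (neg_ne_zero.2 hx1) (F - C γ)
    (by rw [add_pow_char_pow, C_add, hg]; linear_combination hFe)
    (by rw [hA, hB] at hs; simp only [C_add, C_mul, C_neg]; linear_combination hs)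
    (by rw [F_sub_natDegree]; exact hn) 1 (one_dvd _) (by omega)
  apply Good.of_scale 1 (-γ) one_ne_zero
  simpa [sub_eq_add_neg] using this

theorem caseN {p : ℕ} [hp : Fact p.Prime] [CharP K p] (hcard : Fintype.card K = p ^ 4) (F : K[X]) (hn : 0 < F.natDegree)
    (h1 : ((valueSet F).card - 1) * F.natDegree ≤ Fintype.card K - 1)
    (h3 : 3 ≤ (valueSet F).card) (c : K) (hc : c ≠ 0) (hF0 : derivative F ≠ 0)
    (hA : ∀ g ∈ valueSet F, C (cf F g) * (Lf F g * derivative (Mf F g)) = C (cf F g - c) * derivative F)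
    (hB : ∀ g ∈ valueSet F, C (cf F g) * (derivative (Lf F g) * Mf F g) = C c * derivative F)
    (hC : ∏ g ∈ valueSet F, (F - C g) = - (C c * ((X ^ Fintype.card K - X) * derivative F)))
    (hD : ∀ g ∈ valueSet F, Lf F g * ∏ g' ∈ (valueSet F).erase g, (F - C g') =
        - (C (cf F g) * ((X ^ Fintype.card K - X) * derivative (Lf F g))))
    (hall : ∀ g ∈ valueSet F, cf F g = c) : Good p F := by
  have h2 := hp.out.two_le
  have hp0 := hp.out.ne_zero
  set V := valueSet F with hV
  set T := Tp V with hT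
  have hTd : T.natDegree = V.card := Tp_deg V
  have hTF : T.comp F = - (C c * ((X ^ Fintype.card K - X) * derivative F)) := by rw [← hC]; exact Tp_comp V F
  have hT' : derivative T = C c := by
    rw [← sub_eq_zero]
    have hdv : T ∣ derivative T - C c := by
      rw [show T = ∏ a ∈ V, (X - C a) from rfl]
      apply dvd_of_roots
      intro g hg
      rw [eval_sub, eval_C, sub_eq_zero, ← hall g hg]
      exact Tp_deriv V g hg
    refine eq_zero_of_dvd_of_natDegree_lt hdv ?_
    rw [natDegree_sub_C, hTd]
    have := natDegree_derivative_le T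
    omega
  have hcC : (C c : K[X]) ≠ 0 := C_ne_zero.2 hc
  have hQ0 : (X ^ Fintype.card K - X : K[X]) ≠ 0 := Q_squarefree.ne_zero
  have hF2 : derivative (derivative F) = 0 := by
    have d := congrArg derivative hTF
    rw [derivative_comp, hT', C_comp, derivative_neg, derivative_C_mul, derivative_mul, deriv_Q] at d
    have : C c * (X ^ Fintype.card K - X) * derivative (derivative F) = 0 := by linear_combination d
    exact (mul_eq_zero.1 this).resolve_left (mul_ne_zero hcC hQ0)
  obtain ⟨A, B, hAB, hF'⟩ := UWform p F hF2
  obtain ⟨dA, dB⟩ := degUW p F A B hAB hF'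
  have hB0 : B ≠ 0 := by rintro rfl; rw [zero_pow hp0] at hF'; exact hF0 hF'
  have hinv : (C c : K[X]) * C c⁻¹ = 1 := by rw [← C_mul, mul_inv_cancel₀ hc, C_1]
  obtain ⟨ζ, hζ0⟩ := pth_root p (C c⁻¹ * T - X) (by
    rw [derivative_sub, derivative_C_mul, hT', derivative_X]; linear_combination hinv)
  have hζ : T = C c * (X + ζ ^ p) := by rw [← hζ0]; linear_combination - T * hinv
  have hR : V.card = p * ζ.natDegree := by
    rw [← hTd, hζ, natDegree_C_mul hc]
    by_cases hz : ζ.natDegree = 0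
    · exfalso
      have : (X + ζ ^ p : K[X]).natDegree ≤ 1 := by
        refine (natDegree_add_le_of_le (m := 1) (n := 0) (by simp) ?_).trans (by simp)
        rw [natDegree_pow, hz]; simp
      rw [hζ, natDegree_C_mul hc] at hTd
      omega
    · have h4 : p * 1 ≤ p * ζ.natDegree := Nat.mul_le_mul_left _ (by omega)
      rw [natDegree_add_eq_right_of_natDegree_lt, natDegree_pow]
      rw [natDegree_pow, natDegree_X]; omega
  have hstar : A + ζ.comp F + X ^ p ^ 3 * B = 0 := by
    apply eq_zero_of_pow_eq_zero (n := p)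
    have e := hTF
    rw [hζ, hF', hcard, mul_comp, C_comp, add_comp, X_comp, pow_comp] at e
    rw [add_pow_char, add_pow_char, mul_pow, ← pow_mul, ← pow_succ]
    apply mul_left_cancel₀ hcC
    linear_combination e - C c * hAB
  have hstar' : derivative A + B ^ p * (derivative ζ).comp F + X ^ p ^ 3 * derivative B = 0 := by
    have d := congrArg derivative hstar
    rw [derivative_add, derivative_add, derivative_comp, hF', derivative_mul, derivative_X_pow, derivative_zero] at d
    have : ((p ^ 3 : ℕ) : K) = 0 := by simp
    rw [this] at d
    linear_combination d + (by rw [C_0]; ring : (C (0:K) * X ^ (p ^ 3 - 1) * B : K[X]) = 0) * 0 - (by rw [C_0]; ring : (C (0:K) * X ^ (p ^ 3 - 1) * B : K[X]) = 0)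
  have hw : A * derivative B - derivative A * B = (derivative ζ).comp F * B ^ (p + 1) - ζ.comp F * derivative B := by
    linear_combination derivative B * hstar - B * hstar'
  have hdeg : V.card * F.natDegree = p ^ 4 + p * B.natDegree := by
    have := congrArg natDegree hTF
    rw [natDegree_comp, natDegree_neg, natDegree_C_mul hc, natDegree_mul hQ0 hF0, hF', natDegree_pow, hTd,
      FiniteField.X_pow_card_sub_X_natDegree_eq K Fintype.one_lt_card, hcard] at this
    exact this
  rw [hcard] at h1
  set n := F.natDegree with hnd
  have hγ0 : ∀ γ ∈ V, γ + (ζ.eval γ) ^ p = 0 := by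
    intro γ hγ
    have := congrArg (eval γ) hζ
    rw [hT, Tp_eval, Finset.prod_eq_zero hγ (sub_self γ)] at this
    simp [hc] at this; exact this
  have hρpos : 0 < ζ.natDegree := by
    rcases Nat.eq_zero_or_pos ζ.natDegree with h | h
    · rw [h] at hR; omega
    · exact h
  rcases Nat.eq_or_lt_of_le hρpos with hρ1 | hρ2
  · -- ρ = 1
    rw [← hρ1] at hR
    have hp3 : 3 ≤ p := by omega
    have hl := lin_form ζ (by omega)
    have hz1 : ζ.coeff 1 ≠ 0 := by
      rw [show (1 : ℕ) = ζ.natDegree by omega]; apply leadingCoeff_ne_zero.2; rintro rfl; simp at hρpos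
    have hz1p := pow_ne_zero p hz1
    have := good_pow hcard (F - C (F.eval 0)) (- (ζ.coeff 1 ^ p)⁻¹) (by rw [F_sub_natDegree]; exact hn)
      (by rw [F_sub_natDegree]; convert h1 using 2; omega) (by
        intro x
        have m1 : F.eval x ∈ V := Finset.mem_image_of_mem _ (Finset.mem_univ _)
        have e1 := hγ0 _ m1
        have e0 := hγ0 _ (F0_mem F)
        rw [hl] at e1 e0
        simp only [eval_add, eval_mul, eval_C, eval_X, add_pow_char, mul_pow] at e1 e0
        rw [eval_sub, eval_C, sub_pow_char]
        field_simp
        linear_combination e1 - e0) 1 (one_dvd _) (by omega)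
    apply Good.of_scale 1 (-(F.eval 0)) one_ne_zero
    simpa [sub_eq_add_neg] using this
  by_cases hB' : derivative B = 0
  swap
  · exact caseN_B hcard F hn (by rw [hcard]; exact h1) h3 c hc hA hB hD hall hTF A B ζ hAB hF' hζ hR hw hρ2 hB'
  rw [hB', mul_zero, add_zero] at hstar'
  have hζ'd : (derivative ζ).natDegree = 0 := by
    by_contra hne
    have hc0 : (derivative ζ).comp F ≠ 0 := by
      intro h
      have := congrArg natDegree h
      rw [natDegree_comp, natDegree_zero] at this
      rcases Nat.mul_eq_zero.1 this with h | h <;> omega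
    have e : (derivative A).natDegree = (B ^ p * (derivative ζ).comp F).natDegree := by
      rw [eq_neg_of_add_eq_zero_left hstar', natDegree_neg]
    rw [natDegree_mul (pow_ne_zero p hB0) hc0, natDegree_comp, ← hnd] at e
    have h5 : 1 * n ≤ (derivative ζ).natDegree * n := Nat.mul_le_mul_right _ (by omega)
    have h6 := natDegree_derivative_le A
    have h7 : 1 * A.natDegree ≤ p * A.natDegree := Nat.mul_le_mul_right _ (by omega)
    omega
  have hζ'C := eq_C_of_natDegree_eq_zero hζ'd
  set κ := (derivative ζ).coeff 0 with hκ
  rw [hζ'C, C_comp] at hstar'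
  obtain ⟨σ, hσ⟩ : p ∣ ζ.natDegree := by
    have h5 : (derivative ζ).coeff (ζ.natDegree - 1) = 0 := by
      rw [hζ'C, coeff_C, if_neg (by omega)]
    rw [coeff_derivative, show ζ.natDegree - 1 + 1 = ζ.natDegree by omega, mul_eq_zero] at h5
    have hlc : ζ.coeff ζ.natDegree ≠ 0 := by
      apply leadingCoeff_ne_zero.2; rintro rfl; simp at hρpos
    have h6 := h5.resolve_left hlc
    rw [← CharP.cast_eq_zero_iff K p, ← h6]
    conv_lhs => rw [show ζ.natDegree = (ζ.natDegree - 1) + 1 by omega]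
    push_cast; ring
  have hσ1 : 1 ≤ σ := by
    rcases Nat.eq_zero_or_pos σ with h | h
    · rw [h] at hσ; omega
    · exact h
  have hRp : V.card = p ^ 2 * σ := by rw [hR, hσ]; ring
  by_cases hBd : B.natDegree = 0
  · have hBC := eq_C_of_natDegree_eq_zero hBd
    have hb0 : B.coeff 0 ≠ 0 := by intro h; rw [h, C_0] at hBC; exact hB0 hBC
    have hn2 : n ≤ p ^ 2 := by
      rw [hBd, mul_zero, add_zero, hRp] at hdeg
      have : p ^ 2 * (σ * n) = p ^ 2 * p ^ 2 := by rw [← mul_assoc, hdeg]; ring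
      have := Nat.eq_of_mul_eq_mul_left (by positivity) this
      nlinarith
    refine caseN_const hcard F hn A B (B.coeff 0) (- (B.coeff 0 ^ p * κ)) hBC hb0 hAB ?_ ?_ (F.eval 0) ?_
    · rw [hBC, ← C_pow, ← C_mul] at hstar'
      rw [eq_neg_of_add_eq_zero_left hstar', ← C_neg]
    · have : p * A.natDegree ≤ p * p := by rw [← pow_two]; exact dA.trans hn2
      exact Nat.le_of_mul_le_mul_left this (by omega)
    · have hd : F - C (F.eval 0) ∣ T.comp F := by
        rw [Tp_comp]; exact Finset.dvd_prod_of_mem (fun g => F - C g) (F0_mem F)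
      rw [hTF, hF', hBC, ← C_pow, dvd_neg] at hd
      have hd2 := (IsUnit.dvd_mul_left (isUnit_C.2 hc.isUnit)).1 hd
      exact (IsUnit.dvd_mul_right (isUnit_C.2 (pow_ne_zero p hb0).isUnit)).1 hd2
  · obtain ⟨B1, hB1⟩ := pth_root p B hB'
    have hBB : B.natDegree = p * B1.natDegree := by rw [hB1, natDegree_pow]
    set b1 := B1.natDegree with hb1
    have hb1pos : 1 ≤ b1 := by
      rcases Nat.eq_zero_or_pos b1 with h | h
      · rw [h] at hBB; omega
      · exact h
    have hp4 : 4 ≤ p ^ 2 := by nlinarith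
    have hdB2 : p ^ 2 * b1 ≤ n - 1 := by
      rw [hBB, ← mul_assoc, ← pow_two] at dB; exact dB
    have hdeg2 : σ * n = p ^ 2 + b1 := by
      rw [hBB, hRp] at hdeg
      have : p ^ 2 * (σ * n) = p ^ 2 * (p ^ 2 + b1) := by rw [← mul_assoc, hdeg]; ring
      exact Nat.eq_of_mul_eq_mul_left (by positivity) this
    have hb1e : b1 = 1 := by
      by_contra hne
      have h5 : n ≤ σ * n := Nat.le_mul_of_pos_left _ (by omega)
      have h6 : 4 * (b1 - 1) ≤ p ^ 2 * (b1 - 1) := Nat.mul_le_mul_right _ hp4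
      have h7 : p ^ 2 * b1 = p ^ 2 * (b1 - 1) + p ^ 2 := by
        obtain ⟨m, hm⟩ : ∃ m, b1 = m + 1 := ⟨b1 - 1, by omega⟩
        rw [hm]; simp; ring
      omega
    rw [hb1e, mul_one] at hdB2
    rw [hb1e] at hdeg2
    have hσe : σ = 1 := by
      by_contra hne
      have : 2 * n ≤ σ * n := Nat.mul_le_mul_right _ (by omega)
      omega
    rw [hσe, one_mul] at hdeg2
    rw [hσe, mul_one] at hσ
    have hdA : A.natDegree ≤ p := by
      by_contra hlt
      have : p * (p + 1) ≤ p * A.natDegree := Nat.mul_le_mul_left _ (by omega)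
      have e : p * (p + 1) = p ^ 2 + p := by ring
      omega
    have hκ0 : κ = 0 := by
      by_contra hne
      have e : (derivative A).natDegree = (B ^ p * C κ).natDegree := by
        rw [eq_neg_of_add_eq_zero_left hstar', natDegree_neg]
      rw [natDegree_mul_C hne, natDegree_pow, hBB, hb1e, mul_one] at e
      have := natDegree_derivative_le A
      have h8 : 2 * p ≤ p * p := Nat.mul_le_mul_right _ h2
      omega
    rw [hκ0, C_0] at hζ'C
    rw [hκ0, C_0, mul_zero, add_zero] at hstar'
    obtain ⟨A1, hA1⟩ := pth_root p A hstar'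
    obtain ⟨ξ, hξ⟩ := pth_root p ζ hζ'C
    have hξd : ξ.natDegree = 1 := by
      rw [hξ, natDegree_pow] at hσ
      exact Nat.eq_of_mul_eq_mul_left (by omega : 0 < p) (by omega)
    have hA1d : A1.natDegree ≤ 1 := by
      rw [hA1, natDegree_pow] at hdA
      exact Nat.le_of_mul_le_mul_left (by omega) (by omega : 0 < p)
    refine caseN_p2 hcard F hn A1 B1 ξ hA1d (by omega) hξd ?_ ?_ (F.eval 0) ?_
    · conv_lhs => rw [hAB, hA1, hB1]
      rw [← pow_mul, ← pow_mul, pow_two]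
    · apply eq_zero_of_pow_eq_zero (n := p)
      rw [add_pow_char, add_pow_char, mul_pow, ← pow_mul, ← pow_succ, ← hA1, ← hB1, ← pow_comp, ← hξ]
      exact hstar
    · have := hγ0 _ (F0_mem F)
      rw [hξ, eval_pow, ← pow_mul, ← pow_two] at this
      exact this

end caseN3

section rev
set_option linter.unusedSectionVars false
set_option linter.unusedSimpArgs false
set_option linter.unusedVariables false
variable {K : Type} [Field K] [Fintype K] [DecidableEq K]

theorem valueSet_nonconst (F : K[X]) (h : 3 ≤ (valueSet F).card) : 0 < F.natDegree := by
  rcases Nat.eq_zero_or_pos F.natDegree with h0 | h0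
  · exfalso
    rw [eq_C_of_natDegree_eq_zero h0] at h
    have : valueSet (C (F.coeff 0) : K[X]) ⊆ {F.coeff 0} := by
      intro y hy
      simp only [valueSet, Finset.mem_image] at hy
      obtain ⟨a, -, rfl⟩ := hy
      simp
    have := Finset.card_le_card this
    simp at this; omega
  · exact h0

theorem mvsp_of_le (F : K[X]) (h : 3 ≤ (valueSet F).card)
    (h1 : ((valueSet F).card - 1) * F.natDegree ≤ Fintype.card K - 1) : IsMVSP F := by
  have hn := valueSet_nonconst F h
  refine ⟨hn, ?_⟩
  have hq : Fintype.card K ≤ F.natDegree * (valueSet F).card := by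
    have := FiniteField.card_image_polynomial_eval (R := K) (p := F) (natDegree_pos_iff_degree_pos.1 hn)
    exact this
  have hq0 : 0 < Fintype.card K := Fintype.card_pos
  have a1 : (valueSet F).card - 1 ≤ (Fintype.card K - 1) / F.natDegree := (Nat.le_div_iff_mul_le hn).2 h1
  have a2 : (Fintype.card K - 1) / F.natDegree < (valueSet F).card := by
    rw [Nat.div_lt_iff_lt_mul hn, mul_comm]; omega
  omega

theorem le_of_mvsp (F : K[X]) (h : IsMVSP F) :
    ((valueSet F).card - 1) * F.natDegree ≤ Fintype.card K - 1 := by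
  rw [h.2, Nat.add_sub_cancel]; exact Nat.div_mul_le_self _ _

theorem count_le (F H : K[X]) (hH : H ≠ 0) (h : ∀ x, H.eval (F.eval x) = 0) : (valueSet F).card ≤ H.natDegree := by
  apply card_le_degree_of_subset_roots (p := H)
  intro y hy
  have hy : y ∈ valueSet F := hy
  simp only [valueSet, Finset.mem_image] at hy
  obtain ⟨a, -, rfl⟩ := hy
  exact (mem_roots hH).2 (h a)

theorem affine_inv (F : K[X]) (α β γ δ : K) (hα : α ≠ 0) (hγ : γ ≠ 0) :
    (valueSet (C γ * F.comp (C α * X + C β) + C δ)).card = (valueSet F).card ∧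
    (C γ * F.comp (C α * X + C β) + C δ).natDegree = F.natDegree := by
  constructor
  · have : valueSet (C γ * F.comp (C α * X + C β) + C δ) = (valueSet F).image (fun y => γ * y + δ) := by
      ext y
      simp only [valueSet, Finset.mem_image, Finset.mem_univ, true_and, eval_add, eval_mul, eval_C, eval_comp, eval_X, exists_exists_eq_and]
      constructor
      · rintro ⟨a, rfl⟩; exact ⟨_, rfl⟩
      · rintro ⟨a, rfl⟩
        refine ⟨(a - β) / α, ?_⟩
        rw [mul_div_cancel₀ _ hα]; simp
    rw [this, Finset.card_image_of_injective]
    intro a b hab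
    exact mul_left_cancel₀ hγ (add_right_cancel hab)
  · rw [natDegree_add_C, natDegree_C_mul hγ, natDegree_comp, natDegree_linear hα, mul_one]

theorem rev_pow (g : K[X]) (P t : ℕ) (hP : 2 ≤ P) (ht : t ∣ P - 1) (h : ∀ x, g.eval x ^ P = g.eval x)
    (hd : (P - 1) * g.natDegree ≤ Fintype.card K - 1) :
    ((valueSet (g ^ t)).card - 1) * (g ^ t).natDegree ≤ Fintype.card K - 1 := by
  obtain ⟨e, he⟩ := ht
  have ht0 : t ≠ 0 := by rintro rfl; omega
  have he0 : e ≠ 0 := by rintro rfl; omega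
  have hH : (X ^ (e + 1) - X : K[X]).natDegree = e + 1 := by
    rw [natDegree_sub_eq_left_of_natDegree_lt] <;> simp; omega
  have hc := count_le (g ^ t) (X ^ (e + 1) - X) (by intro h0; rw [h0] at hH; simp at hH) (by
    intro x
    simp only [eval_sub, eval_pow, eval_X]
    rw [← pow_mul, mul_add, mul_one, ← he, sub_eq_zero]
    have : P - 1 + t = P + (t - 1) := by omega
    rw [this, pow_add, h x, ← pow_succ', show t - 1 + 1 = t by omega])
  rw [hH] at hc
  refine le_trans ?_ hd
  rw [natDegree_pow, he]
  calc _ ≤ e * (t * g.natDegree) := Nat.mul_le_mul_right _ (by omega)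
    _ = _ := by ring

theorem rev_lin (p : ℕ) (hp : 2 ≤ p) (L : K[X]) (v D : ℕ) (c0 c1 c2 c3 : K) (hc0 : c0 ≠ 0) (hv : v ∣ p - 1)
    (h : ∀ x, c0 * L.eval x + c1 * L.eval x ^ p + c2 * L.eval x ^ p ^ 2 + c3 * L.eval x ^ p ^ 3 = 0)
    (hD : (c3 = 0 ∧ L.natDegree ≤ p ^ 2) ∨ L.natDegree ≤ p) (hcard : Fintype.card K = p ^ 4) :
    ((valueSet (L ^ v)).card - 1) * (L ^ v).natDegree ≤ Fintype.card K - 1 := by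
  obtain ⟨e, he⟩ := hv
  have hv0 : v ≠ 0 := by rintro rfl; omega
  have he0 : e ≠ 0 := by rintro rfl; omega
  have hpe : p = v * e + 1 := by omega
  have q1 : v * (e + 1) = p + (v - 1) := by rw [mul_add]; omega
  have q2 : v * (e * (p + 1) + 1) = p ^ 2 + (v - 1) := by
    have : v * (e * (p + 1) + 1) = (v * e) * (p + 1) + v := by ring
    rw [this, ← he]
    obtain ⟨m, rfl⟩ : ∃ m, p = m + 1 := ⟨p - 1, by omega⟩
    obtain ⟨w, rfl⟩ : ∃ m, v = m + 1 := ⟨v - 1, by omega⟩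
    simp; ring
  have q3 : v * (e * (p ^ 2 + p + 1) + 1) = p ^ 3 + (v - 1) := by
    have : v * (e * (p ^ 2 + p + 1) + 1) = (v * e) * (p ^ 2 + p + 1) + v := by ring
    rw [this, ← he]
    obtain ⟨m, rfl⟩ : ∃ m, p = m + 1 := ⟨p - 1, by omega⟩
    obtain ⟨w, rfl⟩ : ∃ m, v = m + 1 := ⟨v - 1, by omega⟩
    simp; ring
  have l1 : e + 1 ≤ e * (p + 1) + 1 := by nlinarith
  have l2 : e * (p + 1) + 1 ≤ e * (p ^ 2 + p + 1) + 1 := by nlinarith [Nat.zero_le (e * p ^ 2)]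
  have le0 : 1 ≤ e * (p + 1) := Nat.mul_pos (by omega) (by omega)
  have le1 : 1 ≤ e * (p ^ 2 + p + 1) := Nat.mul_pos (by omega) (by omega)
  set H : K[X] := C c0 * X + C c1 * X ^ (e + 1) + C c2 * X ^ (e * (p + 1) + 1) + C c3 * X ^ (e * (p ^ 2 + p + 1) + 1) with hH
  have hH1 : H.coeff 1 = c0 := by
    rw [hH]
    simp only [coeff_add, coeff_C_mul, coeff_X_one, coeff_X_pow]
    rw [if_neg (by omega), if_neg (by omega), if_neg (by omega)]; ring
  have hc := count_le (L ^ v) H (by rintro h0; rw [h0] at hH1; simp at hH1; exact hc0 hH1.symm) (by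
    intro x
    simp only [hH, eval_add, eval_mul, eval_C, eval_pow, eval_X, ← pow_mul]
    rw [q1, q2, q3]
    have hy : L.eval x ^ v = L.eval x * L.eval x ^ (v - 1) := by rw [← pow_succ']; congr 1; omega
    rw [hy]; simp only [pow_add]
    linear_combination L.eval x ^ (v - 1) * h x)
  have b2 : (C c0 * X + C c1 * X ^ (e + 1) + C c2 * X ^ (e * (p + 1) + 1) : K[X]).natDegree ≤ e * (p + 1) + 1 := by
    refine natDegree_add_le_of_degree_le (natDegree_add_le_of_degree_le ?_ ?_) ?_
    · exact (natDegree_C_mul_X_le _).trans (by omega)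
    · exact (natDegree_C_mul_X_pow_le _ _).trans l1
    · exact natDegree_C_mul_X_pow_le _ _
  rw [natDegree_pow, hcard]
  rcases hD with ⟨h3, hL⟩ | hL
  · have : H.natDegree ≤ e * (p + 1) + 1 := by
      rw [hH, h3, C_0, zero_mul, add_zero]; exact b2
    calc _ ≤ (e * (p + 1)) * (v * p ^ 2) := Nat.mul_le_mul (by omega) (Nat.mul_le_mul_left _ hL)
      _ = (v * e) * ((p + 1) * p ^ 2) := by ring
      _ ≤ _ := by
        rw [← he]
        obtain ⟨m, rfl⟩ : ∃ m, p = m + 1 := ⟨p - 1, by omega⟩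
        simp only [Nat.add_sub_cancel]
        apply Nat.le_sub_of_add_le
        nlinarith [Nat.zero_le (m ^ 2)]
  · have : H.natDegree ≤ e * (p ^ 2 + p + 1) + 1 := by
      rw [hH]
      refine natDegree_add_le_of_degree_le (b2.trans l2) (natDegree_C_mul_X_pow_le _ _)
    calc _ ≤ (e * (p ^ 2 + p + 1)) * (v * p) := Nat.mul_le_mul (by omega) (Nat.mul_le_mul_left _ hL)
      _ = (v * e) * ((p ^ 2 + p + 1) * p) := by ring
      _ ≤ _ := by
        rw [← he]
        obtain ⟨m, rfl⟩ : ∃ m, p = m + 1 := ⟨p - 1, by omega⟩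
        simp only [Nat.add_sub_cancel]
        apply Nat.le_sub_of_add_le
        nlinarith [Nat.zero_le (m ^ 2)]

set_option maxHeartbeats 1000000 in
theorem rev_typ {p : ℕ} [hp : Fact p.Prime] [CharP K p] (hcard : Fintype.card K = p ^ 4) (G : K[X]) (h : Typ p G) :
    ((valueSet G).card - 1) * G.natDegree ≤ Fintype.card K - 1 := by
  have h2 := hp.out.two_le
  have hp0 := hp.out.ne_zero
  have hfr : ∀ x : K, x ^ p ^ 4 = x := fun x => by rw [← hcard]; exact FiniteField.pow_card x
  have f1 : ∀ x : K, (x ^ p) ^ p = x ^ p ^ 2 := fun x => by rw [← pow_mul, ← pow_two]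
  have f2 : ∀ x : K, (x ^ p ^ 2) ^ p = x ^ p ^ 3 := fun x => by rw [← pow_mul, ← pow_succ]
  have f3 : ∀ x : K, (x ^ p ^ 3) ^ p = x := fun x => by rw [← pow_mul, ← pow_succ, hfr]
  have f4 : ∀ x : K, (x ^ p ^ 2) ^ p ^ 2 = x := fun x => by rw [← pow_mul, ← pow_add, hfr]
  have m1 : p ≤ p ^ 2 := Nat.le_self_pow (by norm_num) p
  have m2 : p ^ 2 ≤ p ^ 3 := Nat.pow_le_pow_right (by omega) (by norm_num)
  rcases h with ⟨v, hv, -, rfl⟩ | ⟨t, g, ht, -, -, hs, rfl⟩ | ⟨t, g, ht, -, -, ⟨a, b, c, ha, hc, hg⟩, rfl⟩ | ⟨β, v, hβ, hv, rfl⟩ | ⟨v, hv, rfl⟩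
  · refine rev_pow X (p ^ 4) v ?_ hv ?_ ?_
    · exact (Nat.le_self_pow (by norm_num) p).trans' h2
    · intro x; simpa using hfr x
    · rw [natDegree_X, hcard]; omega
  · obtain ⟨a, b, c, d, e, f, ha, hf, hd, hg⟩ := hs
    refine rev_pow g p t h2 ht ?_ ?_
    · intro x
      rw [hg]
      simp only [eval_add, eval_mul, eval_C, eval_pow, eval_X]
      simp only [pow_add, pow_one, add_pow_char, mul_pow, f1, f2, f3, ha, hf, hd]
      ring
    · have : g.natDegree ≤ p ^ 3 + p ^ 2 + p + 1 := by
        rw [hg]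
        iterate 15 refine natDegree_add_le_of_degree_le ?_ ?_
        rotate_left 15
        · rw [natDegree_C]; omega
        rotate_left 12
        · refine (natDegree_C_mul_X_le _).trans ?_; omega
        all_goals (refine (natDegree_C_mul_X_pow_le _ _).trans ?_; omega)
      refine (Nat.mul_le_mul_left _ this).trans ?_
      rw [hcard]
      obtain ⟨m, rfl⟩ : ∃ m, p = m + 1 := ⟨p - 1, by omega⟩
      simp only [Nat.add_sub_cancel]
      apply Nat.le_sub_of_add_le
      apply le_of_eq; ring
  · refine rev_pow g (p ^ 2) t (by omega) ht ?_ ?_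
    · intro x
      rw [hg]
      simp only [eval_add, eval_mul, eval_C, eval_pow, eval_X]
      simp only [pow_add, pow_one, add_pow_char_pow, mul_pow, f4, ha, hc]
      ring
    · have : g.natDegree ≤ p ^ 2 + 1 := by
        rw [hg]
        iterate 3 refine natDegree_add_le_of_degree_le ?_ ?_
        rotate_left 3
        · rw [natDegree_C]; omega
        rotate_left 2
        · refine (natDegree_C_mul_X_le _).trans ?_; omega
        all_goals (refine (natDegree_C_mul_X_pow_le _ _).trans ?_; omega)
      refine (Nat.mul_le_mul_left _ this).trans ?_
      rw [hcard, show p ^ 4 = (p ^ 2) ^ 2 by ring]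
      have hm : 1 ≤ p ^ 2 := by omega
      obtain ⟨m, hm⟩ : ∃ m, p ^ 2 = m + 1 := ⟨p ^ 2 - 1, by omega⟩
      rw [hm]
      simp only [Nat.add_sub_cancel]
      apply Nat.le_sub_of_add_le
      apply le_of_eq; ring
  · set θ := β ^ p - β with hθ
    have hθ0 : θ ≠ 0 := sub_ne_zero.2 hβ
    have t1 : θ ^ p = β ^ p ^ 2 - β ^ p := by rw [hθ, sub_pow_char, f1]
    have t2 : θ ^ p ^ 2 = β ^ p ^ 3 - β ^ p ^ 2 := by rw [← f1, t1, sub_pow_char, f1, f2]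
    have t3 : θ ^ p ^ 3 = β - β ^ p ^ 3 := by rw [← f2, t2, sub_pow_char, f3, f2]
    have htr : θ + θ ^ p + θ ^ p ^ 2 + θ ^ p ^ 3 = 0 := by rw [t1, t2, t3, hθ]; ring
    rw [← t2]
    have hpow : ∀ y : K, y ≠ 0 → y ^ (p - 1) = y ^ p / y := by
      intro y hy
      rw [eq_div_iff hy, ← pow_succ]; congr 1; omega
    rw [hpow θ hθ0, hpow _ (pow_ne_zero _ hθ0), f2]
    have n1 := pow_ne_zero p hθ0
    have n2 := pow_ne_zero (p ^ 2) hθ0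
    have n3 := pow_ne_zero (p ^ 3) hθ0
    refine rev_lin p h2 _ v 0 (θ ^ p) (-(θ + θ ^ p)) θ 0 n1 hv ?_ (Or.inl ⟨rfl, ?_⟩) hcard
    · intro x
      simp only [eval_add, eval_sub, eval_mul, eval_C, eval_pow, eval_X]
      have e1 : (x ^ p ^ 2 + (1 + θ ^ p ^ 3 / θ ^ p ^ 2) * x ^ p - (θ ^ p / θ)⁻¹ * x) ^ p
          = x ^ p ^ 3 + (1 + θ / θ ^ p ^ 3) * x ^ p ^ 2 - (θ ^ p ^ 2 / θ ^ p)⁻¹ * x ^ p := by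
        rw [sub_pow_char, add_pow_char, mul_pow, mul_pow, add_pow_char, inv_pow, div_pow, div_pow, one_pow, f1, f1, f2, f2, f3]
      have e2 : (x ^ p ^ 2 + (1 + θ ^ p ^ 3 / θ ^ p ^ 2) * x ^ p - (θ ^ p / θ)⁻¹ * x) ^ p ^ 2
          = x + (1 + θ ^ p / θ) * x ^ p ^ 3 - (θ ^ p ^ 3 / θ ^ p ^ 2)⁻¹ * x ^ p ^ 2 := by
        rw [← f1, e1, sub_pow_char, add_pow_char, mul_pow, mul_pow, add_pow_char, inv_pow, div_pow, div_pow, one_pow, f1, f1, f2, f2, f3, f3]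
      rw [e1, e2]
      generalize θ ^ p = a1 at *
      generalize θ ^ p ^ 2 = a2 at *
      generalize θ ^ p ^ 3 = a3 at *
      have : θ = -(a1 + a2 + a3) := by linear_combination htr
      have i1 : (a1 / θ)⁻¹ = θ / a1 := inv_div _ _
      have i2 : (a2 / a1)⁻¹ = a1 / a2 := inv_div _ _
      have i3 : (a3 / a2)⁻¹ = a2 / a3 := inv_div _ _
      rw [i1, i2, i3]
      have n3' := n3
      field_simp
      linear_combination (x ^ p * a1 * a3 - x ^ p ^ 2 * θ * a2) * htr
    · refine (natDegree_sub_le _ _).trans (max_le (natDegree_add_le_of_degree_le ?_ ?_) ?_)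
      · simp
      · exact (natDegree_C_mul_X_pow_le _ _).trans m1
      · exact (natDegree_C_mul_X_le _).trans (by omega)
  · refine rev_lin p h2 _ v 0 1 1 1 1 one_ne_zero hv ?_ (Or.inr ?_) hcard
    · intro x
      simp only [eval_sub, eval_pow, eval_X]
      have e1 : (x ^ p - x) ^ p = x ^ p ^ 2 - x ^ p := by rw [sub_pow_char, f1]
      have e2 : (x ^ p - x) ^ p ^ 2 = x ^ p ^ 3 - x ^ p ^ 2 := by rw [← f1, e1, sub_pow_char, f1, f2]
      have e3 : (x ^ p - x) ^ p ^ 3 = x - x ^ p ^ 3 := by rw [← f2, e2, sub_pow_char, f2, f3]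
      rw [e1, e2, e3]; ring
    · refine (natDegree_sub_le _ _).trans (max_le ?_ ?_)
      · simp
      · rw [natDegree_X]; omega

theorem main_iff (p : ℕ) (hp : p.Prime) (hcard : Fintype.card K = p ^ 4)
    (P : K[X]) (hV : 3 ≤ (valueSet P).card) : IsMVSP P ↔ Good p P := by
  have : Fact p.Prime := ⟨hp⟩
  have : CharP K p := by
    obtain ⟨r, hr⟩ := CharP.exists K
    have hrp : r.Prime := CharP.char_is_prime K r
    obtain ⟨n, hn, hc⟩ := FiniteField.card K r
    have hd : r ∣ p ^ 4 := by rw [← hcard, hc]; exact dvd_pow_self _ (by positivity)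
    have : r = p := (Nat.prime_dvd_prime_iff_eq hrp hp).1 (hrp.dvd_of_dvd_pow hd)
    rwa [this] at hr
  constructor
  · intro h
    have h1 := le_of_mvsp P h
    obtain ⟨c, hc, hF', -, hA, hB, hC, hD⟩ := partA P h.1 h1 hV
    by_cases hall : ∀ g ∈ valueSet P, cf P g = c
    · exact caseN hcard P h.1 h1 hV c hc hF' hA hB hC hD hall
    · push Not at hall
      obtain ⟨γ, hγ, hne⟩ := hall
      exact caseE hcard P h.1 h1 hV c hc hF' hA hB hD γ hγ hne
  · rintro ⟨α, β, γ, δ, hα, hγ, G, rfl, hT⟩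
    have h1 := rev_typ hcard _ hT
    obtain ⟨a1, a2⟩ := affine_inv P α β γ δ hα hγ
    rw [a1, a2] at h1
    exact mvsp_of_le P hV h1

end rev

/-- classification of MVSPs over `𝔽_{p^4}` with `#V_F ≥ 3`, up to pre- and
post-composition with affine maps. -/
theorem stmt_9 (p : ℕ) (hp : p.Prime)
    (K : Type) [Field K] [Fintype K] [DecidableEq K]
    (hcard : Fintype.card K = p ^ 4)
    (P : K[X]) (hV : 3 ≤ (valueSet P).card) :
    IsMVSP P ↔
      ∃ α β γ δ : K, α ≠ 0 ∧ γ ≠ 0 ∧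
        ∃ G : K[X], G = C γ * P.comp (C α * X + C β) + C δ ∧
          ((∃ v : ℕ, v ∣ p ^ 4 - 1 ∧ v ≠ p ^ 4 - 1 ∧ G = X ^ v) ∨
          (∃ (t : ℕ) (g : K[X]), t ∣ p - 1 ∧ t ≠ p - 1 ∧ 0 < g.natDegree ∧
            (∃ a b c d e f : K, a ^ p = a ∧ f ^ p = f ∧ d ^ p ^ 2 = d ∧
              g = C a * X ^ (p ^ 3 + p ^ 2 + p + 1) + C b * X ^ (p ^ 3 + p ^ 2 + p)
                + C (b ^ p) * X ^ (p ^ 3 + p ^ 2 + 1) + C (b ^ p ^ 2) * X ^ (p ^ 3 + p + 1)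
                + C (b ^ p ^ 3) * X ^ (p ^ 2 + p + 1) + C c * X ^ (p ^ 3 + p ^ 2)
                + C (c ^ p) * X ^ (p ^ 3 + 1) + C (c ^ p ^ 2) * X ^ (p + 1)
                + C (c ^ p ^ 3) * X ^ (p ^ 2 + p) + C d * X ^ (p ^ 3 + p)
                + C (d ^ p) * X ^ (p ^ 2 + 1) + C e * X ^ p ^ 3 + C (e ^ p) * X
                + C (e ^ p ^ 2) * X ^ p + C (e ^ p ^ 3) * X ^ p ^ 2 + C f) ∧
            G = g ^ t) ∨
          (∃ (t : ℕ) (g : K[X]), t ∣ p ^ 2 - 1 ∧ t ≠ p ^ 2 - 1 ∧ 0 < g.natDegree ∧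
            (∃ a b c : K, a ^ p ^ 2 = a ∧ c ^ p ^ 2 = c ∧
              g = C a * X ^ (p ^ 2 + 1) + C b * X ^ p ^ 2 + C (b ^ p ^ 2) * X + C c) ∧
            G = g ^ t) ∨
          (∃ (β₀ : K) (v : ℕ), β₀ ^ p ≠ β₀ ∧ v ∣ p - 1 ∧
            G = (X ^ p ^ 2 + C (1 + (β₀ ^ p ^ 3 - β₀ ^ p ^ 2) ^ (p - 1)) * X ^ p
              - C (((β₀ ^ p - β₀) ^ (p - 1))⁻¹) * X) ^ v) ∨
          (∃ v : ℕ, v ∣ p - 1 ∧ G = (X ^ p - X) ^ v)) := by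
  exact main_iff p hp hcard P hV
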